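/- Let s be an integer with 1 ≤ s ≤ 56 and let ε > 0. For all real numbers β₁, …, β_s and all sufficiently large N (in terms of s and ε), there exist integers n₁, …, n_s with 0 ≤ n_i ≤ N for each i and (n₁, …, n_s) ≠ (0, …, 0), such that ‖β₁ n₁⁶ + ⋯ + β_s n_s⁶‖ ≤ C(s,ε) · N^{−s/30 + ε}, where C(s,ε) depends only on s and ε. -/

import Mathlib

/-- Distance from a real number to the nearest integer. -/
noncomputable def nearestIntDist (x : ℝ) : ℝ := |x - round x|



namespace SFP
open Finset

/-- Finite Minkowski inequality for sums. -/
lemma minkowski_sum {T C : Type*} [Fintype T] (J : Finset C) (s : ℕ) (hs : 1 ≤ s)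
    (u : C → T → ℝ) (hu : ∀ c t, 0 ≤ u c t) :
    ∑ t, (∑ c ∈ J, u c t) ^ s ≤ (∑ c ∈ J, (∑ t, (u c t) ^ s) ^ ((s : ℝ)⁻¹)) ^ s := by
  classical
  have hs0 : (s : ℝ) ≠ 0 := by positivity
  have key : (∑ t, (∑ c ∈ J, u c t) ^ s) ^ ((s : ℝ)⁻¹)
      ≤ ∑ c ∈ J, (∑ t, (u c t) ^ s) ^ ((s : ℝ)⁻¹) := by
    induction J using Finset.induction_on with
    | empty =>
      have : s ≠ 0 := by omega
      simp [this, Real.zero_rpow (inv_ne_zero hs0)]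
    | insert c J hc ih =>
      rw [Finset.sum_insert hc]
      have h := Real.Lp_add_le (s := (Finset.univ : Finset T)) (f := u c)
        (g := fun t => ∑ c ∈ J, u c t) (p := (s : ℝ)) (by exact_mod_cast hs)
      have e1 : ∀ t, |u c t + ∑ c ∈ J, u c t| ^ (s : ℝ) = (∑ c ∈ insert c J, u c t) ^ s := by
        intro t
        rw [Real.rpow_natCast, Finset.sum_insert hc, abs_of_nonneg]
        exact add_nonneg (hu _ _) (Finset.sum_nonneg fun _ _ => hu _ _)
      have e2 : ∀ t, |u c t| ^ (s : ℝ) = (u c t) ^ s := by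
        intro t
        rw [Real.rpow_natCast, abs_of_nonneg (hu _ _)]
      have e3 : ∀ t, |∑ c ∈ J, u c t| ^ (s : ℝ) = (∑ c ∈ J, u c t) ^ s := by
        intro t
        rw [Real.rpow_natCast, abs_of_nonneg (Finset.sum_nonneg fun _ _ => hu _ _)]
      simp only [e1, e2, e3, one_div] at h
      linarith
  have h0 : 0 ≤ ∑ t, (∑ c ∈ J, u c t) ^ s :=
    Finset.sum_nonneg fun t _ => pow_nonneg (Finset.sum_nonneg fun _ _ => hu _ _) _
  calc ∑ t, (∑ c ∈ J, u c t) ^ s = ((∑ t, (∑ c ∈ J, u c t) ^ s) ^ ((s : ℝ)⁻¹)) ^ s := by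
        rw [Real.rpow_inv_natCast_pow h0 (by omega)]
    _ ≤ _ := by
        gcongr

/-- Localisation. -/
lemma loc {G H C : Type*} [AddCommGroup G] [Fintype G] [Fintype H] [Nonempty H] [Fintype C]
    (w f : G → ℝ) (fc : C → G → ℝ) (ι : H → G) (s P : ℕ) (hs : 1 ≤ s) (K : ℝ) (hK : 0 ≤ K)
    (hw : ∀ t, 0 ≤ w t) (hfc : ∀ c t, 0 ≤ fc c t)
    (hinv : ∀ t h, w (t + ι h) = w t)
    (hloc : ∀ t, ∑ h, f (t + ι h) ^ P ≤
      K * (∑ c, (∑ h, fc c (t + ι h) ^ P) ^ ((s : ℝ)⁻¹)) ^ s) :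
    ∑ t, w t * f t ^ P ≤ K * (∑ c, (∑ t, w t * fc c t ^ P) ^ ((s : ℝ)⁻¹)) ^ s := by
  have hcard : (0 : ℝ) < Fintype.card H := by exact_mod_cast Fintype.card_pos
  have avg : ∀ g : G → ℝ, (Fintype.card H : ℝ) * ∑ t, w t * g t
      = ∑ t, w t * ∑ h, g (t + ι h) := by
    intro g
    have : ∀ h, ∑ t, w t * g t = ∑ t, w t * g (t + ι h) := by
      intro h
      rw [← Equiv.sum_comp (Equiv.addRight (ι h))]
      simp [hinv]
    calc (Fintype.card H : ℝ) * ∑ t, w t * g t = ∑ h : H, ∑ t, w t * g t := by simp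
      _ = ∑ h : H, ∑ t, w t * g (t + ι h) := Finset.sum_congr rfl fun h _ => this h
      _ = _ := by rw [Finset.sum_comm]; simp [Finset.mul_sum]
  have hg0 : ∀ c t, 0 ≤ ∑ h, fc c (t + ι h) ^ P :=
    fun c t => Finset.sum_nonneg fun _ _ => pow_nonneg (hfc _ _) _
  have main : (Fintype.card H : ℝ) * ∑ t, w t * f t ^ P ≤
      (Fintype.card H : ℝ) * (K * (∑ c, (∑ t, w t * fc c t ^ P) ^ ((s : ℝ)⁻¹)) ^ s) := by
    calc (Fintype.card H : ℝ) * ∑ t, w t * f t ^ P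
        = ∑ t, w t * ∑ h, f (t + ι h) ^ P := avg (fun t => f t ^ P)
      _ ≤ ∑ t, w t * (K * (∑ c, (∑ h, fc c (t + ι h) ^ P) ^ ((s : ℝ)⁻¹)) ^ s) := by
          gcongr with t
          · exact hw t
          · exact hloc t
      _ = K * ∑ t, (∑ c, (w t * ∑ h, fc c (t + ι h) ^ P) ^ ((s : ℝ)⁻¹)) ^ s := by
          rw [Finset.mul_sum]
          refine Finset.sum_congr rfl fun t _ => ?_
          have : ∀ c, (w t * ∑ h, fc c (t + ι h) ^ P) ^ ((s : ℝ)⁻¹)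
              = (w t) ^ ((s : ℝ)⁻¹) * (∑ h, fc c (t + ι h) ^ P) ^ ((s : ℝ)⁻¹) :=
            fun c => Real.mul_rpow (hw t) (hg0 c t)
          simp only [this, ← Finset.mul_sum, mul_pow]
          rw [Real.rpow_inv_natCast_pow (hw t) (by omega)]
          ring
      _ ≤ K * (∑ c, (∑ t, ((w t * ∑ h, fc c (t + ι h) ^ P) ^ ((s : ℝ)⁻¹)) ^ s)
            ^ ((s : ℝ)⁻¹)) ^ s := by
          gcongr
          exact minkowski_sum Finset.univ s hs _
            (fun c t => Real.rpow_nonneg (mul_nonneg (hw t) (hg0 c t)) _)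
      _ = K * (∑ c, ((Fintype.card H : ℝ) * ∑ t, w t * fc c t ^ P) ^ ((s : ℝ)⁻¹)) ^ s := by
          congr 2
          refine Finset.sum_congr rfl fun c _ => ?_
          congr 1
          rw [avg (fun t => fc c t ^ P)]
          refine Finset.sum_congr rfl fun t _ => ?_
          rw [Real.rpow_inv_natCast_pow (mul_nonneg (hw t) (hg0 c t)) (by omega)]
      _ = _ := by
          have : ∀ c, ((Fintype.card H : ℝ) * ∑ t, w t * fc c t ^ P) ^ ((s : ℝ)⁻¹)
              = (Fintype.card H : ℝ) ^ ((s : ℝ)⁻¹) * (∑ t, w t * fc c t ^ P) ^ ((s : ℝ)⁻¹) :=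
            fun c => Real.mul_rpow hcard.le
              (Finset.sum_nonneg fun t _ => mul_nonneg (hw t) (pow_nonneg (hfc _ _) _))
          simp only [this, ← Finset.mul_sum, mul_pow]
          rw [Real.rpow_inv_natCast_pow hcard.le (by omega)]
          ring
  exact le_of_mul_le_mul_left main hcard

/-- Refinement of partitions. -/
lemma refine_sum {L A B : Type*} [Fintype A] [Fintype B] [DecidableEq A] [DecidableEq B]
    (S : Finset L) (κ1 : L → A) (κ2 : L → B) (φ : Finset L → ℝ) (h0 : φ ∅ = 0)
    (hdet : ∀ m ∈ S, ∀ m' ∈ S, κ2 m = κ2 m' → κ1 m = κ1 m') :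
    ∑ c, φ (S.filter fun m => κ2 m = c)
      = ∑ a, ∑ c, φ ((S.filter fun m => κ1 m = a).filter fun m => κ2 m = c) := by
  rw [Finset.sum_comm]
  refine Finset.sum_congr rfl fun c _ => ?_
  rcases (S.filter fun m => κ2 m = c).eq_empty_or_nonempty with he | ⟨m0, hm0⟩
  · rw [he, h0]
    symm
    refine Finset.sum_eq_zero fun a _ => ?_
    rw [Finset.filter_comm, he]
    simpa using h0
  · rw [Finset.mem_filter] at hm0
    rw [Finset.sum_eq_single (κ1 m0)]
    · congr 1
      ext m
      simp only [Finset.mem_filter]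
      constructor
      · rintro ⟨h1, h2⟩
        exact ⟨⟨h1, hdet m h1 m0 hm0.1 (h2.trans hm0.2.symm)⟩, h2⟩
      · rintro ⟨⟨h1, _⟩, h2⟩
        exact ⟨h1, h2⟩
    · intro a _ ha
      convert h0
      rw [Finset.filter_eq_empty_iff]
      intro m hm
      rw [Finset.mem_filter] at hm
      intro h2
      exact ha (hm.2.symm.trans (hdet m hm.1 m0 hm0.1 (h2.trans hm0.2.symm)))
    · simp

/-- Triangular numbers. -/
def tri : ℕ → ℕ
  | 0 => 0
  | (l + 1) => tri l + (l + 1)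

lemma two_tri (l : ℕ) : 2 * tri l = l * (l + 1) := by
  induction l with
  | zero => rfl
  | succ l ih => simp only [tri]; linarith [ih]

lemma tri_mono : Monotone tri := monotone_nat_of_le_succ fun n => by simp [tri]

lemma tri_pos {l : ℕ} (h : 1 ≤ l) : 1 ≤ tri l := by
  have := tri_mono h
  simpa [tri] using this

/-- Phase. -/
def ev {q k : ℕ} (x : Fin (k + 1) → ZMod q) (y : ZMod q) : ZMod q := ∑ j, x j * y ^ (j : ℕ)

/-- Exponential sum. -/
noncomputable def Fs (q k : ℕ) [NeZero q] (pos : ℤ → ℤ) (a : ℤ → ℂ) (S : Finset ℤ)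
    (x : Fin (k + 1) → ZMod q) : ℂ :=
  ∑ m ∈ S, a m * ZMod.stdAddChar (ev x ((pos m : ℤ) : ZMod q))

lemma Fs_empty (q k : ℕ) [NeZero q] (pos : ℤ → ℤ) (a : ℤ → ℂ) (x) :
    Fs q k pos a ∅ x = 0 := by simp [Fs]

lemma Fs_add (q k : ℕ) [NeZero q] (pos : ℤ → ℤ) (a : ℤ → ℂ) (S : Finset ℤ) (t x) :
    Fs q k pos a S (t + x) =
      ∑ m ∈ S, (a m * ZMod.stdAddChar (ev t ((pos m : ℤ) : ZMod q))) *
        ZMod.stdAddChar (ev x ((pos m : ℤ) : ZMod q)) := by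
  refine Finset.sum_congr rfl fun m _ => ?_
  have : ev (t + x) ((pos m : ℤ) : ZMod q) = ev t ((pos m : ℤ) : ZMod q)
      + ev x ((pos m : ℤ) : ZMod q) := by
    simp [ev, add_mul, Finset.sum_add_distrib]
  rw [this, AddChar.map_add_eq_mul, mul_assoc]

/-- Vector of coefficients of a polynomial. -/
def vec {q : ℕ} (k : ℕ) (Q : Polynomial (ZMod q)) : Fin (k + 1) → ZMod q := fun j => Q.coeff j

lemma ev_vec {q k : ℕ} (Q : Polynomial (ZMod q)) (hQ : Q.natDegree ≤ k) (y : ZMod q) :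
    ev (vec k Q) y = Q.eval y := by
  rw [Polynomial.eval_eq_sum_range' (n := k + 1) (by omega), Finset.sum_range]
  rfl

/-- Character compatibility. -/
lemma char_compat (p A B : ℕ) [NeZero p] (z : ℤ) :
    ZMod.stdAddChar (((p : ℤ) ^ A * z : ℤ) : ZMod (p ^ (A + B))) =
      ZMod.stdAddChar ((z : ℤ) : ZMod (p ^ B)) := by
  rw [ZMod.stdAddChar_coe, ZMod.stdAddChar_coe]
  congr 1
  have hp : (p : ℂ) ≠ 0 := by exact_mod_cast NeZero.ne p
  push_cast
  field_simp
  ring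
  

/-- The weighted norm. -/
noncomputable def Nm (p k n : ℕ) [Fact p.Prime] (pos : ℤ → ℤ) (a : ℤ → ℂ) (S : Finset ℤ) : ℝ :=
  ∑ x, ‖Fs (p ^ (k * n)) k pos a S x‖ ^ (2 * tri k)

noncomputable def Vn (p k n : ℕ) [Fact p.Prime] (pos : ℤ → ℤ) (a : ℤ → ℂ) (S : Finset ℤ) : ℝ :=
  ∑ c : ZMod (p ^ n), (Nm p k n pos a (S.filter fun m => ((pos m : ℤ) : ZMod (p ^ n)) = c))
    ^ ((tri k : ℝ)⁻¹)

def Dec (p k n : ℕ) [Fact p.Prime] (K : ℝ) : Prop :=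
  ∀ (pos : ℤ → ℤ) (a : ℤ → ℂ) (S : Finset ℤ),
    Nm p k n pos a S ≤ K * (Vn p k n pos a S) ^ (tri k)

lemma Nm_nonneg (p k n : ℕ) [Fact p.Prime] (pos a S) : 0 ≤ Nm p k n pos a S :=
  Finset.sum_nonneg fun _ _ => by positivity

lemma Vn_nonneg (p k n : ℕ) [Fact p.Prime] (pos a S) : 0 ≤ Vn p k n pos a S :=
  Finset.sum_nonneg fun _ _ => Real.rpow_nonneg (Nm_nonneg _ _ _ _ _ _) _

lemma Nm_empty (p k n : ℕ) [Fact p.Prime] (hk : 1 ≤ k) (pos a) : Nm p k n pos a ∅ = 0 := by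
  have := tri_pos hk
  simp [Nm, Fs_empty]; right; omega

end SFP


namespace SFP
open Finset

lemma loc_dec (p l d k n : ℕ) [Fact p.Prime] (hl : 1 ≤ l) (K : ℝ) (hK : 0 ≤ K) (hD : Dec p l d K)
    (pos : ℤ → ℤ) (a : ℤ → ℂ) (S : Finset ℤ) (v : ℤ → ℤ)
    (w : (Fin (k + 1) → ZMod (p ^ (k * n))) → ℝ) (hw : ∀ t, 0 ≤ w t)
    (ι : (Fin (l + 1) → ZMod (p ^ (l * d))) → (Fin (k + 1) → ZMod (p ^ (k * n))))
    (hinv : ∀ t h, w (t + ι h) = w t)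
    (hch : ∀ h, ∃ u : ℂ, ‖u‖ = 1 ∧ ∀ m ∈ S,
      ZMod.stdAddChar (ev (ι h) ((pos m : ℤ) : ZMod (p ^ (k * n)))) =
        u * ZMod.stdAddChar (ev h ((v m : ℤ) : ZMod (p ^ (l * d))))) :
    ∑ t, w t * ‖Fs (p ^ (k * n)) k pos a S t‖ ^ (2 * tri l) ≤
      K * (∑ c : ZMod (p ^ d), (∑ t, w t * ‖Fs (p ^ (k * n)) k pos a
        (S.filter fun m => ((v m : ℤ) : ZMod (p ^ d)) = c) t‖ ^ (2 * tri l))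
          ^ ((tri l : ℝ)⁻¹)) ^ (tri l) := by
  refine loc w (fun t => ‖Fs (p ^ (k * n)) k pos a S t‖)
    (fun c t => ‖Fs (p ^ (k * n)) k pos a
        (S.filter fun m => ((v m : ℤ) : ZMod (p ^ d)) = c) t‖) ι (tri l) (2 * tri l)
        (tri_pos hl) K hK hw (fun _ _ => norm_nonneg _) hinv ?_
  intro t
  set a' : ℤ → ℂ := fun m => a m * ZMod.stdAddChar (ev t ((pos m : ℤ) : ZMod (p ^ (k * n))))
    with ha'
  have key : ∀ h, ∀ S' ⊆ S, ‖Fs (p ^ (k * n)) k pos a S' (t + ι h)‖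
      = ‖Fs (p ^ (l * d)) l v a' S' h‖ := by
    intro h S' hS'
    obtain ⟨u, hu, hm⟩ := hch h
    rw [Fs_add]
    have : ∑ m ∈ S', (a m * ZMod.stdAddChar (ev t ((pos m : ℤ) : ZMod (p ^ (k * n))))) *
        ZMod.stdAddChar (ev (ι h) ((pos m : ℤ) : ZMod (p ^ (k * n))))
        = u * Fs (p ^ (l * d)) l v a' S' h := by
      rw [Fs, Finset.mul_sum]
      refine Finset.sum_congr rfl fun m hmS => ?_
      rw [hm m (hS' hmS), ha']
      ring
    rw [this, norm_mul, hu, one_mul]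
  have := hD v a' S
  simp only [Nm, Vn] at this
  simp only [key _ S subset_rfl]
  refine this.trans (le_of_eq ?_)
  congr 2
  refine Finset.sum_congr rfl fun c _ => ?_
  congr 1
  refine Finset.sum_congr rfl fun h _ => ?_
  rw [key _ _ (Finset.filter_subset _ _)]

lemma Vn_refine (p d k n : ℕ) [Fact p.Prime] (hk : 1 ≤ k)
    (pos : ℤ → ℤ) (a : ℤ → ℂ) (S : Finset ℤ) (v : ℤ → ℤ)
    (hdet : ∀ m ∈ S, ∀ m' ∈ S, ((pos m : ℤ) : ZMod (p ^ n)) = ((pos m' : ℤ) : ZMod (p ^ n)) →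
      ((v m : ℤ) : ZMod (p ^ d)) = ((v m' : ℤ) : ZMod (p ^ d))) :
    Vn p k n pos a S = ∑ c : ZMod (p ^ d), Vn p k n pos a
        (S.filter fun m => ((v m : ℤ) : ZMod (p ^ d)) = c) := by
  have hk' := tri_pos hk
  exact refine_sum S (fun m => ((v m : ℤ) : ZMod (p ^ d)))
    (fun m => ((pos m : ℤ) : ZMod (p ^ n)))
    (fun S' => (Nm p k n pos a S') ^ ((tri k : ℝ)⁻¹))
    (by rw [Nm_empty p k n hk, Real.zero_rpow]; positivity) hdet

/-- Division facts for classes. -/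
lemma class_div {p : ℕ} [Fact p.Prime] {r d n : ℕ} (hn : r + d ≤ n) {c x y vx vy : ℤ}
    (hx : x = c + p ^ r * vx) (hy : y = c + p ^ r * vy)
    (h : ((x : ℤ) : ZMod (p ^ n)) = ((y : ℤ) : ZMod (p ^ n))) :
    ((vx : ℤ) : ZMod (p ^ d)) = ((vy : ℤ) : ZMod (p ^ d)) := by
  rw [ZMod.intCast_eq_intCast_iff_dvd_sub] at h ⊢
  have hp : (p : ℤ) ≠ 0 := by exact_mod_cast (Fact.out : p.Prime).ne_zero
  have h1 : ((p : ℤ) ^ r * p ^ d) ∣ p ^ r * (vy - vx) := by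
    refine dvd_trans ?_ (a := _) (b := ((p ^ n : ℕ) : ℤ)) ?_
    · push_cast
      rw [← pow_add]
      exact pow_dvd_pow _ hn
    · have e : (p : ℤ) ^ r * (vy - vx) = y - x := by rw [hx, hy]; ring
      rw [e]; exact h
  have := (mul_dvd_mul_iff_left (pow_ne_zero r hp)).1 h1
  exact_mod_cast this

lemma class_eq {p : ℕ} [Fact p.Prime] {n : ℕ} (x y : ℤ)
    : ((x : ℤ) : ZMod (p ^ n)) = ((y : ℤ) : ZMod (p ^ n)) ↔ (p : ℤ) ^ n ∣ x - y := by
  rw [eq_comm, ZMod.intCast_eq_intCast_iff_dvd_sub]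
  push_cast; rfl

lemma Vn_single (p k n : ℕ) [Fact p.Prime] (hk : 1 ≤ k)
    (pos : ℤ → ℤ) (a : ℤ → ℂ) (S : Finset ℤ) (x : ZMod (p ^ n))
    (hx : ∀ m ∈ S, ((pos m : ℤ) : ZMod (p ^ n)) = x) :
    Vn p k n pos a S = (Nm p k n pos a S) ^ ((tri k : ℝ)⁻¹) := by
  have hk' := tri_pos hk
  rw [Vn, Finset.sum_eq_single x]
  · rw [Finset.filter_true_of_mem hx]
  · intro b _ hb
    rw [Finset.filter_false_of_mem, Nm_empty p k n hk, Real.zero_rpow (by positivity)]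
    intro m hm h
    exact hb (h.symm.trans (hx m hm))
  · simp

/-- Lemma A. -/
lemma lemA (p k n r : ℕ) [Fact p.Prime] (hk : 1 ≤ k) (hr : r ≤ n) (K : ℝ) (hK : 0 ≤ K)
    (hD : Dec p k (n - r) K) (pos : ℤ → ℤ) (a : ℤ → ℂ) (S : Finset ℤ) (c : ℤ)
    (hS : ∀ m ∈ S, (p : ℤ) ^ r ∣ pos m - c) :
    Nm p k n pos a S ≤ K * (Vn p k n pos a S) ^ (tri k) := by
  obtain ⟨d, rfl⟩ := Nat.exists_eq_add_of_le hr
  rw [Nat.add_sub_cancel_left] at hD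
  have hp : (p : ℤ) ≠ 0 := by exact_mod_cast (Fact.out : p.Prime).ne_zero
  set v : ℤ → ℤ := fun m => (pos m - c) / (p : ℤ) ^ r with hv
  have hpos : ∀ m ∈ S, pos m = c + p ^ r * v m := by
    intro m hm
    rw [hv]
    simp only
    rw [Int.mul_ediv_cancel' (hS m hm)]; ring
  let Q : (Fin (k + 1) → ZMod (p ^ (k * d))) → Polynomial (ZMod (p ^ (k * (r + d)))) := fun h =>
    ∑ j : Fin (k + 1), Polynomial.C (((h j).val : ZMod (p ^ (k * (r + d)))) *
      (p : ZMod (p ^ (k * (r + d)))) ^ (r * (k - j))) *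
      (Polynomial.X - Polynomial.C (c : ZMod (p ^ (k * (r + d))))) ^ (j : ℕ)
  have hQdeg : ∀ h, (Q h).natDegree ≤ k := by
    intro h
    refine Polynomial.natDegree_sum_le_of_forall_le _ _ fun j _ => ?_
    refine (Polynomial.natDegree_C_mul_le _ _).trans ?_
    refine (Polynomial.natDegree_pow_le).trans ?_
    have h1 : (Polynomial.X - Polynomial.C (c : ZMod (p ^ (k * (r + d))))).natDegree ≤ 1 :=
      Polynomial.natDegree_X_sub_C_le _
    have h2 : (j : ℕ) ≤ k := by omega
    nlinarith
  have main := loc_dec p k d k (r + d) hk K hK hD pos a S v (fun _ => 1) (fun _ => zero_le_one)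
    (fun h => vec k (Q h)) (fun _ _ => rfl) (by
      intro h
      refine ⟨1, by simp, fun m hm => ?_⟩
      rw [one_mul, ev_vec _ (hQdeg h)]
      have e1 : (Q h).eval ((pos m : ℤ) : ZMod (p ^ (k * (r + d)))) =
          (((p : ℤ) ^ (k * r) * ∑ j, ((h j).val : ℤ) * (v m) ^ (j : ℕ) : ℤ) :
            ZMod (p ^ (k * (r + d)))) := by
        simp only [Q, Polynomial.eval_finsetSum, Polynomial.eval_mul, Polynomial.eval_C,
          Polynomial.eval_pow, Polynomial.eval_sub, Polynomial.eval_X]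
        rw [hpos m hm]
        push_cast
        rw [Finset.mul_sum]
        refine Finset.sum_congr rfl fun j _ => ?_
        have h2 : k * r = r * (k - j) + r * j := by
          rw [← Nat.mul_add, Nat.sub_add_cancel (by omega), mul_comm]
        rw [h2, pow_add, add_sub_cancel_left, mul_pow, ← pow_mul]
        ring
      rw [e1]
      have e2 := char_compat p (k * r) (k * d) (∑ j, ((h j).val : ℤ) * (v m) ^ (j : ℕ))
      have e3 : ∀ (A B : ℕ) (z : ℤ), A = B →
        (ZMod.stdAddChar ((z : ℤ) : ZMod (p ^ A)) : ℂ) = ZMod.stdAddChar ((z : ℤ) : ZMod (p ^ B)) := by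
        intro A B z h; subst h; rfl
      rw [e3 _ _ _ (Nat.mul_add k r d), e2]
      congr 1
      simp [ev])
  simp only [one_mul] at main
  refine main.trans ?_
  gcongr
  rw [Vn_refine p d k (r + d) hk pos a S v
    (fun m hm m' hm' h => class_div le_rfl (hpos m hm) (hpos m' hm') h)]
  refine Finset.sum_le_sum fun c' _ => ?_
  rw [Vn_single p k (r + d) hk pos a _ ((c : ZMod (p ^ (r + d))) + p ^ r * (c'.val : ℕ))]
  · rfl
  · intro m hm
    rw [Finset.mem_filter] at hm
    rw [hpos m hm.1]
    have h1 : ((v m : ℤ) : ZMod (p ^ d)) = (((c'.val : ℕ) : ℤ) : ZMod (p ^ d)) := by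
      rw [hm.2]; simp
    rw [class_eq] at h1
    have h2 : ((c + (p : ℤ) ^ r * v m : ℤ) : ZMod (p ^ (r + d))) =
      ((c + (p : ℤ) ^ r * ((c'.val : ℕ) : ℤ) : ℤ) : ZMod (p ^ (r + d))) := by
      rw [class_eq, pow_add]
      have : c + (p : ℤ) ^ r * v m - (c + (p : ℤ) ^ r * ((c'.val : ℕ) : ℤ)) =
        (p : ℤ) ^ r * (v m - ((c'.val : ℕ) : ℤ)) := by ring
      rw [this]
      exact mul_dvd_mul_left _ h1
    rw [h2]; push_cast; rfl

end SFP


namespace SFP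
open Finset

lemma poly_inj (p k l M : ℕ) [Fact p.Prime] (hlk : l < k) (hpk : k < p)
    (u0 : ZMod (p ^ M)) (hu : IsUnit u0) (Q : Polynomial (ZMod (p ^ M))) (hdeg : Q.natDegree ≤ k)
    (hX : Polynomial.X ^ (k - l + 1) ∣ Q)
    (ht : ∀ j < l, (Polynomial.taylor u0 Q).coeff (j + 1) = 0) : Q = 0 := by
  have hp : p.Prime := Fact.out
  rcases Nat.eq_zero_or_pos M with rfl | hM
  · have : Subsingleton (ZMod (p ^ 0)) := by
      rw [pow_zero]; infer_instance
    exact Subsingleton.elim _ _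
  have : Nontrivial (ZMod (p ^ M)) :=
    (ZMod.nontrivial_iff).2 (by
      have := Nat.one_lt_pow hM.ne' hp.one_lt
      omega)
  have hd1 : (Polynomial.X - Polynomial.C u0) ^ l ∣ Q.derivative := by
    rw [Polynomial.X_sub_C_pow_dvd_iff, ← Polynomial.taylor_apply, Polynomial.X_pow_dvd_iff]
    intro d hd
    have := Polynomial.coeff_derivative (Polynomial.taylor u0 Q) d
    rw [ht d hd, zero_mul] at this
    have e : Polynomial.taylor u0 (Polynomial.derivative Q)
      = Polynomial.derivative (Polynomial.taylor u0 Q) := by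
      simp [Polynomial.taylor_apply, Polynomial.derivative_comp]
    rw [e, this]
  have hd2 : Polynomial.X ^ (k - l) ∣ Q.derivative := by
    rw [Polynomial.X_pow_dvd_iff] at hX ⊢
    intro d hd
    rw [Polynomial.coeff_derivative, hX (d + 1) (by omega), zero_mul]
  have hcop : IsCoprime ((Polynomial.X - Polynomial.C u0) ^ l)
      ((Polynomial.X : Polynomial (ZMod (p ^ M))) ^ (k - l)) := by
    apply IsCoprime.pow
    obtain ⟨w, hw⟩ := hu
    refine ⟨- Polynomial.C (↑w⁻¹ : ZMod (p ^ M)), Polynomial.C (↑w⁻¹ : ZMod (p ^ M)), ?_⟩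
    have : Polynomial.C (↑w⁻¹ : ZMod (p ^ M)) * Polynomial.C u0 = 1 := by
      rw [← Polynomial.C_mul, ← hw]; simp
    linear_combination this
  have hdvd := hcop.mul_dvd hd1 hd2
  have hmon : ((Polynomial.X - Polynomial.C u0) ^ l *
      (Polynomial.X : Polynomial (ZMod (p ^ M))) ^ (k - l)).Monic :=
    ((Polynomial.monic_X_sub_C u0).pow l).mul (Polynomial.monic_X.pow _)
  have hder : Q.derivative = 0 := by
    by_contra hne
    refine hmon.not_dvd_of_natDegree_lt hne ?_ hdvd
    rw [((Polynomial.monic_X_sub_C u0).pow l).natDegree_mul (Polynomial.monic_X.pow _),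
      (Polynomial.monic_X_sub_C u0).natDegree_pow, Polynomial.monic_X.natDegree_pow]
    simp only [Polynomial.natDegree_X_sub_C, Polynomial.natDegree_X, mul_one]
    have := Polynomial.natDegree_derivative_le Q
    omega
  ext j
  rw [Polynomial.coeff_zero]
  rcases j with _ | j
  · rw [Polynomial.X_pow_dvd_iff] at hX
    exact hX 0 (by omega)
  · by_cases hj : j + 1 ≤ k
    · have h1 := Polynomial.coeff_derivative Q j
      rw [hder, Polynomial.coeff_zero] at h1
      have hun : IsUnit ((j : ZMod (p ^ M)) + 1) := by
        have : ((j + 1 : ℕ) : ZMod (p ^ M)) = (j : ZMod (p ^ M)) + 1 := by push_cast; rfl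
        rw [← this, ZMod.isUnit_iff_coprime]
        apply Nat.Coprime.pow_right
        rw [Nat.coprime_comm, hp.coprime_iff_not_dvd]
        intro h
        have := Nat.le_of_dvd (by omega) h
        omega
      exact (hun.mul_left_eq_zero).1 h1.symm
    · exact Polynomial.coeff_eq_zero_of_natDegree_lt (by omega)

lemma poly_exists (p k l M : ℕ) [Fact p.Prime] (hl : 1 ≤ l) (hlk : l < k) (hpk : k < p)
    (u0 : ZMod (p ^ M)) (hu : IsUnit u0) (y : Fin l → ZMod (p ^ M)) :
    ∃ R : Polynomial (ZMod (p ^ M)), R.natDegree ≤ k ∧ Polynomial.X ^ (k - l + 1) ∣ R ∧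
      ∀ j : Fin l, (Polynomial.taylor u0 R).coeff (j + 1) = y j := by
  let R : (Fin l → ZMod (p ^ M)) → Polynomial (ZMod (p ^ M)) := fun z =>
    Polynomial.X ^ (k - l + 1) * ∑ i : Fin l, Polynomial.C (z i) * Polynomial.X ^ (i : ℕ)
  have hR : ∀ z, (R z).natDegree ≤ k := by
    intro z
    refine Polynomial.natDegree_mul_le.trans ?_
    have h1 : (∑ i : Fin l, Polynomial.C (z i) * Polynomial.X ^ (i : ℕ)).natDegree ≤ l - 1 := by
      refine Polynomial.natDegree_sum_le_of_forall_le _ _ fun i _ => ?_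
      refine (Polynomial.natDegree_C_mul_X_pow_le _ _).trans (by omega)
    have h2 := Polynomial.natDegree_X_pow_le (R := ZMod (p ^ M)) (k - l + 1)
    omega
  have hsub : ∀ z z', R (z - z') = R z - R z' := by
    intro z z'
    simp only [R, ← mul_sub, ← Finset.sum_sub_distrib]
    congr 1
    refine Finset.sum_congr rfl fun i _ => ?_
    simp [sub_mul]
  have hinj : Function.Injective (fun z : Fin l → ZMod (p ^ M) =>
      fun j : Fin l => (Polynomial.taylor u0 (R z)).coeff (j + 1)) := by
    intro z z' h
    have h0 : R (z - z') = 0 := by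
      refine poly_inj p k l M hlk hpk u0 hu _ (hR _) (Dvd.intro _ rfl) ?_
      intro j hj
      have := congrFun h ⟨j, hj⟩
      simp only at this
      rw [hsub, map_sub, Polynomial.coeff_sub, this, sub_self]
    funext i
    have h1 := congrArg (fun P => Polynomial.coeff P ((i : ℕ) + (k - l + 1))) h0
    simp only [R, Polynomial.coeff_zero] at h1
    rw [mul_comm, Polynomial.coeff_mul_X_pow, Polynomial.finsetSum_coeff,
      Finset.sum_eq_single i] at h1
    · rw [Polynomial.coeff_C_mul_X_pow, if_pos rfl] at h1
      exact sub_eq_zero.1 h1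
    · intro b _ hb
      rw [Polynomial.coeff_C_mul_X_pow, if_neg]
      intro h; exact hb (Fin.ext h.symm)
    · simp
  obtain ⟨z, hz⟩ := (Finite.injective_iff_surjective.1 hinj) y
  exact ⟨R z, hR z, Dvd.intro _ rfl, fun j => congrFun hz j⟩

/-- Bilinear estimates. -/
def BD (p k l r b n : ℕ) [Fact p.Prime] (K : ℝ) : Prop :=
  ∀ (pos : ℤ → ℤ) (a : ℤ → ℂ) (S1 S2 : Finset ℤ) (c1 c2 : ℤ),
    (∀ m ∈ S1, (p : ℤ) ^ r ∣ pos m - c1) → (∀ m ∈ S2, (p : ℤ) ^ b ∣ pos m - c2) →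
    ¬ (p : ℤ) ∣ c1 - c2 →
    ∑ x, ‖Fs (p ^ (k * n)) k pos a S1 x‖ ^ (2 * tri l) *
        ‖Fs (p ^ (k * n)) k pos a S2 x‖ ^ (2 * (tri k - tri l)) ≤
      K * (Vn p k n pos a S1 ^ tri l * Vn p k n pos a S2 ^ (tri k - tri l))

lemma isUnit_of_not_dvd (p M : ℕ) [Fact p.Prime] (z : ℤ) (h : ¬ (p : ℤ) ∣ z) :
    IsUnit ((z : ℤ) : ZMod (p ^ M)) := by
  have hp : p.Prime := Fact.out
  rw [ZMod.coe_int_isUnit_iff_isCoprime]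
  push_cast
  apply IsCoprime.pow_left
  exact (Nat.prime_iff_prime_int.1 hp).coprime_iff_not_dvd.2 h

lemma p_pow_zero (p M A : ℕ) [Fact p.Prime] (h : M ≤ A) : (p : ZMod (p ^ M)) ^ A = 0 := by
  rw [← Nat.cast_pow, ZMod.natCast_eq_zero_iff]
  exact pow_dvd_pow _ h

/-- The auxiliary polynomials for Lemma B. -/
lemma polyB (p k n l r d b : ℕ) [Fact p.Prime] (hl : 1 ≤ l) (hlk : l < k) (hpk : k < p)
    (h1 : l * (r + d) ≤ (k - l + 1) * b) (h2 : l * (r + d) ≤ (l + 1) * r) (h3 : r + d ≤ n)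
    (c1 c2 : ℤ) (hc : ¬ (p : ℤ) ∣ c1 - c2) (h : Fin (l + 1) → ZMod (p ^ (l * d))) :
    ∃ x : Fin (k + 1) → ZMod (p ^ (k * n)),
      (∀ v : ℤ, ev x ((c2 + p ^ b * v : ℤ) : ZMod (p ^ (k * n))) = 0) ∧
      ∃ u : ℂ, ‖u‖ = 1 ∧ ∀ v : ℤ,
        ZMod.stdAddChar (ev x ((c1 + p ^ r * v : ℤ) : ZMod (p ^ (k * n)))) =
          u * ZMod.stdAddChar (ev h ((v : ℤ) : ZMod (p ^ (l * d)))) := by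
  have hM : l * (r + d) ≤ k * n := Nat.mul_le_mul hlk.le h3
  obtain ⟨R, hRdeg, hRX, hRt⟩ := poly_exists p k l (k * n) hl hlk hpk
    ((c1 - c2 : ℤ) : ZMod (p ^ (k * n))) (isUnit_of_not_dvd p _ _ hc)
    (fun j => ((h j.succ).val : ZMod (p ^ (k * n))) * (p : ZMod (p ^ (k * n))) ^ (r * (l - (j + 1))))
  set E := k * n - l * (r + d) with hE
  set Q : Polynomial (ZMod (p ^ (k * n))) := Polynomial.C ((p : ZMod (p ^ (k * n))) ^ E) *
    R.comp (Polynomial.X - Polynomial.C (c2 : ZMod (p ^ (k * n)))) with hQ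
  have hQdeg : Q.natDegree ≤ k := by
    refine (Polynomial.natDegree_C_mul_le _ _).trans ?_
    refine (Polynomial.natDegree_comp_le).trans ?_
    have := Polynomial.natDegree_X_sub_C_le (c2 : ZMod (p ^ (k * n)))
    nlinarith
  have hQe : ∀ y, Q.eval y = (p : ZMod (p ^ (k * n))) ^ E * R.eval (y - c2) := by
    intro y; simp [hQ, Polynomial.eval_comp]
  refine ⟨vec k Q, ?_, ?_⟩
  · intro v
    rw [ev_vec _ hQdeg, hQe]
    obtain ⟨S, rfl⟩ := hRX
    push_cast
    rw [add_sub_cancel_left, Polynomial.eval_mul, Polynomial.eval_pow, Polynomial.eval_X, mul_pow,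
      ← pow_mul, ← mul_assoc, ← mul_assoc, ← pow_add, p_pow_zero, zero_mul, zero_mul]
    have : b * (k - l + 1) = (k - l + 1) * b := mul_comm _ _
    omega
  · set T := Polynomial.taylor ((c1 - c2 : ℤ) : ZMod (p ^ (k * n))) R with hT
    refine ⟨ZMod.stdAddChar ((p : ZMod (p ^ (k * n))) ^ E * T.coeff 0) *
      ZMod.stdAddChar (-(h 0)), by simp [AddChar.norm_apply], ?_⟩
    intro v
    have e1 : Q.eval ((c1 + p ^ r * v : ℤ) : ZMod (p ^ (k * n))) =
        (p : ZMod (p ^ (k * n))) ^ E * T.coeff 0 +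
        (((p : ℤ) ^ (k * n - l * d) * ∑ j : Fin l, ((h j.succ).val : ℤ) * v ^ ((j : ℕ) + 1) : ℤ) :
          ZMod (p ^ (k * n))) := by
      rw [hQe]
      have e2 : (((c1 + p ^ r * v : ℤ) : ZMod (p ^ (k * n))) - c2) =
        ((p : ZMod (p ^ (k * n))) ^ r * v) + ((c1 - c2 : ℤ) : ZMod (p ^ (k * n))) := by
        push_cast; ring
      rw [e2, ← Polynomial.taylor_eval, ← hT,
        Polynomial.eval_eq_sum_range' (n := (l + 1) + (k - l)) (by
          rw [hT, Polynomial.natDegree_taylor]; omega), Finset.sum_range_add, mul_add]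
      have e3 : (p : ZMod (p ^ (k * n))) ^ E * ∑ x ∈ range (k - l), T.coeff (l + 1 + x) *
          ((p : ZMod (p ^ (k * n))) ^ r * v) ^ (l + 1 + x) = 0 := by
        rw [Finset.mul_sum]
        refine Finset.sum_eq_zero fun x _ => ?_
        rw [mul_pow, ← pow_mul]
        have : (p : ZMod (p ^ (k * n))) ^ E * (p : ZMod (p ^ (k * n))) ^ (r * (l + 1 + x)) = 0 := by
          rw [← pow_add, p_pow_zero]
          have : r * (l + 1 + x) = (l + 1) * r + r * x := by ring
          omega
        linear_combination (T.coeff (l + 1 + x) * (v : ZMod (p ^ (k * n))) ^ (l + 1 + x)) * this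
      rw [e3, add_zero, Finset.sum_range, Fin.sum_univ_succ, mul_add]
      simp only [Fin.val_zero, pow_zero, mul_one, Fin.val_succ]
      congr 1
      push_cast
      rw [Finset.mul_sum, Finset.mul_sum]
      refine Finset.sum_congr rfl fun j _ => ?_
      have hr : r * l = r * (l - (j + 1)) + r * (j + 1) := by
        rw [← Nat.mul_add, Nat.sub_add_cancel (by omega)]
      have hEE : k * n - l * d = E + (r * (l - (j + 1)) + r * (j + 1)) := by
        rw [← hr, hE, Nat.mul_add, mul_comm r l]
        rw [Nat.mul_add] at hM
        omega
      rw [hRt j, hEE, pow_add, pow_add, mul_pow, ← pow_mul]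
      ring
    rw [ev_vec _ hQdeg, e1, AddChar.map_add_eq_mul, mul_assoc]
    congr 1
    have hM' : k * n = (k * n - l * d) + l * d := by
      rw [Nat.mul_add] at hM
      omega
    have e4 := char_compat p (k * n - l * d) (l * d)
      (∑ j : Fin l, ((h j.succ).val : ℤ) * v ^ ((j : ℕ) + 1))
    have e3 : ∀ (A B : ℕ) (z : ℤ), A = B →
        (ZMod.stdAddChar ((z : ℤ) : ZMod (p ^ A)) : ℂ) = ZMod.stdAddChar ((z : ℤ) : ZMod (p ^ B)) := by
      intro A B z h; subst h; rfl
    rw [e3 _ _ _ hM', e4, ← AddChar.map_add_eq_mul]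
    congr 1
    rw [ev, Fin.sum_univ_succ]
    simp

/-- Lemma B. -/
lemma lemB (p k n l r d b : ℕ) [Fact p.Prime] (hr1 : 1 ≤ r) (hl : 1 ≤ l) (hlk : l < k) (hpk : k < p)
    (h1 : l * (r + d) ≤ (k - l + 1) * b) (h2 : l * (r + d) ≤ (l + 1) * r) (h3 : r + d ≤ n)
    (K K' : ℝ) (hK : 0 ≤ K) (hK' : 0 ≤ K') (hD : Dec p l d K') (hB : BD p k l (r + d) b n K) :
    BD p k l r b n (K' * K) := by
  intro pos a S1 S2 c1 c2 hS1 hS2 hc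
  have hk : 1 ≤ k := by omega
  set v : ℤ → ℤ := fun m => (pos m - c1) / (p : ℤ) ^ r with hv
  have hpos : ∀ m ∈ S1, pos m = c1 + p ^ r * v m := by
    intro m hm
    rw [hv]
    simp only
    rw [Int.mul_ediv_cancel' (hS1 m hm)]; ring
  have hpos2 : ∀ m ∈ S2, ∃ v, pos m = c2 + p ^ b * v := by
    intro m hm
    obtain ⟨v, hv⟩ := hS2 m hm
    exact ⟨v, by linarith⟩
  choose ι hι1 hι2 using polyB p k n l r d b hl hlk hpk h1 h2 h3 c1 c2 hc
  have main := loc_dec p l d k n hl K' hK' hD pos a S1 v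
    (fun x => ‖Fs (p ^ (k * n)) k pos a S2 x‖ ^ (2 * (tri k - tri l)))
    (fun _ => by positivity) ι (by
      intro t h
      have : Fs (p ^ (k * n)) k pos a S2 (t + ι h) = Fs (p ^ (k * n)) k pos a S2 t := by
        rw [Fs_add, Fs]
        refine Finset.sum_congr rfl fun m hm => ?_
        obtain ⟨v, hv⟩ := hpos2 m hm
        have := hι1 h v
        rw [← hv] at this
        rw [this]; simp
      simp only [this]) (by
      intro h
      obtain ⟨u, hu, huv⟩ := hι2 h
      refine ⟨u, hu, fun m hm => ?_⟩
      rw [hpos m hm]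
      exact huv _)
  have hsum : ∑ x, ‖Fs (p ^ (k * n)) k pos a S1 x‖ ^ (2 * tri l) *
        ‖Fs (p ^ (k * n)) k pos a S2 x‖ ^ (2 * (tri k - tri l)) =
      ∑ x, ‖Fs (p ^ (k * n)) k pos a S2 x‖ ^ (2 * (tri k - tri l)) *
        ‖Fs (p ^ (k * n)) k pos a S1 x‖ ^ (2 * tri l) :=
    Finset.sum_congr rfl fun x _ => mul_comm _ _
  rw [hsum]
  refine main.trans ?_
  have hV2 := Vn_nonneg p k n pos a S2
  have hl0 : tri l ≠ 0 := by have := tri_pos hl; omega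
  set W := (K * Vn p k n pos a S2 ^ (tri k - tri l)) ^ ((tri l : ℝ)⁻¹) with hW
  have hW0 : 0 ≤ W := by positivity
  have hWp : W ^ tri l = K * Vn p k n pos a S2 ^ (tri k - tri l) :=
    Real.rpow_inv_natCast_pow (by positivity) hl0
  have step : ∀ c : ZMod (p ^ d), (∑ t, ‖Fs (p ^ (k * n)) k pos a S2 t‖ ^ (2 * (tri k - tri l)) *
      ‖Fs (p ^ (k * n)) k pos a
        (S1.filter fun m => ((v m : ℤ) : ZMod (p ^ d)) = c) t‖ ^ (2 * tri l)) ^ ((tri l : ℝ)⁻¹)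
      ≤ W * Vn p k n pos a (S1.filter fun m => ((v m : ℤ) : ZMod (p ^ d)) = c) := by
    intro c
    have hV1 := Vn_nonneg p k n pos a (S1.filter fun m => ((v m : ℤ) : ZMod (p ^ d)) = c)
    have hr0 : r ≠ 0 := by omega
    have := hB pos a (S1.filter fun m => ((v m : ℤ) : ZMod (p ^ d)) = c) S2
      (c1 + p ^ r * (c.val : ℕ)) c2 (by
        intro m hm
        rw [Finset.mem_filter] at hm
        rw [hpos m hm.1]
        have h1 : ((v m : ℤ) : ZMod (p ^ d)) = (((c.val : ℕ) : ℤ) : ZMod (p ^ d)) := by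
          rw [hm.2]; simp
        rw [class_eq] at h1
        have : c1 + (p : ℤ) ^ r * v m - (c1 + (p : ℤ) ^ r * ((c.val : ℕ) : ℤ)) =
          (p : ℤ) ^ r * (v m - ((c.val : ℕ) : ℤ)) := by ring
        rw [this, pow_add]
        exact mul_dvd_mul_left _ h1) hS2 (by
        have : c1 + (p : ℤ) ^ r * (c.val : ℕ) - c2 = (c1 - c2) + (p : ℤ) ^ r * (c.val : ℕ) := by ring
        rw [this, Int.dvd_add_left (Dvd.dvd.mul_right (dvd_pow_self _ hr0) _)]
        exact hc)
    have hcalc : ∑ t, ‖Fs (p ^ (k * n)) k pos a S2 t‖ ^ (2 * (tri k - tri l)) *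
      ‖Fs (p ^ (k * n)) k pos a
        (S1.filter fun m => ((v m : ℤ) : ZMod (p ^ d)) = c) t‖ ^ (2 * tri l) ≤
        (W * Vn p k n pos a (S1.filter fun m => ((v m : ℤ) : ZMod (p ^ d)) = c)) ^ tri l := by
      rw [mul_pow, hWp]
      calc _ = _ := Finset.sum_congr rfl fun x _ => mul_comm _ _
        _ ≤ _ := this
        _ = _ := by ring
    calc _ ≤ ((W * Vn p k n pos a (S1.filter fun m => ((v m : ℤ) : ZMod (p ^ d)) = c)) ^ tri l)
        ^ ((tri l : ℝ)⁻¹) := by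
          apply Real.rpow_le_rpow _ hcalc (by positivity)
          exact Finset.sum_nonneg fun _ _ => by positivity
      _ = _ := Real.pow_rpow_inv_natCast (by positivity) hl0
  calc K' * (∑ c : ZMod (p ^ d), (∑ t, ‖Fs (p ^ (k * n)) k pos a S2 t‖ ^ (2 * (tri k - tri l)) *
      ‖Fs (p ^ (k * n)) k pos a
        (S1.filter fun m => ((v m : ℤ) : ZMod (p ^ d)) = c) t‖ ^ (2 * tri l)) ^ ((tri l : ℝ)⁻¹))
          ^ (tri l) ≤
      K' * (∑ c : ZMod (p ^ d),
        W * Vn p k n pos a (S1.filter fun m => ((v m : ℤ) : ZMod (p ^ d)) = c)) ^ (tri l) := by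
        refine mul_le_mul_of_nonneg_left (pow_le_pow_left₀ ?_
          (Finset.sum_le_sum fun c _ => step c) _) hK'
        exact Finset.sum_nonneg fun _ _ => Real.rpow_nonneg
            (Finset.sum_nonneg fun _ _ => mul_nonneg (pow_nonneg (norm_nonneg _) _)
              (pow_nonneg (norm_nonneg _) _)) _
    _ = _ := by
      rw [← Finset.mul_sum, ← Vn_refine p d k n hk pos a S1 v
        (fun m hm m' hm' h => class_div h3 (hpos m hm) (hpos m' hm') h), mul_pow, hWp]
      ring

end SFP


namespace SFP
open Finset

lemma holder_nat {T : Type*} (J : Finset T) (i j : ℕ) (hij : 1 ≤ i + j) (g u v : T → ℝ)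
    (hg : ∀ x, 0 ≤ g x) (hu : ∀ x, 0 ≤ u x) (hv : ∀ x, 0 ≤ v x)
    (h : ∀ x, g x ^ (i + j) = u x ^ i * v x ^ j) :
    (∑ x ∈ J, g x) ^ (i + j) ≤ (∑ x ∈ J, u x) ^ i * (∑ x ∈ J, v x) ^ j := by
  rcases Nat.eq_zero_or_pos i with rfl | hi
  · have : ∀ x, g x = v x := fun x => by
      have := h x
      simp only [pow_zero, one_mul, zero_add] at this
      exact (pow_left_inj₀ (hg x) (hv x) (by omega)).1 this
    simp [this]
  rcases Nat.eq_zero_or_pos j with rfl | hj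
  · have : ∀ x, g x = u x := fun x => by
      have := h x
      simp only [pow_zero, mul_one, add_zero] at this
      exact (pow_left_inj₀ (hg x) (hu x) (by omega)).1 this
    simp [this]
  set N : ℝ := ((i + j : ℕ) : ℝ) with hN
  have hNpos : 0 < N := by rw [hN]; positivity
  have hN0 : i + j ≠ 0 := by omega
  have hi' : (0 : ℝ) < i := by exact_mod_cast hi
  have hj' : (0 : ℝ) < j := by exact_mod_cast hj
  set α : ℝ := i / N
  set β : ℝ := j / N
  have hα : 0 < α := by positivity
  have hβ : 0 < β := by positivity
  have hαβ : α + β = 1 := by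
    simp only [α, β]; rw [← add_div, hN]; push_cast; rw [div_self]; positivity
  have e : ∀ x, g x = u x ^ α * v x ^ β := by
    intro x
    rw [← pow_left_inj₀ (hg x) (mul_nonneg (Real.rpow_nonneg (hu x) _) (Real.rpow_nonneg (hv x) _)) hN0,
      h x, mul_pow, ← Real.rpow_natCast (u x ^ α), ← Real.rpow_natCast (v x ^ β),
      ← Real.rpow_mul (hu x), ← Real.rpow_mul (hv x)]
    have e1 : α * ((i + j : ℕ) : ℝ) = (i : ℝ) := by simp only [α]; rw [← hN]; field_simp
    have e2 : β * ((i + j : ℕ) : ℝ) = (j : ℝ) := by simp only [β]; rw [← hN]; field_simp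
    rw [e1, e2, Real.rpow_natCast, Real.rpow_natCast]
  have H := Real.inner_le_Lp_mul_Lq_of_nonneg J (Real.HolderConjugate.inv_inv hα hβ hαβ)
    (f := fun x => u x ^ α) (g := fun x => v x ^ β) (fun x _ => Real.rpow_nonneg (hu x) _)
    (fun x _ => Real.rpow_nonneg (hv x) _)
  simp only [← e, one_div, inv_inv] at H
  have e3 : ∀ x, (u x ^ α) ^ α⁻¹ = u x := fun x => Real.rpow_rpow_inv (hu x) hα.ne'
  have e4 : ∀ x, (v x ^ β) ^ β⁻¹ = v x := fun x => Real.rpow_rpow_inv (hv x) hβ.ne'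
  simp only [e3, e4] at H
  have hU : 0 ≤ ∑ x ∈ J, u x := Finset.sum_nonneg fun x _ => hu x
  have hV : 0 ≤ ∑ x ∈ J, v x := Finset.sum_nonneg fun x _ => hv x
  calc (∑ x ∈ J, g x) ^ (i + j) ≤ ((∑ x ∈ J, u x) ^ α * (∑ x ∈ J, v x) ^ β) ^ (i + j) :=
        pow_le_pow_left₀ (Finset.sum_nonneg fun x _ => hg x) H _
    _ = _ := by
      rw [mul_pow, ← Real.rpow_natCast (_ ^ α), ← Real.rpow_natCast (_ ^ β),
      ← Real.rpow_mul hU, ← Real.rpow_mul hV]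
      have e1 : α * ((i + j : ℕ) : ℝ) = (i : ℝ) := by simp only [α]; rw [← hN]; field_simp
      have e2 : β * ((i + j : ℕ) : ℝ) = (j : ℝ) := by simp only [β]; rw [← hN]; field_simp
      rw [e1, e2, Real.rpow_natCast, Real.rpow_natCast]

lemma Dec_mono {p k n : ℕ} [Fact p.Prime] {K K' : ℝ} (h : K ≤ K') (hD : Dec p k n K) :
    Dec p k n K' := fun pos a S => (hD pos a S).trans
      (mul_le_mul_of_nonneg_right h (pow_nonneg (Vn_nonneg _ _ _ _ _ _) _))

lemma BD_mono {p k l r b n : ℕ} [Fact p.Prime] {K K' : ℝ} (h : K ≤ K') (hD : BD p k l r b n K) :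
    BD p k l r b n K' := fun pos a S1 S2 c1 c2 h1 h2 h3 => (hD pos a S1 S2 c1 c2 h1 h2 h3).trans
      (mul_le_mul_of_nonneg_right h (mul_nonneg (pow_nonneg (Vn_nonneg _ _ _ _ _ _) _)
        (pow_nonneg (Vn_nonneg _ _ _ _ _ _) _)))

lemma BD_zero (p k r b n : ℕ) [Fact p.Prime] (hk : 1 ≤ k) (hb : b ≤ n) (K : ℝ) (hK : 0 ≤ K)
    (hD : Dec p k (n - b) K) : BD p k 0 r b n K := by
  intro pos a S1 S2 c1 c2 h1 h2 h3
  have := lemA p k n b hk hb K hK hD pos a S2 c2 h2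
  simpa [tri, Nm] using this

lemma BD_triv (p k l r b n : ℕ) [Fact p.Prime] (hk : 1 ≤ k) (hl : l ≤ k) (hr : r ≤ n) (hb : b ≤ n)
    (K : ℝ) (hK : 0 ≤ K) (hD1 : Dec p k (n - r) K) (hD2 : Dec p k (n - b) K) :
    BD p k l r b n K := by
  intro pos a S1 S2 c1 c2 h1 h2 h3
  have A1 := lemA p k n r hk hr K hK hD1 pos a S1 c1 h1
  have A2 := lemA p k n b hk hb K hK hD2 pos a S2 c2 h2
  have V1 := Vn_nonneg p k n pos a S1
  have V2 := Vn_nonneg p k n pos a S2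
  obtain ⟨j, hj⟩ := Nat.exists_eq_add_of_le (tri_mono hl)
  have hk' := tri_pos hk
  rw [Nm] at A1 A2
  have e : tri k - tri l = j := by omega
  rw [e]
  rw [hj] at A1 A2 hk'
  have H := holder_nat Finset.univ (tri l) j hk'
    (fun x => ‖Fs (p ^ (k * n)) k pos a S1 x‖ ^ (2 * tri l) *
        ‖Fs (p ^ (k * n)) k pos a S2 x‖ ^ (2 * j))
    (fun x => ‖Fs (p ^ (k * n)) k pos a S1 x‖ ^ (2 * (tri l + j)))
    (fun x => ‖Fs (p ^ (k * n)) k pos a S2 x‖ ^ (2 * (tri l + j)))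
    (fun x => by positivity) (fun x => by positivity) (fun x => by positivity)
    (fun x => by rw [mul_pow, ← pow_mul, ← pow_mul, ← pow_mul, ← pow_mul]; ring)
  refine (pow_le_pow_iff_left₀ (Finset.sum_nonneg fun _ _ => by positivity) (by positivity)
    (n := tri l + j) (by omega)).1 (H.trans ?_)
  calc _ ≤ (K * Vn p k n pos a S1 ^ (tri l + j)) ^ tri l *
        (K * Vn p k n pos a S2 ^ (tri l + j)) ^ j := by
        gcongr
    _ = _ := by ring

lemma tri_id {k l : ℕ} (hl : 1 ≤ l) (hlk : l ≤ k) :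
    tri k = tri (k - l) + tri (l - 1) + l * (k - l + 1) := by
  obtain ⟨j, rfl⟩ := Nat.exists_eq_add_of_le hlk
  obtain ⟨i, rfl⟩ := Nat.exists_eq_add_of_le hl
  have h1 := two_tri (1 + i + j)
  have h2 := two_tri (1 + i + j - (1 + i))
  have h3 := two_tri (1 + i - 1)
  have e1 : 1 + i + j - (1 + i) = j := by omega
  have e2 : 1 + i - 1 = i := by omega
  rw [e1] at h2 ⊢
  rw [e2] at h3 ⊢
  nlinarith

lemma BD_holder (p k l r b n : ℕ) [Fact p.Prime] (hl : 1 ≤ l) (hlk : l < k)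
    (K K1 K2 : ℝ) (hK : 0 ≤ K) (hK1 : 0 ≤ K1) (hK2 : 0 ≤ K2) (hKK : K1 ^ (k - l) * K2 ≤ K ^ (k - l + 1))
    (h1 : BD p k (l - 1) r b n K1) (h2 : BD p k (k - l) b r n K2) :
    BD p k l r b n K := by
  intro pos a S1 S2 c1 c2 hS1 hS2 hc
  have A1 := h1 pos a S1 S2 c1 c2 hS1 hS2 hc
  have A2 := h2 pos a S2 S1 c2 c1 hS2 hS1 (by
    intro h; apply hc; rw [← neg_sub]; exact (dvd_neg).2 h)
  have V1 := Vn_nonneg p k n pos a S1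
  have V2 := Vn_nonneg p k n pos a S2
  have t1 := tri_id hl hlk.le
  have t2 : tri l = tri (l - 1) + l := by
    obtain ⟨i, rfl⟩ := Nat.exists_eq_add_of_le' hl
    simp [tri]
  set N := k - l with hN
  set A := tri (l - 1)
  set B := tri N
  have e1 : tri k - A = B + l * (N + 1) := by omega
  have e2 : tri k - B = A + l * (N + 1) := by omega
  have e3 : tri k - tri l = B + l * N := by
    have : l * (N + 1) = l * N + l := by ring
    omega
  rw [e1] at A1
  rw [e2] at A2
  rw [e3, t2]
  have H := holder_nat Finset.univ N 1 (by omega)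
    (fun x => ‖Fs (p ^ (k * n)) k pos a S1 x‖ ^ (2 * (A + l)) *
        ‖Fs (p ^ (k * n)) k pos a S2 x‖ ^ (2 * (B + l * N)))
    (fun x => ‖Fs (p ^ (k * n)) k pos a S1 x‖ ^ (2 * A) *
        ‖Fs (p ^ (k * n)) k pos a S2 x‖ ^ (2 * (B + l * (N + 1))))
    (fun x => ‖Fs (p ^ (k * n)) k pos a S2 x‖ ^ (2 * B) *
        ‖Fs (p ^ (k * n)) k pos a S1 x‖ ^ (2 * (A + l * (N + 1))))
    (fun x => by positivity) (fun x => by positivity) (fun x => by positivity)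
    (fun x => by
      simp only [mul_pow, ← pow_mul]
      ring)
  refine (pow_le_pow_iff_left₀ (Finset.sum_nonneg fun _ _ => by positivity) (by positivity)
    (n := N + 1) (by omega)).1 (H.trans ?_)
  calc _ ≤ (K1 * (Vn p k n pos a S1 ^ A * Vn p k n pos a S2 ^ (B + l * (N + 1)))) ^ N *
        (K2 * (Vn p k n pos a S2 ^ B * Vn p k n pos a S1 ^ (A + l * (N + 1)))) ^ 1 := by
        gcongr
    _ = (K1 ^ N * K2) * (Vn p k n pos a S1 ^ (A + l) * Vn p k n pos a S2 ^ (B + l * N)) ^ (N + 1) := by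
        simp only [mul_pow, ← pow_mul]
        ring
    _ ≤ K ^ (N + 1) * (Vn p k n pos a S1 ^ (A + l) * Vn p k n pos a S2 ^ (B + l * N)) ^ (N + 1) := by
        gcongr
    _ = _ := by ring

lemma sum_pow_le_max {T : Type*} (J : Finset T) (e : ℕ) (u : T → ℝ) (hu : ∀ x, 0 ≤ u x)
    (hJ : J.Nonempty) :
    (∑ x ∈ J, u x) ^ e ≤ (J.card : ℝ) ^ e * ∑ x ∈ J, u x ^ e := by
  obtain ⟨x0, hx0, hmax⟩ := Finset.exists_max_image J u hJ
  have h1 : ∑ x ∈ J, u x ≤ J.card * u x0 := by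
    calc _ ≤ ∑ x ∈ J, u x0 := Finset.sum_le_sum hmax
      _ = _ := by simp
  calc _ ≤ ((J.card : ℝ) * u x0) ^ e := pow_le_pow_left₀ (Finset.sum_nonneg fun x _ => hu x) h1 _
    _ = (J.card : ℝ) ^ e * u x0 ^ e := mul_pow _ _ _
    _ ≤ _ := by
      gcongr
      exact Finset.single_le_sum (f := fun x => u x ^ e) (fun x _ => pow_nonneg (hu x) _) hx0

lemma sum_pow_le_pow (T : Type*) (J : Finset T) (e : ℕ) (he : 1 ≤ e) (u : T → ℝ) (hu : ∀ x, 0 ≤ u x) :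
    ∑ x ∈ J, u x ^ e ≤ (∑ x ∈ J, u x) ^ e := by
  obtain ⟨f, rfl⟩ := Nat.exists_eq_add_of_le' he
  calc ∑ x ∈ J, u x ^ (f + 1) ≤ ∑ x ∈ J, u x * (∑ x ∈ J, u x) ^ f := by
        refine Finset.sum_le_sum fun x hx => ?_
        rw [pow_succ, mul_comm]
        exact mul_le_mul_of_nonneg_left (pow_le_pow_left₀ (hu x)
          (Finset.single_le_sum (fun x _ => hu x) hx) _) (hu x)
    _ = _ := by rw [← Finset.sum_mul, pow_succ, mul_comm]

lemma Fs_split (q k N : ℕ) [NeZero q] [NeZero N] (pos : ℤ → ℤ) (a : ℤ → ℂ) (S : Finset ℤ) (x) :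
    Fs q k pos a S x = ∑ c : ZMod N, Fs q k pos a (S.filter fun m => ((pos m : ℤ) : ZMod N) = c) x := by
  simp only [Fs]
  rw [Finset.sum_fiberwise]

lemma Dec_triv (p k n : ℕ) [Fact p.Prime] (hk : 1 ≤ k) :
    Dec p k n ((p : ℝ) ^ (n * (2 * tri k))) := by
  intro pos a S
  have hk' := tri_pos hk
  have h1 : Nm p k n pos a S ≤ (p : ℝ) ^ (n * (2 * tri k)) * ∑ c : ZMod (p ^ n),
      Nm p k n pos a (S.filter fun m => ((pos m : ℤ) : ZMod (p ^ n)) = c) := by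
    simp only [Nm]
    rw [Finset.sum_comm, Finset.mul_sum]
    refine Finset.sum_le_sum fun x _ => ?_
    rw [Fs_split _ k (p ^ n)]
    calc _ ≤ (∑ c : ZMod (p ^ n), ‖Fs (p ^ (k * n)) k pos a
          (S.filter fun m => ((pos m : ℤ) : ZMod (p ^ n)) = c) x‖) ^ (2 * tri k) := by
          gcongr
          exact norm_sum_le _ _
      _ ≤ _ := sum_pow_le_max _ _ _ (fun _ => norm_nonneg _) Finset.univ_nonempty
      _ = _ := by
        rw [Finset.card_univ, ZMod.card]
        push_cast
        rw [← pow_mul]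
  refine h1.trans ?_
  gcongr
  calc _ = ∑ c : ZMod (p ^ n), ((Nm p k n pos a (S.filter fun m => ((pos m : ℤ) : ZMod (p ^ n)) = c))
        ^ ((tri k : ℝ)⁻¹)) ^ (tri k) := by
        refine Finset.sum_congr rfl fun c _ => ?_
        rw [Real.rpow_inv_natCast_pow (Nm_nonneg _ _ _ _ _ _) (by omega)]
    _ ≤ _ := sum_pow_le_pow _ _ _ hk' _ (fun c => Real.rpow_nonneg (Nm_nonneg _ _ _ _ _ _) _)

end SFP


namespace SFP
open Finset

lemma orth (q k : ℕ) [NeZero q] (hk : 1 ≤ k) (y y' : ZMod q) (h : y ≠ y') :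
    ∑ x : Fin (k + 1) → ZMod q, (ZMod.stdAddChar (ev x y - ev x y') : ℂ) = 0 := by
  set t : Fin (k + 1) → ZMod q := Pi.single ⟨1, by omega⟩ 1 with ht
  have hev : ∀ z : ZMod q, ev t z = z := by
    intro z
    rw [ev, Finset.sum_eq_single (⟨1, by omega⟩ : Fin (k + 1))]
    · simp [ht]
    · intro b _ hb; simp [ht, Pi.single_eq_of_ne hb]
    · simp
  have hadd : ∀ x z, ev (x + t) z = ev x z + z := by
    intro x z
    have : ev (x + t) z = ev x z + ev t z := by
      simp [ev, add_mul, Finset.sum_add_distrib]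
    rw [this, hev]
  have hne : (ZMod.stdAddChar (y - y') : ℂ) ≠ 1 := by
    rw [← AddChar.map_zero_eq_one (ZMod.stdAddChar (N := q))]
    intro h'
    exact h (sub_eq_zero.1 (ZMod.injective_stdAddChar h'))
  have key : ∑ x : Fin (k + 1) → ZMod q, (ZMod.stdAddChar (ev x y - ev x y') : ℂ) =
    (∑ x : Fin (k + 1) → ZMod q, (ZMod.stdAddChar (ev x y - ev x y') : ℂ)) * ZMod.stdAddChar (y - y') := by
    rw [Finset.sum_mul]
    conv_lhs => rw [← Equiv.sum_comp (Equiv.addRight t)]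
    refine Finset.sum_congr rfl fun x _ => ?_
    rw [← AddChar.map_add_eq_mul]
    congr 1
    simp only [Equiv.coe_addRight, hadd]
    ring
  have : (∑ x : Fin (k + 1) → ZMod q, (ZMod.stdAddChar (ev x y - ev x y') : ℂ)) *
      (ZMod.stdAddChar (y - y') - 1) = 0 := by
    linear_combination -key
  rcases mul_eq_zero.1 this with h | h
  · exact h
  · exact absurd (sub_eq_zero.1 h) hne

lemma norm_sq_Fs (q k : ℕ) [NeZero q] (pos a S) :
    ((∑ x, ‖Fs q k pos a S x‖ ^ 2 : ℝ) : ℂ) = ∑ m ∈ S, ∑ m' ∈ S, a m * (starRingEnd ℂ) (a m') *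
      ∑ x : Fin (k + 1) → ZMod q, (ZMod.stdAddChar
        (ev x ((pos m : ℤ) : ZMod q) - ev x ((pos m' : ℤ) : ZMod q)) : ℂ) := by
  have : ∀ x, ((‖Fs q k pos a S x‖ ^ 2 : ℝ) : ℂ) = ∑ m ∈ S, ∑ m' ∈ S, a m * (starRingEnd ℂ) (a m') *
      (ZMod.stdAddChar (ev x ((pos m : ℤ) : ZMod q) - ev x ((pos m' : ℤ) : ZMod q)) : ℂ) := by
    intro x
    push_cast
    rw [← Complex.mul_conj', Fs, map_sum, Finset.sum_mul_sum]
    refine Finset.sum_congr rfl fun m _ => Finset.sum_congr rfl fun m' _ => ?_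
    rw [sub_eq_add_neg, AddChar.map_add_eq_mul, map_mul, AddChar.map_neg_eq_conj]
    ring
  rw [Complex.ofReal_sum]
  simp only [this]
  rw [Finset.sum_comm]
  refine Finset.sum_congr rfl fun m _ => ?_
  rw [Finset.sum_comm]
  refine Finset.sum_congr rfl fun m' _ => ?_
  rw [Finset.mul_sum]

lemma Dec_base (p n : ℕ) [Fact p.Prime] : Dec p 1 n 1 := by
  intro pos a S
  have t1 : tri 1 = 1 := rfl
  simp only [Vn, t1, Nm, pow_one, Nat.cast_one, inv_one, Real.rpow_one, one_mul, mul_one]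
  apply le_of_eq
  rw [← Complex.ofReal_inj, norm_sq_Fs, Complex.ofReal_sum]
  simp only [norm_sq_Fs]
  have : ∀ c : ZMod (p ^ n), ∀ D : ℤ → ℤ → ℂ,
    ∑ m ∈ S with ((pos m : ℤ) : ZMod (p ^ n)) = c, ∑ m' ∈ S with ((pos m' : ℤ) : ZMod (p ^ n)) = c, D m m'
      = ∑ m ∈ S with ((pos m : ℤ) : ZMod (p ^ n)) = c,
        ∑ m' ∈ S, if ((pos m' : ℤ) : ZMod (p ^ n)) = ((pos m : ℤ) : ZMod (p ^ n)) then D m m' else 0 := by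
    intro c D
    refine Finset.sum_congr rfl fun m hm => ?_
    rw [Finset.mem_filter] at hm
    rw [Finset.sum_filter, hm.2]
  simp only [this]
  rw [Finset.sum_fiberwise]
  refine Finset.sum_congr rfl fun m _ => Finset.sum_congr rfl fun m' _ => ?_
  split_ifs with h
  · rfl
  · rw [orth _ 1 le_rfl, mul_zero]
    intro h'
    apply h
    rw [class_eq] at h' ⊢
    rw [one_mul] at h'
    rw [← neg_sub, dvd_neg]
    exact h'

/-- Decoupling with exponent `η`. -/
def DecE (p k : ℕ) [Fact p.Prime] (η : ℝ) : Prop :=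
  ∃ C : ℝ, 1 ≤ C ∧ ∀ n : ℕ, Dec p k n (C * (p : ℝ) ^ (η * n))

lemma p_one_le (p : ℕ) [Fact p.Prime] : (1 : ℝ) ≤ p := by
  exact_mod_cast (Fact.out : p.Prime).one_lt.le

lemma DecE_mono {p k : ℕ} [Fact p.Prime] {η η' : ℝ} (h : η ≤ η') (hD : DecE p k η) :
    DecE p k η' := by
  obtain ⟨C, hC, hn⟩ := hD
  refine ⟨C, hC, fun n => Dec_mono ?_ (hn n)⟩
  have := p_one_le p
  gcongr

lemma DecE_base (p : ℕ) [Fact p.Prime] (ε : ℝ) (hε : 0 ≤ ε) : DecE p 1 ε := by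
  refine ⟨1, le_rfl, fun n => Dec_mono ?_ (Dec_base p n)⟩
  rw [one_mul]
  exact Real.one_le_rpow (p_one_le p) (by positivity)

/-- Lemma C. -/
lemma lemC (p k l : ℕ) [Fact p.Prime] (hl : 1 ≤ l) (hlk : l < k) (hpk : k < p)
    (IH : ∀ ε : ℝ, 0 < ε → DecE p l ε) (ε : ℝ) (hε : 0 < ε) :
    ∃ C : ℝ, 1 ≤ C ∧ ∃ L : ℕ, 1 ≤ L ∧ ∀ (n b a a' : ℕ) (K : ℝ), 0 ≤ K → L ≤ a → a ≤ a' →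
      l * a' ≤ (k - l + 1) * b → a' ≤ n → BD p k l a' b n K →
      BD p k l a b n (C * (p : ℝ) ^ (ε * ((a' : ℝ) - a)) * K) := by
  have hp1 : (1 : ℝ) < p := by exact_mod_cast (Fact.out : p.Prime).one_lt
  have hp0 : (0 : ℝ) < p := by linarith
  obtain ⟨C, hC, hn⟩ := IH (ε / 2) (by positivity)
  obtain ⟨d0, hd01, hd0⟩ : ∃ d0 : ℕ, 1 ≤ d0 ∧ C ≤ (p : ℝ) ^ (ε / 2 * d0) := by
    obtain ⟨d0, h⟩ := pow_unbounded_of_one_lt C (Real.one_lt_rpow hp1 (by positivity : 0 < ε / 2))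
    refine ⟨d0 + 1, by omega, ?_⟩
    rw [Real.rpow_mul hp0.le, Real.rpow_natCast]
    exact h.le.trans (pow_le_pow_right₀ (Real.one_le_rpow hp1.le (by positivity)) (by omega))
  refine ⟨C, hC, l * d0 + 1, by omega, ?_⟩
  intro n b a a' K hK hLa haa' hlb ha'n hB
  induction hm : a' - a using Nat.strong_induction_on generalizing a with
  | _ m ih =>
    by_cases hcase : a' - a ≤ d0
    · obtain ⟨d, rfl⟩ := Nat.exists_eq_add_of_le haa'
      have hd : d ≤ d0 := by omega
      have := lemB p k n l a d b (by omega) hl hlk hpk hlb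
        (by nlinarith [Nat.mul_le_mul_left l hd]) ha'n K _ hK (by positivity) (hn d) hB
      refine BD_mono ?_ this
      gcongr
      · exact hp1.le
      · linarith
      · push_cast
        linarith
    · have h2 := ih (a' - (a + d0)) (by
        omega) (a + d0) (by omega) (by omega) rfl
      have := lemB p k n l a d0 b (by omega) hl hlk hpk
        (by nlinarith [Nat.mul_le_mul_left l (show a + d0 ≤ a' by omega)])
        (by nlinarith) (by omega) _ _ (by positivity) (by positivity) (hn d0) h2
      refine BD_mono ?_ this
      push_cast
      have e : ε * ((a' : ℝ) - a) = ε / 2 * d0 + ε / 2 * d0 + ε * ((a' : ℝ) - (a + d0)) := by ring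
      rw [e, Real.rpow_add hp0, Real.rpow_add hp0]
      have h3 : C * (p : ℝ) ^ (ε / 2 * d0) * (C * (p : ℝ) ^ (ε * ((a' : ℝ) - (a + d0))) * K) ≤
        (p : ℝ) ^ (ε / 2 * d0) * (p : ℝ) ^ (ε / 2 * d0) *
          (C * (p : ℝ) ^ (ε * ((a' : ℝ) - (a + d0))) * K) := by
        gcongr
      refine h3.trans (le_of_eq ?_)
      ring

end SFP


namespace SFP
open Finset

/-- The gain coefficients. -/
noncomputable def cc (k : ℕ) : ℕ → ℕ → ℝ
  | 0, l => if l = 0 then 1 else 0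
  | (t + 1), l => if l = 0 then 1 else
      ((k : ℝ) - l) / ((k : ℝ) - l + 1) * cc k t (l - 1) + cc k t (k - l) / l

lemma cc_zero (k t : ℕ) : cc k t 0 = 1 := by cases t <;> simp [cc]

lemma cc_nonneg (k t : ℕ) : ∀ l, l ≤ k → 0 ≤ cc k t l := by
  induction t with
  | zero => intro l _; simp only [cc]; split_ifs <;> norm_num
  | succ t ih =>
    intro l hl
    simp only [cc]
    split_ifs with h
    · norm_num
    · have h1 := ih (l - 1) (by omega)
      have h2 := ih (k - l) (by omega)
      have h3 : (0 : ℝ) ≤ (k : ℝ) - l := by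
        rw [sub_nonneg]; exact_mod_cast hl
      positivity

lemma aux_ineq (l j a' b : ℕ) (h : (j + 1) * b < l * a' + l) (hb : l + j ≤ b) :
    j * b ≤ (l + 1) * a' := by
  by_contra hcon
  push Not at hcon
  have t1 : l * ((l + 1) * a') ≤ l * (j * b) := Nat.mul_le_mul_left _ hcon.le
  have t2 : (l + 1) * ((j + 1) * b + 1) ≤ (l + 1) * (l * a' + l) := Nat.mul_le_mul_left _ h
  have t3 : l * l ≤ (l + j) * b := Nat.mul_le_mul (by omega) (by omega)
  have t4 : (l + 1) * (l * a' + l) = l * ((l + 1) * a') + l * l + l := by ring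
  have t5 : (l + 1) * ((j + 1) * b + 1) = l * (j * b) + (l + j) * b + b + l + 1 := by ring
  omega

set_option maxHeartbeats 1000000 in
lemma claim (p k : ℕ) [Fact p.Prime] (hk : 2 ≤ k) (hpk : k < p)
    (IH : ∀ l, 1 ≤ l → l < k → ∀ ε : ℝ, 0 < ε → DecE p l ε) (η : ℝ) (hη : 0 ≤ η)
    (hD : DecE p k η) (t : ℕ) : ∀ ε : ℝ, 0 < ε → ∃ C : ℝ, 1 ≤ C ∧ ∃ L : ℕ, 1 ≤ L ∧
      ∀ n b l a : ℕ, l < k → L ≤ a → L ≤ b → l * a ≤ (k - l + 1) * b → k ^ (t + 1) * b ≤ n →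
        BD p k l a b n (C * (p : ℝ) ^ (η * n + ε * n - η * cc k t l * b)) := by
  have hp1 : (1 : ℝ) < p := by exact_mod_cast (Fact.out : p.Prime).one_lt
  have hp0 : (0 : ℝ) < p := by linarith
  obtain ⟨C0, hC0, hC0n⟩ := hD
  have hbn : ∀ t n b : ℕ, k ^ (t + 1) * b ≤ n → k * b ≤ n := by
    intro t n b h
    refine le_trans (Nat.mul_le_mul_right b ?_) h
    calc k = k ^ 1 := (pow_one k).symm
      _ ≤ k ^ (t + 1) := Nat.pow_le_pow_right (by omega) (by omega)
  have hzero : ∀ (t n b a : ℕ) (ε : ℝ), 0 < ε → k ^ (t + 1) * b ≤ n →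
      BD p k 0 a b n (C0 * (p : ℝ) ^ (η * n + ε * n - η * cc k t 0 * b)) := by
    intro t n b a ε hε h
    have hb : b ≤ n := by nlinarith [hbn t n b h]
    refine BD_mono ?_ (BD_zero p k a b n (by omega) hb _ (by positivity) (hC0n (n - b)))
    gcongr
    · exact hp1.le
    · rw [cc_zero, Nat.cast_sub hb]
      have : 0 ≤ ε * n := by positivity
      linarith
  induction t with
  | zero =>
    intro ε hε
    refine ⟨C0, hC0, 1, le_rfl, ?_⟩
    intro n b l a hlk ha hb hlab hn
    rcases Nat.eq_zero_or_pos l with rfl | hl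
    · exact hzero 0 n b a ε hε hn
    have h1 := hbn 0 n b hn
    have hb : b ≤ n := by nlinarith
    have h2 : (k - l + 1) * b ≤ k * b := Nat.mul_le_mul_right b (by omega)
    have ha : a ≤ n := by nlinarith
    have mono : ∀ x ≤ n, C0 * (p : ℝ) ^ (η * (n - x : ℕ)) ≤
      C0 * (p : ℝ) ^ (η * n + ε * n - η * cc k 0 l * b) := by
      intro x hx
      gcongr
      · exact hp1.le
      · have : cc k 0 l = 0 := by simp [cc]; omega
        rw [this, Nat.cast_sub hx]
        have : 0 ≤ ε * n := by positivity
        have : 0 ≤ η * x := by positivity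
        linarith
    exact BD_triv p k l a b n (by omega) hlk.le ha hb _ (by positivity)
      (Dec_mono (mono a ha) (hC0n _)) (Dec_mono (mono b hb) (hC0n _))
  | succ t ih =>
    intro ε hε
    obtain ⟨C1, hC1, L1, hL1, h1⟩ := ih (ε / 2) (by positivity)
    have h2 : ∀ l, ∃ C : ℝ, 1 ≤ C ∧ ∃ L : ℕ, 1 ≤ L ∧ (1 ≤ l → l < k →
      ∀ (n b a a' : ℕ) (K : ℝ), 0 ≤ K → L ≤ a → a ≤ a' →
      l * a' ≤ (k - l + 1) * b → a' ≤ n → BD p k l a' b n K →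
      BD p k l a b n (C * (p : ℝ) ^ (ε / 2 * ((a' : ℝ) - a)) * K)) := by
      intro l
      by_cases hl : 1 ≤ l ∧ l < k
      · obtain ⟨C, hC, L, hL, h⟩ := lemC p k l hl.1 hl.2 hpk (IH l hl.1 hl.2) (ε / 2) (by positivity)
        exact ⟨C, hC, L, hL, fun _ _ => h⟩
      · exact ⟨1, le_rfl, 1, le_rfl, fun h h' => absurd ⟨h, h'⟩ hl⟩
    choose C2 hC2 L2 hL2 h2 using h2
    set M : ℝ := ∑ i ∈ range (k + 1), cc k t i with hM
    have hcM : ∀ i, i ≤ k → cc k t i ≤ M := by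
      intro i hi
      exact Finset.single_le_sum (f := fun i => cc k t i)
        (fun i hi => cc_nonneg k t i (by rw [Finset.mem_range] at hi; omega))
        (Finset.mem_range.2 (by omega))
    have hM0 : 0 ≤ M := (cc_nonneg k t 0 (by omega)).trans (hcM 0 (by omega))
    set CC : ℝ := ∑ l ∈ range k, C2 l with hCC
    have hC2CC : ∀ l < k, C2 l ≤ CC := fun l hl =>
      Finset.single_le_sum (f := C2) (fun i _ => by linarith [hC2 i]) (Finset.mem_range.2 hl)
    have hCC1 : 1 ≤ CC := (hC2 0).trans (hC2CC 0 (by omega))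
    have hpM : 1 ≤ (p : ℝ) ^ (η * M) := Real.one_le_rpow hp1.le (by positivity)
    refine ⟨C0 + CC * (C1 * (p : ℝ) ^ (η * M)), by
        have : 0 ≤ CC * (C1 * (p : ℝ) ^ (η * M)) := by positivity
        linarith, L1 + k + ∑ l ∈ range k, L2 l, by omega, ?_⟩
    intro n b l a hlk ha hb hlab hn
    rcases Nat.eq_zero_or_pos l with rfl | hl
    · refine BD_mono ?_ (hzero (t + 1) n b a ε hε hn)
      have : 0 ≤ CC * (C1 * (p : ℝ) ^ (η * M)) := by positivity
      gcongr
      linarith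
    have hkb := hbn (t + 1) n b hn
    have hkt : k ^ (t + 1) * (k * b) ≤ n := by
      refine le_trans (le_of_eq ?_) hn
      ring
    have hL2l : L2 l ≤ ∑ l ∈ range k, L2 l :=
      Finset.single_le_sum (f := L2) (fun i _ => by omega) (Finset.mem_range.2 hlk)
    have hN : (k - l + 1) * b ≤ k * b := Nat.mul_le_mul_right b (by omega)
    set a' := (k - l + 1) * b / l with ha'
    have ha'1 : l * a' ≤ (k - l + 1) * b := Nat.mul_div_le _ _
    have ha'2 : (k - l + 1) * b < l * a' + l := by
      have := Nat.lt_mul_div_succ ((k - l + 1) * b) hl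
      rw [← ha', Nat.mul_add, mul_one] at this
      exact this
    have haa' : a ≤ a' := (Nat.le_div_iff_mul_le hl).2 (by rw [mul_comm]; exact hlab)
    have ha'kb : a' ≤ k * b := by nlinarith
    have ha'n : a' ≤ n := by omega
    obtain ⟨j, hj⟩ : ∃ j, k = l + j := Nat.exists_eq_add_of_le hlk.le
    have hkl : k - l = j := by omega
    have hj1 : 1 ≤ j := by omega
    have hB1 := h1 n b (l - 1) a' (by omega) (by omega) (by omega) (by
      obtain ⟨i, rfl⟩ := Nat.exists_eq_add_of_le' hl
      have e : k - (i + 1 - 1) + 1 = (k - (i + 1) + 1) + 1 := by omega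
      rw [e]
      simp only [Nat.add_sub_cancel]
      nlinarith) (by nlinarith [Nat.pow_pos (n := t + 1) (show 0 < k by omega)])
    have hB2 := h1 n a' (k - l) b (by omega) (by omega) (by omega) (by
      have e : k - (k - l) + 1 = l + 1 := by omega
      rw [e, hkl]
      rw [hkl] at ha'2
      have hbl : l + j ≤ b := by omega
      exact aux_ineq l j a' b ha'2 hbl) (by
        refine le_trans (Nat.mul_le_mul_left _ ha'kb) hkt)
    have hR := BD_holder p k l a' b n hl hlk
      (C1 * (p : ℝ) ^ (η * n + ε / 2 * n - η * cc k (t + 1) l * b + η * M)) _ _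
      (by positivity) (by positivity) (by positivity) (by
        rw [hkl, mul_pow, mul_pow]
        rw [← Real.rpow_natCast (_ ^ (_ : ℝ)), ← Real.rpow_natCast (_ ^ (_ : ℝ)),
          ← Real.rpow_mul hp0.le, ← Real.rpow_mul hp0.le]
        have e : ∀ A B C D : ℝ, A * B * (C * D) = (A * C) * (B * D) := fun _ _ _ _ => by ring
        rw [e, ← pow_succ, ← Real.rpow_add hp0]
        gcongr
        · exact hp1.le
        · have hcl : cc k (t + 1) l = (j : ℝ) / ((j : ℝ) + 1) * cc k t (l - 1) + cc k t j / l := by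
            have : (k : ℝ) - l = j := by rw [hj]; push_cast; ring
            rw [cc, if_neg (by omega), this, hkl]
          rw [hcl]
          have hl0 : (0 : ℝ) < l := by exact_mod_cast hl
          have hj0 : (0 : ℝ) < j := by exact_mod_cast hj1
          have hc2 := cc_nonneg k t j (by omega)
          have hc2M := hcM j (by omega)
          set c1 := cc k t (l - 1)
          set c2 := cc k t j
          have ha'3 : ((j : ℝ) + 1) * b / l ≤ a' + 1 := by
            rw [div_le_iff₀ hl0]
            have : (j + 1) * b ≤ l * a' + l := by rw [hkl] at ha'2; omega
            have : ((j : ℝ) + 1) * b ≤ l * a' + l := by exact_mod_cast this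
            linarith
          have h5 : η * c2 * (((j : ℝ) + 1) * b / l) ≤ η * c2 * (a' + 1) := by gcongr
          have h6 : η * c2 ≤ ((j : ℝ) + 1) * (η * M) := by
            have : η * c2 ≤ η * M := by gcongr
            have : 0 ≤ η * M := by positivity
            nlinarith
          push_cast
          have e1 : (η * n + ε / 2 * n - η * ((j : ℝ) / ((j : ℝ) + 1) * c1 + c2 / l) * b + η * M) * ((j : ℝ) + 1)
            = (η * n + ε / 2 * n) * (j + 1) - η * j * c1 * b - η * c2 * (((j : ℝ) + 1) * b / l)
              + ((j : ℝ) + 1) * (η * M) := by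
            field_simp
            ring
          rw [e1]
          linarith) hB1 hB2
    have hfin := h2 l hl hlk n b a a' _ (by positivity) (by omega) haa' ha'1 ha'n hR
    refine BD_mono ?_ hfin
    have ha'nR : (a' : ℝ) ≤ n := by exact_mod_cast ha'n
    calc C2 l * (p : ℝ) ^ (ε / 2 * ((a' : ℝ) - a)) *
        (C1 * (p : ℝ) ^ (η * n + ε / 2 * n - η * cc k (t + 1) l * b + η * M))
        ≤ CC * (p : ℝ) ^ (ε / 2 * n) *
        (C1 * (p : ℝ) ^ (η * n + ε / 2 * n - η * cc k (t + 1) l * b + η * M)) := by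
          gcongr
          · exact hC2CC l hlk
          · exact hp1.le
          · have : (0 : ℝ) ≤ a := by positivity
            linarith
      _ = (CC * (C1 * (p : ℝ) ^ (η * M))) * (p : ℝ) ^ (η * n + ε * n - η * cc k (t + 1) l * b) := by
          have e : η * n + ε * n - η * cc k (t + 1) l * b =
            (ε / 2 * n) + (η * n + ε / 2 * n - η * cc k (t + 1) l * b) := by ring
          rw [e, Real.rpow_add hp0 (ε / 2 * n), Real.rpow_add hp0 _ (η * M)]
          ring
      _ ≤ _ := by
          gcongr
          linarith

end SFP


namespace SFP
open Finset

lemma cc_sum (K t : ℕ) :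
    ∑ i ∈ range K, cc (K + 1) t (i + 1) = t * ((K : ℝ) / (K + 1)) := by
  induction t with
  | zero => simp [cc]
  | succ t ih =>
    have h1 : ∀ i ∈ range K, cc (K + 1) (t + 1) (i + 1) =
        ((K : ℝ) - i) / ((K : ℝ) - i + 1) * cc (K + 1) t i + cc (K + 1) t (K - i) / ((i : ℝ) + 1) := by
      intro i hi
      rw [cc, if_neg (by omega)]
      push_cast
      have e1 : K + 1 - (i + 1) = K - i := by omega
      have e2 : (K : ℝ) + 1 - (i + 1) = K - i := by ring
      rw [e2]
    rw [Finset.sum_congr rfl h1, Finset.sum_add_distrib]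
    have h2 : ∑ i ∈ range K, cc (K + 1) t (K - i) / ((i : ℝ) + 1) =
        ∑ i ∈ range K, cc (K + 1) t (i + 1) / ((K : ℝ) - i) := by
      rw [← Finset.sum_range_reflect]
      refine Finset.sum_congr rfl fun i hi => ?_
      rw [Finset.mem_range] at hi
      have e1 : K - (K - 1 - i) = i + 1 := by omega
      have e2 : ((K - 1 - i : ℕ) : ℝ) + 1 = K - i := by
        rw [Nat.sub_sub, Nat.cast_sub (by omega)]; push_cast; ring
      rw [e1, e2]
    have h3 : ∑ i ∈ range K, ((K : ℝ) - i) / ((K : ℝ) - i + 1) * cc (K + 1) t i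
        = ∑ i ∈ range (K + 1), ((K : ℝ) - i) / ((K : ℝ) - i + 1) * cc (K + 1) t i := by
      rw [Finset.sum_range_succ]; simp
    rw [h2, h3, Finset.sum_range_succ', add_right_comm, ← Finset.sum_add_distrib]
    have h4 : ∀ i ∈ range K, ((K : ℝ) - (i + 1 : ℕ)) / ((K : ℝ) - (i + 1 : ℕ) + 1) * cc (K + 1) t (i + 1) +
        cc (K + 1) t (i + 1) / ((K : ℝ) - i) = cc (K + 1) t (i + 1) := by
      intro i hi
      rw [Finset.mem_range] at hi
      have : (0 : ℝ) < (K : ℝ) - i := by rw [sub_pos]; exact_mod_cast hi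
      push_cast
      have e : (K : ℝ) - (i + 1) + 1 = K - i := by ring
      rw [e]
      field_simp
      ring
    rw [Finset.sum_congr rfl h4, ih, cc_zero]
    push_cast
    ring

lemma cc_large (k t : ℕ) (hk : 2 ≤ k) : ∃ l, 1 ≤ l ∧ l < k ∧ (t : ℝ) / k ≤ cc k t l := by
  obtain ⟨K, rfl⟩ : ∃ K, k = K + 1 := ⟨k - 1, by omega⟩
  have hK : (0 : ℝ) < K := by exact_mod_cast (by omega : 0 < K)
  obtain ⟨i, hi, h⟩ := Finset.exists_le_of_sum_le (s := range K)
    (f := fun _ => (t : ℝ) / ((K + 1 : ℕ) : ℝ)) (g := fun i => cc (K + 1) t (i + 1))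
    ⟨0, Finset.mem_range.2 (by omega)⟩ (by
      rw [cc_sum]
      simp
      apply le_of_eq
      ring)
  rw [Finset.mem_range] at hi
  exact ⟨i + 1, by omega, by omega, h⟩

lemma broad_narrow {T : Type*} [Fintype T] [DecidableEq T] [Nonempty T] (U : T → ℂ) (i j : ℕ)
    (δ : ℝ) (hδ : 0 < δ) :
    ‖∑ I, U I‖ ^ (i + j) ≤ (1 + δ) ^ (i + j) * ∑ I, ‖U I‖ ^ (i + j) +
      (Fintype.card T : ℝ) ^ (i + j) * ((Fintype.card T : ℝ) / δ) ^ j *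
        ∑ I, ∑ I', if I ≠ I' then ‖U I‖ ^ i * ‖U I'‖ ^ j else 0 := by
  obtain ⟨I1, -, hmax⟩ := Finset.exists_max_image Finset.univ (fun I => ‖U I‖) Finset.univ_nonempty
  have hc : (0 : ℝ) < Fintype.card T := by exact_mod_cast Fintype.card_pos
  have hS0 : 0 ≤ ∑ I, ∑ I', if I ≠ I' then ‖U I‖ ^ i * ‖U I'‖ ^ j else 0 :=
    Finset.sum_nonneg fun _ _ => Finset.sum_nonneg fun _ _ => by split_ifs <;> positivity
  have hT0 : 0 ≤ ∑ I, ‖U I‖ ^ (i + j) := Finset.sum_nonneg fun _ _ => by positivity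
  by_cases h : ∀ I, I ≠ I1 → ‖U I‖ ≤ δ / Fintype.card T * ‖U I1‖
  · have h1 : ‖∑ I, U I‖ ≤ (1 + δ) * ‖U I1‖ := by
      calc ‖∑ I, U I‖ = ‖U I1 + ∑ I ∈ univ.erase I1, U I‖ := by
            rw [Finset.add_sum_erase _ _ (Finset.mem_univ I1)]
        _ ≤ ‖U I1‖ + ∑ I ∈ univ.erase I1, ‖U I‖ :=
            (norm_add_le _ _).trans (by gcongr; exact norm_sum_le _ _)
        _ ≤ ‖U I1‖ + ∑ I ∈ univ.erase I1, δ / Fintype.card T * ‖U I1‖ := by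
            gcongr with I hI
            exact h I (Finset.ne_of_mem_erase hI)
        _ ≤ ‖U I1‖ + ∑ I : T, δ / Fintype.card T * ‖U I1‖ := by
            gcongr
            exact Finset.erase_subset _ _
        _ = _ := by
            simp
            field_simp
    calc _ ≤ ((1 + δ) * ‖U I1‖) ^ (i + j) := by gcongr
      _ = (1 + δ) ^ (i + j) * ‖U I1‖ ^ (i + j) := mul_pow _ _ _
      _ ≤ (1 + δ) ^ (i + j) * ∑ I, ‖U I‖ ^ (i + j) := by
        gcongr
        exact Finset.single_le_sum (f := fun I => ‖U I‖ ^ (i + j))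
          (fun _ _ => by positivity) (Finset.mem_univ I1)
      _ ≤ _ := by
        have : 0 ≤ (Fintype.card T : ℝ) ^ (i + j) * ((Fintype.card T : ℝ) / δ) ^ j *
          ∑ I, ∑ I', if I ≠ I' then ‖U I‖ ^ i * ‖U I'‖ ^ j else 0 := by positivity
        linarith
  · push Not at h
    obtain ⟨I2, hne, hI2⟩ := h
    have h1 : ‖∑ I, U I‖ ≤ Fintype.card T * ‖U I1‖ := by
      calc _ ≤ ∑ I, ‖U I‖ := norm_sum_le _ _
        _ ≤ ∑ I : T, ‖U I1‖ := Finset.sum_le_sum fun I _ => hmax I (Finset.mem_univ I)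
        _ = _ := by simp
    have h2 : ‖U I1‖ ≤ Fintype.card T / δ * ‖U I2‖ := by
      have : ‖U I1‖ = Fintype.card T / δ * (δ / Fintype.card T * ‖U I1‖) := by field_simp
      rw [this]
      gcongr
    calc _ ≤ ((Fintype.card T : ℝ) * ‖U I1‖) ^ (i + j) := by gcongr
      _ = (Fintype.card T : ℝ) ^ (i + j) * (‖U I1‖ ^ i * ‖U I1‖ ^ j) := by ring
      _ ≤ (Fintype.card T : ℝ) ^ (i + j) * (‖U I1‖ ^ i * (Fintype.card T / δ * ‖U I2‖) ^ j) := by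
        gcongr
      _ = (Fintype.card T : ℝ) ^ (i + j) * (Fintype.card T / δ) ^ j *
          (if I1 ≠ I2 then ‖U I1‖ ^ i * ‖U I2‖ ^ j else 0) := by
        rw [if_pos hne.symm]; ring
      _ ≤ (Fintype.card T : ℝ) ^ (i + j) * (Fintype.card T / δ) ^ j *
          ∑ I, ∑ I', if I ≠ I' then ‖U I‖ ^ i * ‖U I'‖ ^ j else 0 := by
        gcongr
        calc _ ≤ ∑ I', if I1 ≠ I' then ‖U I1‖ ^ i * ‖U I'‖ ^ j else 0 :=
              Finset.single_le_sum (f := fun I' => if I1 ≠ I' then ‖U I1‖ ^ i * ‖U I'‖ ^ j else 0)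
                (fun _ _ => by split_ifs <;> positivity) (Finset.mem_univ I2)
          _ ≤ _ := Finset.single_le_sum
                (f := fun I => ∑ I', if I ≠ I' then ‖U I‖ ^ i * ‖U I'‖ ^ j else 0)
                (fun _ _ => Finset.sum_nonneg fun _ _ => by split_ifs <;> positivity)
                (Finset.mem_univ I1)
      _ ≤ _ := by
        have : 0 ≤ (1 + δ) ^ (i + j) * ∑ I, ‖U I‖ ^ (i + j) := by positivity
        linarith

lemma Vn_filter_le (p k n d : ℕ) [Fact p.Prime] (hk : 1 ≤ k) (hd : d ≤ n) (pos a S)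
    (c : ZMod (p ^ d)) :
    Vn p k n pos a (S.filter fun m => ((pos m : ℤ) : ZMod (p ^ d)) = c) ≤ Vn p k n pos a S := by
  rw [Vn_refine p d k n hk pos a S pos (by
    intro m _ m' _ h
    rw [class_eq] at h ⊢
    exact (pow_dvd_pow _ hd).trans h)]
  exact Finset.single_le_sum (f := fun c => Vn p k n pos a
    (S.filter fun m => ((pos m : ℤ) : ZMod (p ^ d)) = c)) (fun _ _ => Vn_nonneg _ _ _ _ _ _)
    (Finset.mem_univ c)

lemma BD_split (p k l a b n : ℕ) [Fact p.Prime] (hk : 1 ≤ l) (hlk : l < k) (hab : a ≤ b) (hb1 : 1 ≤ b)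
    (hb : b ≤ n) (K : ℝ) (hK : 0 ≤ K) (hB : BD p k l a b n K) (pos : ℤ → ℤ) (f : ℤ → ℂ) (S : Finset ℤ)
    (I I' : ZMod (p ^ 1)) (hI : I ≠ I') :
    ∑ x, ‖Fs (p ^ (k * n)) k pos f (S.filter fun m => ((pos m : ℤ) : ZMod (p ^ 1)) = I) x‖ ^ (2 * tri l) *
        ‖Fs (p ^ (k * n)) k pos f (S.filter fun m => ((pos m : ℤ) : ZMod (p ^ 1)) = I') x‖
          ^ (2 * (tri k - tri l)) ≤
      (p : ℝ) ^ (b * (2 * tri k + 2)) * K * Vn p k n pos f S ^ tri k := by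
  have hk1 : 1 ≤ k := by omega
  have htl : tri l ≤ tri k := tri_mono hlk.le
  have htl' : tri l < tri k := by
    have : tri (l + 1) ≤ tri k := tri_mono hlk
    simp only [tri] at this
    omega
  have ht1 := tri_pos hk
  set SI := S.filter fun m => ((pos m : ℤ) : ZMod (p ^ 1)) = I with hSI
  set SI' := S.filter fun m => ((pos m : ℤ) : ZMod (p ^ 1)) = I' with hSI'
  have hV := Vn_nonneg p k n pos f S
  have split : ∀ (S0 : Finset ℤ) (e : ℕ) x, ‖Fs (p ^ (k * n)) k pos f S0 x‖ ^ e ≤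
      (p : ℝ) ^ (b * e) * ∑ J : ZMod (p ^ b), ‖Fs (p ^ (k * n)) k pos f
        (S0.filter fun m => ((pos m : ℤ) : ZMod (p ^ b)) = J) x‖ ^ e := by
    intro S0 e x
    rw [Fs_split _ k (p ^ b)]
    calc _ ≤ (∑ c : ZMod (p ^ b), ‖Fs (p ^ (k * n)) k pos f
          (S0.filter fun m => ((pos m : ℤ) : ZMod (p ^ b)) = c) x‖) ^ e := by
          gcongr
          exact norm_sum_le _ _
      _ ≤ _ := sum_pow_le_max _ _ _ (fun _ => norm_nonneg _) Finset.univ_nonempty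
      _ = _ := by
        rw [Finset.card_univ, ZMod.card]
        push_cast
        rw [← pow_mul]
  have each : ∀ J J' : ZMod (p ^ b), ∑ x, ‖Fs (p ^ (k * n)) k pos f
        (SI.filter fun m => ((pos m : ℤ) : ZMod (p ^ b)) = J) x‖ ^ (2 * tri l) *
        ‖Fs (p ^ (k * n)) k pos f (SI'.filter fun m => ((pos m : ℤ) : ZMod (p ^ b)) = J') x‖
          ^ (2 * (tri k - tri l)) ≤ K * Vn p k n pos f S ^ tri k := by
    intro J J'
    rcases (SI.filter fun m => ((pos m : ℤ) : ZMod (p ^ b)) = J).eq_empty_or_nonempty with h0 | ⟨m0, hm0⟩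
    · rw [h0]
      simp only [Fs_empty, norm_zero]
      rw [zero_pow (by omega)]
      simp only [zero_mul, Finset.sum_const_zero]
      positivity
    rcases (SI'.filter fun m => ((pos m : ℤ) : ZMod (p ^ b)) = J').eq_empty_or_nonempty with h0 | ⟨m1, hm1⟩
    · rw [h0]
      simp only [Fs_empty, norm_zero]
      rw [zero_pow (n := 2 * (tri k - tri l)) (by omega)]
      simp only [mul_zero, Finset.sum_const_zero]
      positivity
    rw [Finset.mem_filter, hSI, Finset.mem_filter] at hm0
    rw [Finset.mem_filter, hSI', Finset.mem_filter] at hm1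
    have H := hB pos f (SI.filter fun m => ((pos m : ℤ) : ZMod (p ^ b)) = J)
      (SI'.filter fun m => ((pos m : ℤ) : ZMod (p ^ b)) = J') (pos m0) (pos m1)
      (by
        intro m hm
        rw [Finset.mem_filter] at hm
        have := hm.2.trans hm0.2.symm
        rw [class_eq] at this
        exact (pow_dvd_pow _ hab).trans this)
      (by
        intro m hm
        rw [Finset.mem_filter] at hm
        have := hm.2.trans hm1.2.symm
        rw [class_eq] at this
        exact this)
      (by
        intro h
        apply hI
        rw [← hm0.1.2, ← hm1.1.2, class_eq, pow_one]
        exact h)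
    refine H.trans ?_
    have V1 : Vn p k n pos f (SI.filter fun m => ((pos m : ℤ) : ZMod (p ^ b)) = J) ≤ Vn p k n pos f S :=
      (Vn_filter_le p k n b hk1 hb pos f SI J).trans
        (Vn_filter_le p k n 1 hk1 (by omega) pos f S I)
    have V2 : Vn p k n pos f (SI'.filter fun m => ((pos m : ℤ) : ZMod (p ^ b)) = J') ≤ Vn p k n pos f S :=
      (Vn_filter_le p k n b hk1 hb pos f SI' J').trans
        (Vn_filter_le p k n 1 hk1 (by omega) pos f S I')
    have e : tri k = tri l + (tri k - tri l) := by omega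
    calc _ ≤ K * (Vn p k n pos f S ^ tri l * Vn p k n pos f S ^ (tri k - tri l)) := by
          refine mul_le_mul_of_nonneg_left (mul_le_mul
            (pow_le_pow_left₀ (Vn_nonneg _ _ _ _ _ _) V1 _)
            (pow_le_pow_left₀ (Vn_nonneg _ _ _ _ _ _) V2 _)
            (pow_nonneg (Vn_nonneg _ _ _ _ _ _) _) (pow_nonneg hV _)) hK
      _ = _ := by rw [← pow_add, ← e]
  calc _ ≤ ∑ x, ((p : ℝ) ^ (b * (2 * tri l)) * ∑ J : ZMod (p ^ b), ‖Fs (p ^ (k * n)) k pos f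
        (SI.filter fun m => ((pos m : ℤ) : ZMod (p ^ b)) = J) x‖ ^ (2 * tri l)) *
        ((p : ℝ) ^ (b * (2 * (tri k - tri l))) * ∑ J' : ZMod (p ^ b), ‖Fs (p ^ (k * n)) k pos f
        (SI'.filter fun m => ((pos m : ℤ) : ZMod (p ^ b)) = J') x‖ ^ (2 * (tri k - tri l))) := by
        refine Finset.sum_le_sum fun x _ => mul_le_mul (split _ _ _) (split _ _ _) (by positivity) ?_
        exact mul_nonneg (by positivity) (Finset.sum_nonneg fun _ _ => by positivity)
    _ = (p : ℝ) ^ (b * (2 * tri k)) * ∑ J : ZMod (p ^ b), ∑ J' : ZMod (p ^ b),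
        ∑ x, ‖Fs (p ^ (k * n)) k pos f
        (SI.filter fun m => ((pos m : ℤ) : ZMod (p ^ b)) = J) x‖ ^ (2 * tri l) *
        ‖Fs (p ^ (k * n)) k pos f (SI'.filter fun m => ((pos m : ℤ) : ZMod (p ^ b)) = J') x‖
          ^ (2 * (tri k - tri l)) := by
        have e : b * (2 * tri k) = b * (2 * tri l) + b * (2 * (tri k - tri l)) := by
          rw [← Nat.mul_add, ← Nat.mul_add]; congr 2; omega
        rw [e, pow_add]
        have e3 : ∀ A B X Y : ℝ, (A * X) * (B * Y) = (A * B) * (X * Y) := fun A B X Y => by ring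
        rw [Finset.sum_congr rfl (fun x _ => e3 _ _ _ _), ← Finset.mul_sum]
        simp_rw [Finset.sum_mul_sum]
        congr 1
        rw [Finset.sum_comm]
        refine Finset.sum_congr rfl fun J _ => ?_
        rw [Finset.sum_comm]
    _ ≤ (p : ℝ) ^ (b * (2 * tri k)) * ∑ J : ZMod (p ^ b), ∑ J' : ZMod (p ^ b),
        K * Vn p k n pos f S ^ tri k := by
        gcongr with J _ J' _
        exact each J J'
    _ = _ := by
        simp only [Finset.sum_const, Finset.card_univ, ZMod.card, nsmul_eq_mul]
        push_cast
        ring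

end SFP


namespace SFP
open Finset

lemma Dec_rec (p k l a b n : ℕ) [Fact p.Prime] (hl : 1 ≤ l) (hlk : l < k) (hab : a ≤ b) (hb1 : 1 ≤ b)
    (hb : b ≤ n) (K0 K δ : ℝ) (hK0 : 0 ≤ K0) (hK : 0 ≤ K) (hδ : 0 < δ) (hD : Dec p k (n - 1) K0)
    (hB : BD p k l a b n K) :
    Dec p k n ((1 + δ) ^ (2 * tri k) * K0 +
      (p : ℝ) ^ (2 * tri k) * ((p : ℝ) / δ) ^ (2 * (tri k - tri l)) * (p : ℝ) ^ 2 *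
        (p : ℝ) ^ (b * (2 * tri k + 2)) * K) := by
  intro pos f S
  have hk1 : 1 ≤ k := by omega
  have htl : tri l ≤ tri k := tri_mono hlk.le
  have hV := Vn_nonneg p k n pos f S
  have hp0 : (0 : ℝ) < p := lt_of_lt_of_le one_pos (p_one_le p)
  have ex : 2 * tri k = 2 * tri l + 2 * (tri k - tri l) := by omega
  have nar : ∑ I : ZMod (p ^ 1), Nm p k n pos f (S.filter fun m => ((pos m : ℤ) : ZMod (p ^ 1)) = I)
      ≤ K0 * Vn p k n pos f S ^ tri k := by
    have h1 : ∀ I : ZMod (p ^ 1), Nm p k n pos f (S.filter fun m => ((pos m : ℤ) : ZMod (p ^ 1)) = I)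
      ≤ K0 * Vn p k n pos f (S.filter fun m => ((pos m : ℤ) : ZMod (p ^ 1)) = I) ^ tri k := by
      intro I
      refine lemA p k n 1 hk1 (by omega) K0 hK0 hD pos f _ (I.val : ℤ) ?_
      intro m hm
      rw [Finset.mem_filter] at hm
      rw [← class_eq, hm.2]
      simp
    refine (Finset.sum_le_sum fun I _ => h1 I).trans ?_
    rw [← Finset.mul_sum]
    refine mul_le_mul_of_nonneg_left ?_ hK0
    rw [Vn_refine p 1 k n hk1 pos f S pos (by
      intro m _ m' _ h
      rw [class_eq] at h ⊢
      exact (pow_dvd_pow _ (by omega)).trans h)]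
    exact sum_pow_le_pow _ _ _ (tri_pos hk1) _ fun _ => Vn_nonneg _ _ _ _ _ _
  have step : ∀ x, ‖Fs (p ^ (k * n)) k pos f S x‖ ^ (2 * tri k) ≤
      (1 + δ) ^ (2 * tri k) * ∑ I : ZMod (p ^ 1),
        ‖Fs (p ^ (k * n)) k pos f (S.filter fun m => ((pos m : ℤ) : ZMod (p ^ 1)) = I) x‖ ^ (2 * tri k) +
      (p : ℝ) ^ (2 * tri k) * ((p : ℝ) / δ) ^ (2 * (tri k - tri l)) *
        ∑ I : ZMod (p ^ 1), ∑ I' : ZMod (p ^ 1), if I ≠ I' then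
          ‖Fs (p ^ (k * n)) k pos f (S.filter fun m => ((pos m : ℤ) : ZMod (p ^ 1)) = I) x‖ ^ (2 * tri l) *
          ‖Fs (p ^ (k * n)) k pos f (S.filter fun m => ((pos m : ℤ) : ZMod (p ^ 1)) = I') x‖
            ^ (2 * (tri k - tri l)) else 0 := by
    intro x
    have := broad_narrow (fun I : ZMod (p ^ 1) =>
      Fs (p ^ (k * n)) k pos f (S.filter fun m => ((pos m : ℤ) : ZMod (p ^ 1)) = I) x)
      (2 * tri l) (2 * (tri k - tri l)) δ hδ
    rw [← Fs_split, ← ex, ZMod.card] at this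
    have e : ((p ^ 1 : ℕ) : ℝ) = p := by simp
    rw [e] at this
    exact this
  have hc : 0 ≤ (p : ℝ) ^ (2 * tri k) * ((p : ℝ) / δ) ^ (2 * (tri k - tri l)) := by positivity
  have bro : ∑ x, ∑ I : ZMod (p ^ 1), ∑ I' : ZMod (p ^ 1), (if I ≠ I' then
          ‖Fs (p ^ (k * n)) k pos f (S.filter fun m => ((pos m : ℤ) : ZMod (p ^ 1)) = I) x‖ ^ (2 * tri l) *
          ‖Fs (p ^ (k * n)) k pos f (S.filter fun m => ((pos m : ℤ) : ZMod (p ^ 1)) = I') x‖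
            ^ (2 * (tri k - tri l)) else 0) ≤
      (p : ℝ) ^ 2 * ((p : ℝ) ^ (b * (2 * tri k + 2)) * K * Vn p k n pos f S ^ tri k) := by
    rw [Finset.sum_comm]
    have h0 : 0 ≤ (p : ℝ) ^ (b * (2 * tri k + 2)) * K * Vn p k n pos f S ^ tri k := by positivity
    calc _ ≤ ∑ I : ZMod (p ^ 1), ∑ I' : ZMod (p ^ 1),
          ((p : ℝ) ^ (b * (2 * tri k + 2)) * K * Vn p k n pos f S ^ tri k) := by
          refine Finset.sum_le_sum fun I _ => ?_
          rw [Finset.sum_comm]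
          refine Finset.sum_le_sum fun I' _ => ?_
          by_cases hI : I = I'
          · simp only [hI, ne_eq, not_true_eq_false, if_false, Finset.sum_const_zero]
            exact h0
          · simp only [ne_eq, hI, not_false_eq_true, if_true]
            exact BD_split p k l a b n hl hlk hab hb1 hb K hK hB pos f S I I' hI
      _ = _ := by
        simp only [Finset.sum_const, Finset.card_univ, ZMod.card, nsmul_eq_mul]
        push_cast
        ring
  have e1 := Finset.sum_le_sum (s := Finset.univ) fun x _ => step x
  rw [Finset.sum_add_distrib, ← Finset.mul_sum, ← Finset.mul_sum, Finset.sum_comm (s := Finset.univ)] at e1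
  refine (le_trans e1 ?_)
  calc _ ≤ (1 + δ) ^ (2 * tri k) * (K0 * Vn p k n pos f S ^ tri k) +
        (p : ℝ) ^ (2 * tri k) * ((p : ℝ) / δ) ^ (2 * (tri k - tri l)) *
        ((p : ℝ) ^ 2 * ((p : ℝ) ^ (b * (2 * tri k + 2)) * K * Vn p k n pos f S ^ tri k)) :=
        add_le_add (mul_le_mul_of_nonneg_left nar (by positivity)) (mul_le_mul_of_nonneg_left bro hc)
    _ = _ := by ring

set_option maxHeartbeats 1000000 in
lemma improve (p k : ℕ) [Fact p.Prime] (hk : 2 ≤ k) (hpk : k < p)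
    (IH : ∀ l, 1 ≤ l → l < k → ∀ ε : ℝ, 0 < ε → DecE p l ε) (η : ℝ) (hη : 0 ≤ η)
    (hD : DecE p k η) (t l : ℕ) (hl : 1 ≤ l) (hlk : l < k)
    (hcc : 2 * (tri k : ℝ) + 3 ≤ η * cc k t l) (η' : ℝ) (hη' : 0 < η')
    (hηη' : η - 1 / (2 * (k : ℝ) ^ (t + 1)) ≤ η') : DecE p k η' := by
  have hp1 : (1 : ℝ) < p := by exact_mod_cast (Fact.out : p.Prime).one_lt
  have hp0 : (0 : ℝ) < p := by linarith
  have hk0 : (0 : ℝ) < k := by exact_mod_cast (by omega : 0 < k)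
  have hs := tri_pos (by omega : 1 ≤ k)
  obtain ⟨C1, hC1, L, hL, hBD⟩ := claim p k hk hpk IH η hη hD t (1 / (2 * (k : ℝ) ^ (t + 1))) (by positivity)
  obtain ⟨C0, hC0, hC0n⟩ := hD
  set s := tri k with hsdef
  set lam : ℕ := k ^ (t + 1) with hlam
  have hlam0 : 0 < lam := by positivity
  have hlamR : (k : ℝ) ^ (t + 1) = (lam : ℝ) := by rw [hlam]; push_cast; rfl
  rw [hlamR] at hηη' hBD
  have hlR : (0 : ℝ) < lam := by exact_mod_cast hlam0
  set x : ℝ := (p : ℝ) ^ (η' / 2) with hx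
  have hx1 : 1 < x := Real.one_lt_rpow hp1 (by positivity)
  set δ : ℝ := Real.log x / (2 * s) with hδd
  have hsR : (0 : ℝ) < s := by exact_mod_cast hs
  have hδ : 0 < δ := by have := Real.log_pos hx1; positivity
  have hδx : (1 + δ) ^ (2 * s) ≤ x := by
    calc (1 + δ) ^ (2 * s) ≤ (Real.exp δ) ^ (2 * s) := by
          gcongr
          linarith [Real.add_one_le_exp δ]
      _ = Real.exp (((2 * s : ℕ) : ℝ) * δ) := by rw [Real.exp_nat_mul]
      _ = x := by
        rw [hδd]
        push_cast
        rw [mul_div_cancel₀ _ (by positivity)]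
        exact Real.exp_log (by linarith)
  set B : ℝ := (p : ℝ) ^ (2 * s) * ((p : ℝ) / δ) ^ (2 * (s - tri l)) * (p : ℝ) ^ 2 * C1 * (p : ℝ) ^ (k : ℝ)
    with hB
  have hB0 : 0 < B := by positivity
  set n1 : ℕ := lam * k * L with hn1
  have hxi : x⁻¹ < 1 := inv_lt_one_of_one_lt₀ hx1
  set C : ℝ := C0 * (p : ℝ) ^ (η * n1) + B / (1 - x⁻¹) with hC
  have h1x : 0 < 1 - x⁻¹ := by linarith
  have hCB : B ≤ C * (1 - x⁻¹) := by
    have : C * (1 - x⁻¹) = C0 * (p : ℝ) ^ (η * n1) * (1 - x⁻¹) + B := by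
      rw [hC, add_mul, div_mul_cancel₀ _ h1x.ne']
    rw [this]
    have : 0 ≤ C0 * (p : ℝ) ^ (η * n1) * (1 - x⁻¹) := by positivity
    linarith
  have hC1 : 1 ≤ C := by
    have h1 : 1 ≤ (p : ℝ) ^ (η * n1) := Real.one_le_rpow hp1.le (by positivity)
    have h2 : 0 ≤ B / (1 - x⁻¹) := by positivity
    have h3 : 1 * 1 ≤ C0 * (p : ℝ) ^ (η * n1) := by gcongr
    linarith
  refine ⟨C, hC1, ?_⟩
  intro n
  induction n with
  | zero =>
    refine Dec_mono ?_ (hC0n 0)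
    simp only [Nat.cast_zero, mul_zero, Real.rpow_zero, mul_one]
    have h1 : 1 ≤ (p : ℝ) ^ (η * n1) := Real.one_le_rpow hp1.le (by positivity)
    have h2 : 0 ≤ B / (1 - x⁻¹) := by positivity
    nlinarith
  | succ m ih =>
    set n := m + 1 with hn
    by_cases hnn : n < n1
    · refine Dec_mono ?_ (hC0n n)
      have h1 : 1 ≤ (p : ℝ) ^ (η' * n) := Real.one_le_rpow hp1.le (by positivity)
      have h2 : 0 ≤ B / (1 - x⁻¹) := by positivity
      have h3 : (p : ℝ) ^ (η * n) ≤ (p : ℝ) ^ (η * n1) := by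
        apply Real.rpow_le_rpow_of_exponent_le hp1.le
        have : (n : ℝ) ≤ n1 := by exact_mod_cast hnn.le
        gcongr
      calc C0 * (p : ℝ) ^ (η * n) ≤ C0 * (p : ℝ) ^ (η * n1) := by gcongr
        _ ≤ C * 1 := by linarith
        _ ≤ _ := by gcongr
    · push Not at hnn
      set a := n / (lam * k) with ha
      set b := k * a with hb
      have hLa : L ≤ a := by
        rw [ha, Nat.le_div_iff_mul_le (by positivity), mul_comm]; exact hnn
      have hab : a ≤ b := by rw [hb]; nlinarith
      have hLb : L ≤ b := hLa.trans hab
      have hlb : lam * b ≤ n := by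
        rw [hb, ← mul_assoc, ha]; exact Nat.mul_div_le _ _
      have hbn : b ≤ n := by nlinarith
      have hnb : n < lam * b + lam * k := by
        have := Nat.lt_mul_div_succ n (by positivity : 0 < lam * k)
        rw [← ha] at this
        rw [hb]
        nlinarith
      have hBD' := hBD n b l a hlk hLa hLb (by
        rw [hb]
        calc l * a ≤ 1 * (k * a) := by rw [one_mul]; exact Nat.mul_le_mul_right _ hlk.le
          _ ≤ _ := Nat.mul_le_mul_right _ (by omega)) hlb
      have ih' : Dec p k (n - 1) (C * (p : ℝ) ^ (η' * m)) := by
        rw [hn, Nat.add_sub_cancel]; exact ih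
      have := Dec_rec p k l a b n hl hlk hab (by omega) hbn _ _ δ (by positivity) (by positivity) hδ ih' hBD'
      refine Dec_mono ?_ this
      have E1 : (1 + δ) ^ (2 * tri k) * (C * (p : ℝ) ^ (η' * m)) ≤ x⁻¹ * C * (p : ℝ) ^ (η' * n) := by
        have e : (p : ℝ) ^ (η' * n) = x * x * (p : ℝ) ^ (η' * m) := by
          rw [hx, ← Real.rpow_add hp0, ← Real.rpow_add hp0, hn]
          push_cast
          ring_nf
        rw [e]
        have hxx : x⁻¹ * C * (x * x * (p : ℝ) ^ (η' * m)) = x * (C * (p : ℝ) ^ (η' * m)) := by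
          field_simp
        rw [hxx]
        exact mul_le_mul_of_nonneg_right hδx (by positivity)
      have E2 : (p : ℝ) ^ (b * (2 * tri k + 2)) *
          (C1 * (p : ℝ) ^ (η * n + 1 / (2 * lam) * n - η * cc k t l * b)) ≤
          C1 * (p : ℝ) ^ (k : ℝ) * (p : ℝ) ^ (η' * n) := by
        rw [← Real.rpow_natCast, mul_left_comm, ← Real.rpow_add hp0, mul_assoc C1, ← Real.rpow_add hp0]
        refine mul_le_mul_of_nonneg_left ?_ (by linarith)
        apply Real.rpow_le_rpow_of_exponent_le hp1.le
        push_cast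
        have hb0 : (0 : ℝ) ≤ b := by positivity
        have h1 : (2 * (tri k : ℝ) + 3) * b ≤ η * cc k t l * b := by gcongr
        have h2 : (n : ℝ) / lam ≤ b + k := by
          rw [div_le_iff₀ hlR]
          have : (n : ℝ) < lam * b + lam * k := by exact_mod_cast hnb
          linarith
        have h3 : (η - 1 / (2 * lam)) * n ≤ η' * n := by gcongr
        have h4 : (1 : ℝ) / (2 * lam) * n = (n : ℝ) / lam / 2 := by field_simp
        nlinarith
      calc _ = (1 + δ) ^ (2 * tri k) * (C * (p : ℝ) ^ (η' * m)) +
            (p : ℝ) ^ (2 * s) * ((p : ℝ) / δ) ^ (2 * (s - tri l)) * (p : ℝ) ^ 2 *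
            ((p : ℝ) ^ (b * (2 * tri k + 2)) *
          (C1 * (p : ℝ) ^ (η * n + 1 / (2 * lam) * n - η * cc k t l * b))) := by ring
        _ ≤ x⁻¹ * C * (p : ℝ) ^ (η' * n) +
            (p : ℝ) ^ (2 * s) * ((p : ℝ) / δ) ^ (2 * (s - tri l)) * (p : ℝ) ^ 2 *
            (C1 * (p : ℝ) ^ (k : ℝ) * (p : ℝ) ^ (η' * n)) :=
            add_le_add E1 (mul_le_mul_of_nonneg_left E2 (by positivity))
        _ = (x⁻¹ * C + B) * (p : ℝ) ^ (η' * n) := by rw [hB]; ring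
        _ ≤ C * (p : ℝ) ^ (η' * n) := by
            refine mul_le_mul_of_nonneg_right ?_ (by positivity)
            linarith

/-- Discrete decoupling for the moment curve (with epsilon loss). -/
theorem decoupling (p : ℕ) [Fact p.Prime] (k : ℕ) (hk : 1 ≤ k) (hpk : k < p) :
    ∀ ε : ℝ, 0 < ε → DecE p k ε := by
  induction k using Nat.strong_induction_on with
  | _ k IH =>
    rcases Nat.lt_or_ge k 2 with h1 | h2
    · obtain rfl : k = 1 := by omega
      exact fun ε hε => DecE_base p ε hε.le
    have IH' : ∀ l, 1 ≤ l → l < k → ∀ ε : ℝ, 0 < ε → DecE p l ε :=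
      fun l hl hlk => IH l hlk hl (by omega)
    have hp0 : (0 : ℝ) < p := lt_of_lt_of_le one_pos (p_one_le p)
    have htriv : DecE p k (2 * tri k) := by
      refine ⟨1, le_rfl, fun n => ?_⟩
      have := Dec_triv p k n hk
      rw [one_mul]
      rw [← Real.rpow_natCast] at this
      push_cast at this
      rwa [mul_comm] at this
    set E : Set ℝ := {η | 0 ≤ η ∧ DecE p k η} with hE
    have hne : E.Nonempty := ⟨2 * tri k, by positivity, htriv⟩
    have hbd : BddBelow E := ⟨0, fun η h => h.1⟩
    set η0 := sInf E with hη0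
    have hη00 : 0 ≤ η0 := le_csInf hne fun η h => h.1
    have hz : η0 ≤ 0 := by
      by_contra hpos
      push Not at hpos
      obtain ⟨t, ht⟩ := exists_nat_gt ((2 * (tri k : ℝ) + 3) * k / η0)
      obtain ⟨l, hl, hlk, hcc⟩ := cc_large k t h2
      have hk0 : (0 : ℝ) < k := by exact_mod_cast (by omega : 0 < k)
      set g : ℝ := 1 / (2 * (k : ℝ) ^ (t + 1)) with hg
      have hg0 : 0 < g := by positivity
      obtain ⟨η, hηE, hηlt⟩ := exists_lt_of_csInf_lt hne (show sInf E < η0 + g / 2 by linarith)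
      have hηge : η0 ≤ η := csInf_le hbd hηE
      have hcc2 : 2 * (tri k : ℝ) + 3 ≤ η * cc k t l := by
        calc 2 * (tri k : ℝ) + 3 ≤ η0 * ((t : ℝ) / k) := by
              rw [div_lt_iff₀ hpos] at ht
              rw [← mul_div_assoc, le_div_iff₀ hk0]
              linarith
          _ ≤ η * cc k t l := by
            have := hηE.1
            gcongr
      have := improve p k h2 hpk IH' η hηE.1 hηE.2 t l hl hlk hcc2 (max (η - g) (η0 / 2))
        (lt_max_of_lt_right (by linarith)) (le_max_left _ _)
      have h3 : η0 ≤ max (η - g) (η0 / 2) :=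
        csInf_le hbd ⟨(by positivity : (0:ℝ) ≤ η0 / 2).trans (le_max_right _ _), this⟩
      have h4 : max (η - g) (η0 / 2) < η0 := max_lt (by linarith) (by linarith)
      linarith
    intro ε hε
    obtain ⟨η, hηE, hηlt⟩ := exists_lt_of_csInf_lt hne (show sInf E < ε by linarith)
    exact DecE_mono hηlt.le hηE.2

end SFP


namespace SFP
open Finset

noncomputable def ee (x : ℝ) : ℂ := Complex.exp (((2 * Real.pi * x : ℝ) : ℂ) * Complex.I)

noncomputable def nd (x : ℝ) : ℝ := |x - round x|

lemma ee_zero : ee 0 = 1 := by simp [ee]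
lemma ee_add (x y : ℝ) : ee (x + y) = ee x * ee y := by
  rw [ee, ee, ee, ← Complex.exp_add]; congr 1; push_cast; ring
lemma ee_norm (x : ℝ) : ‖ee x‖ = 1 := by rw [ee, Complex.norm_exp_ofReal_mul_I]
lemma ee_neg (x : ℝ) : ee (-x) = (starRingEnd ℂ) (ee x) := by
  rw [ee, ee, ← Complex.exp_conj]
  congr 1
  rw [map_mul, Complex.conj_ofReal, Complex.conj_I]
  push_cast; ring
lemma ee_int (n : ℤ) : ee n = 1 := by
  rw [ee, Complex.exp_eq_one_iff]
  exact ⟨n, by push_cast; ring⟩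
lemma ee_add_int (x : ℝ) (n : ℤ) : ee (x + n) = ee x := by rw [ee_add, ee_int, mul_one]
lemma ee_nat_mul (x : ℝ) (n : ℕ) : ee (n * x) = ee x ^ n := by
  rw [ee, ee, ← Complex.exp_nat_mul]; congr 1; push_cast; ring
lemma ee_sum {ι : Type*} (s : Finset ι) (f : ι → ℝ) : ee (∑ i ∈ s, f i) = ∏ i ∈ s, ee (f i) := by
  classical
  induction s using Finset.induction_on with
  | empty => simp [ee_zero]
  | insert a s ha ih => rw [Finset.sum_insert ha, Finset.prod_insert ha, ee_add, ih]

lemma nd_nonneg (x : ℝ) : 0 ≤ nd x := abs_nonneg _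
lemma nd_le_half (x : ℝ) : nd x ≤ 1 / 2 := abs_sub_round x
lemma nd_le (x : ℝ) (n : ℤ) : nd x ≤ |x - n| := round_le x n
lemma nd_add_int (x : ℝ) (n : ℤ) : nd (x + n) = nd x := by
  rw [nd, nd, round_add_intCast]; push_cast; congr 1; ring
lemma nd_exists (x : ℝ) : ∃ n : ℤ, nd x = |x - n| := ⟨round x, rfl⟩
lemma nd_neg (x : ℝ) : nd (-x) = nd x := by
  apply le_antisymm
  · obtain ⟨n, hn⟩ := nd_exists x
    refine (nd_le _ (-n)).trans ?_
    rw [hn]; push_cast; rw [← abs_neg]; apply le_of_eq; congr 1; ring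
  · obtain ⟨n, hn⟩ := nd_exists (-x)
    refine (nd_le _ (-n)).trans ?_
    rw [hn]; push_cast; rw [← abs_neg]; apply le_of_eq; congr 1; ring
lemma nd_add_le (x y : ℝ) : nd (x + y) ≤ nd x + nd y := by
  obtain ⟨n, hn⟩ := nd_exists x
  obtain ⟨m, hm⟩ := nd_exists y
  rw [hn, hm]
  refine (nd_le _ (n + m)).trans ?_
  push_cast
  refine le_trans (le_of_eq ?_) (abs_add_le _ _)
  congr 1; ring
lemma nd_sum_le {ι : Type*} (s : Finset ι) (f : ι → ℝ) : nd (∑ i ∈ s, f i) ≤ ∑ i ∈ s, nd (f i) := by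
  classical
  induction s using Finset.induction_on with
  | empty => simp [nd]
  | insert a s ha ih =>
    rw [Finset.sum_insert ha, Finset.sum_insert ha]
    exact (nd_add_le _ _).trans (by gcongr)
lemma nd_mul_nat (x : ℝ) (n : ℕ) : nd (n * x) ≤ n * nd x := by
  obtain ⟨m, hm⟩ := nd_exists x
  refine (nd_le _ (n * m)).trans ?_
  push_cast
  rw [← mul_sub, abs_mul, Nat.abs_cast, hm]

lemma ee_sub_one (x : ℝ) : 4 * nd x ≤ ‖ee x - 1‖ := by
  obtain ⟨n, hn⟩ := nd_exists x
  have h2 := nd_le_half x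
  set y := x - n with hy
  have e : ee x = ee y := by
    rw [← ee_add_int y n, hy]; congr 1; ring
  rw [e, ee, mul_comm _ Complex.I, Complex.norm_exp_I_mul_ofReal_sub_one, hn]
  rw [norm_mul, Real.norm_eq_abs, Real.norm_eq_abs, abs_two]
  have e2 : 2 * Real.pi * y / 2 = Real.pi * y := by ring
  rw [e2]
  have := Real.mul_abs_le_abs_sin (x := Real.pi * y) (by
    rw [abs_mul, abs_of_pos Real.pi_pos]
    rw [← hn]
    nlinarith [Real.pi_pos])
  rw [abs_mul, abs_of_pos Real.pi_pos] at this
  have h3 : 2 / Real.pi * (Real.pi * |y|) = 2 * |y| := by field_simp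
  linarith

/-- geometric sum bound -/
lemma geo_bound (x : ℝ) (H : ℕ) : ‖∑ v ∈ Finset.range H, ee ((v + 1) * x)‖ * nd x ≤ 1 / 2 := by
  have h1 : ∑ v ∈ Finset.range H, ee ((v + 1) * x) = ee x * ∑ v ∈ Finset.range H, ee x ^ v := by
    rw [Finset.mul_sum]
    refine Finset.sum_congr rfl fun v _ => ?_
    rw [add_mul, one_mul, ee_add, ee_nat_mul, mul_comm]
  have h2 : ‖∑ v ∈ Finset.range H, ee ((v + 1) * x)‖ * ‖ee x - 1‖ ≤ 2 := by
    rw [h1, norm_mul, ee_norm, one_mul, ← norm_mul, geom_sum_mul]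
    refine (norm_sub_le _ _).trans ?_
    rw [norm_pow, ee_norm]
    simp
    norm_num
  have h3 := ee_sub_one x
  have h4 := norm_nonneg (∑ v ∈ Finset.range H, ee ((v + 1) * x))
  nlinarith

lemma geo_triv (x : ℝ) (H : ℕ) : ‖∑ v ∈ Finset.range H, ee ((v + 1) * x)‖ ≤ H := by
  refine (norm_sum_le _ _).trans ?_
  simp [ee_norm]

lemma geo_bucket (x : ℝ) (H : ℕ) (hH : 0 < H) :
    ‖∑ v ∈ Finset.range H, ee ((v + 1) * x)‖ ≤
      (H : ℝ) / ((⌊H * Int.fract x⌋₊ : ℝ) + 1) + (H : ℝ) / ((H : ℝ) - ⌊H * Int.fract x⌋₊) := by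
  set S := ‖∑ v ∈ Finset.range H, ee ((v + 1) * x)‖ with hS
  set m := ⌊H * Int.fract x⌋₊ with hm
  have hHR : (0 : ℝ) < H := by exact_mod_cast hH
  have hf0 := Int.fract_nonneg x
  have hf1 := Int.fract_lt_one x
  have hm1 : (m : ℝ) ≤ H * Int.fract x := Nat.floor_le (by positivity)
  have hm2 : H * Int.fract x < m + 1 := Nat.lt_floor_add_one _
  have hmH : m + 1 ≤ H := by
    have : (m : ℝ) < H := by nlinarith
    exact_mod_cast this
  have hmHR : (m : ℝ) + 1 ≤ H := by exact_mod_cast hmH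
  have g1 : S ≤ H := geo_triv x H
  have g2 : S * nd x ≤ 1 / 2 := geo_bound x H
  have hS0 : 0 ≤ S := norm_nonneg _
  have hp1 : 0 ≤ (H : ℝ) / ((m : ℝ) + 1) := by positivity
  have hp2 : 0 ≤ (H : ℝ) / ((H : ℝ) - m) := div_nonneg hHR.le (by linarith)
  have hnd : nd x = min (Int.fract x) (1 - Int.fract x) := by rw [nd, abs_sub_round_eq_min]
  rcases le_total (Int.fract x) (1 - Int.fract x) with h | h
  · rw [min_eq_left h] at hnd
    have : S ≤ (H : ℝ) / ((m : ℝ) + 1) := by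
      rw [le_div_iff₀ (by positivity)]
      rcases Nat.eq_zero_or_pos m with h0 | h0
      · rw [h0]; simpa using g1
      · have h1 : (1 : ℝ) ≤ m := by exact_mod_cast h0
        rw [hnd] at g2
        have : S * (m : ℝ) ≤ S * (H * Int.fract x) := by gcongr
        nlinarith
    linarith
  · rw [min_eq_right h] at hnd
    have : S ≤ (H : ℝ) / ((H : ℝ) - m) := by
      rw [le_div_iff₀ (by linarith)]
      rcases Nat.lt_or_ge (m + 1) H with h0 | h0
      · have h1 : (m : ℝ) + 2 ≤ H := by exact_mod_cast h0
        rw [hnd] at g2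
        have : S * ((H : ℝ) - (m + 1)) ≤ S * (H - H * Int.fract x) := by gcongr
        nlinarith
      · have : (H : ℝ) - m = 1 := by
          have : (H : ℝ) ≤ m + 1 := by exact_mod_cast h0
          linarith
        rw [this]; simpa using g1
    linarith

lemma sum_harm (H : ℕ) : ∑ m ∈ Finset.range H, ((H : ℝ) / ((m : ℝ) + 1) + (H : ℝ) / ((H : ℝ) - m)) ≤
    2 * H * (1 + Real.log H) := by
  have h1 : ∑ m ∈ Finset.range H, (H : ℝ) / ((H : ℝ) - m) = ∑ m ∈ Finset.range H, (H : ℝ) / ((m : ℝ) + 1) := by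
    rw [← Finset.sum_range_reflect]
    refine Finset.sum_congr rfl fun m hm => ?_
    rw [Finset.mem_range] at hm
    have : ((H - 1 - m : ℕ) : ℝ) = H - 1 - m := by
      rw [Nat.sub_sub, Nat.cast_sub (by omega)]; push_cast; ring
    rw [this]; congr 1; ring
  have h2 : ∑ m ∈ Finset.range H, (H : ℝ) / ((m : ℝ) + 1) ≤ H * (1 + Real.log H) := by
    have := harmonic_le_one_add_log H
    rw [harmonic] at this
    push_cast at this
    simp_rw [div_eq_mul_inv]
    rw [← Finset.mul_sum]
    gcongr
  rw [Finset.sum_add_distrib, h1]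
  linarith

/-- counting in buckets -/
lemma Z_bound (x : ℝ) (L H M : ℕ) (hH : 0 < H) (c : ℝ)
    (hM : ∀ D ⊆ Finset.range L, (∀ j ∈ D, ∀ j' ∈ D, nd (x * ((j : ℝ) - j')) < 1 / H) → D.card ≤ M) :
    ∑ j ∈ Finset.range L, ‖∑ v ∈ Finset.range H, ee ((v + 1) * (x * j + c))‖ ≤
      M * (2 * H * (1 + Real.log H)) := by
  have hHR : (0 : ℝ) < H := by exact_mod_cast hH
  set g : ℕ → ℕ := fun j => ⌊H * Int.fract (x * j + c)⌋₊ with hg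
  have hmap : ∀ j ∈ Finset.range L, g j ∈ Finset.range H := by
    intro j _
    rw [Finset.mem_range, hg]
    simp only
    rw [Nat.floor_lt (by have := Int.fract_nonneg (x * j + c); positivity)]
    nlinarith [Int.fract_lt_one (x * j + c)]
  calc _ ≤ ∑ j ∈ Finset.range L, ((H : ℝ) / ((g j : ℝ) + 1) + (H : ℝ) / ((H : ℝ) - g j)) :=
        Finset.sum_le_sum fun j _ => geo_bucket _ H hH
    _ = ∑ m ∈ Finset.range H, ∑ j ∈ Finset.range L with g j = m,
          ((H : ℝ) / ((g j : ℝ) + 1) + (H : ℝ) / ((H : ℝ) - g j)) :=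
        (Finset.sum_fiberwise_of_maps_to hmap _).symm
    _ = ∑ m ∈ Finset.range H, (((Finset.range L).filter fun j => g j = m).card : ℝ) *
          ((H : ℝ) / ((m : ℝ) + 1) + (H : ℝ) / ((H : ℝ) - m)) := by
        refine Finset.sum_congr rfl fun m _ => ?_
        rw [← nsmul_eq_mul, ← Finset.sum_const]
        refine Finset.sum_congr rfl fun j hj => ?_
        rw [(Finset.mem_filter.1 hj).2]
    _ ≤ ∑ m ∈ Finset.range H, (M : ℝ) *
          ((H : ℝ) / ((m : ℝ) + 1) + (H : ℝ) / ((H : ℝ) - m)) := by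
        refine Finset.sum_le_sum fun m hm => ?_
        rw [Finset.mem_range] at hm
        have hmR : (m : ℝ) < H := by exact_mod_cast hm
        refine mul_le_mul_of_nonneg_right ?_
          (add_nonneg (by positivity) (div_nonneg hHR.le (by linarith)))
        norm_cast
        refine hM _ (Finset.filter_subset _ _) ?_
        intro j hj j' hj'
        have e1 := (Finset.mem_filter.1 hj).2
        have e2 := (Finset.mem_filter.1 hj').2
        simp only [hg] at e1 e2
        have a1 := Nat.floor_le (by have := Int.fract_nonneg (x * j + c); positivity : 0 ≤ H * Int.fract (x * j + c))
        have a2 := Nat.lt_floor_add_one (H * Int.fract (x * j + c))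
        have b1 := Nat.floor_le (by have := Int.fract_nonneg (x * j' + c); positivity : 0 ≤ H * Int.fract (x * j' + c))
        have b2 := Nat.lt_floor_add_one (H * Int.fract (x * j' + c))
        rw [e1] at a1 a2
        rw [e2] at b1 b2
        have k1 := Int.floor_add_fract (x * j + c)
        have k2 := Int.floor_add_fract (x * j' + c)
        refine (nd_le _ (⌊x * j + c⌋ - ⌊x * j' + c⌋)).trans_lt ?_
        push_cast
        have e : x * ((j : ℝ) - j') - ((⌊x * j + c⌋ : ℝ) - ⌊x * j' + c⌋) =
            Int.fract (x * j + c) - Int.fract (x * j' + c) := by linarith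
        rw [e, lt_div_iff₀ hHR]
        rcases abs_cases (Int.fract (x * j + c) - Int.fract (x * j' + c)) with ⟨h, _⟩ | ⟨h, _⟩ <;> rw [h] <;> nlinarith
    _ ≤ _ := by
        rw [← Finset.mul_sum]
        exact mul_le_mul_of_nonneg_left (sum_harm H) (by positivity)

lemma lattice (x : ℝ) (L H : ℕ) (hH : 2 * L ≤ H) (D : Finset ℕ) (hDL : D ⊆ Finset.range L)
    (K : ℕ) (hK : 1 ≤ K) (hD : K + 1 ≤ D.card) (hnd : ∀ j ∈ D, ∀ j' ∈ D, nd (x * ((j : ℝ) - j')) < 1 / H) :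
    ∃ q : ℕ, 1 ≤ q ∧ q * K ≤ L ∧ nd (x * q) * (H * K) ≤ 1 := by
  classical
  have hne : D.Nonempty := Finset.card_pos.1 (by omega)
  have hL0 : 0 < L := by
    obtain ⟨j, hj⟩ := hne
    have := Finset.mem_range.1 (hDL hj)
    omega
  have hHR : (0 : ℝ) < H := by exact_mod_cast (by omega : 0 < H)
  set j0 := D.min' hne with hj0
  have hj0D : j0 ∈ D := D.min'_mem hne
  have hex : ∃ d : ℕ, 1 ≤ d ∧ ∃ a : ℤ, |x * d - a| < 1 / H := by
    obtain ⟨j1, hj1, hj1ne⟩ := Finset.exists_mem_ne (s := D) (by omega) j0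
    have hlt : j0 < j1 := lt_of_le_of_ne (D.min'_le _ hj1) hj1ne.symm
    refine ⟨j1 - j0, by omega, ?_⟩
    obtain ⟨a, ha⟩ := nd_exists (x * ((j1 : ℝ) - j0))
    refine ⟨a, ?_⟩
    rw [Nat.cast_sub hlt.le, ← ha]
    exact hnd _ hj1 _ hj0D
  set q := Nat.find hex with hq
  obtain ⟨hq1, a0, ha0⟩ := Nat.find_spec hex
  have hmin : ∀ d : ℕ, 1 ≤ d → ∀ a : ℤ, |x * d - a| < 1 / H → q ≤ d := fun d hd a ha =>
    Nat.find_min' hex ⟨hd, a, ha⟩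
  rw [← hq] at hq1 ha0
  have hqR : (1 : ℝ) ≤ q := by exact_mod_cast hq1
  have hcop : IsCoprime a0 (q : ℤ) := by
    rw [Int.isCoprime_iff_gcd_eq_one]
    set g := Int.gcd a0 q with hg
    have hg0 : 0 < g := Int.gcd_pos_of_ne_zero_right _ (by exact_mod_cast (by omega : q ≠ 0))
    obtain ⟨a', ha'⟩ : (g : ℤ) ∣ a0 := Int.gcd_dvd_left ..
    obtain ⟨q', hq'⟩ : g ∣ q := by
      have : (g : ℤ) ∣ q := Int.gcd_dvd_right ..
      exact_mod_cast this
    have hgR : (1 : ℝ) ≤ g := by exact_mod_cast hg0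
    have hq'1 : 1 ≤ q' := by
      rcases Nat.eq_zero_or_pos q' with h | h
      · rw [h] at hq'; omega
      · exact h
    have h1 := hmin q' hq'1 a' (by
      refine lt_of_le_of_lt ?_ ha0
      have e : x * q - a0 = g * (x * q' - a') := by rw [hq', ha']; push_cast; ring
      rw [e, abs_mul, Nat.abs_cast]
      nlinarith [abs_nonneg (x * q' - a')])
    have : g * q' ≤ 1 * q' := by rw [← hq', one_mul]; exact h1
    have := Nat.le_of_mul_le_mul_right this (by omega)
    omega
  have key : ∀ d : ℕ, 1 ≤ d → d ≤ L → ∀ a : ℤ, |x * d - a| < 1 / H →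
      q ∣ d ∧ |x * d - a| * q = d * |x * q - a0| := by
    intro d hd1 hdL a ha
    have hqd := hmin d hd1 a ha
    have hdLR : (d : ℝ) ≤ L := by exact_mod_cast hdL
    have hd0 : (1 : ℝ) ≤ d := by exact_mod_cast hd1
    have hqL : (q : ℝ) ≤ L := by exact_mod_cast hqd.trans hdL
    have hH2 : 2 * (L : ℝ) ≤ H := by exact_mod_cast hH
    have heq : (d : ℤ) * a0 = q * a := by
      have h1 : |(((d : ℤ) * a0 - q * a : ℤ) : ℝ)| < 1 := by
        push_cast
        have e : (d : ℝ) * a0 - q * a = q * (x * d - a) - d * (x * q - a0) := by ring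
        rw [e]
        calc _ ≤ |(q : ℝ) * (x * d - a)| + |(d : ℝ) * (x * q - a0)| := abs_sub _ _
          _ = q * |x * d - a| + d * |x * q - a0| := by
            rw [abs_mul, abs_mul, Nat.abs_cast, Nat.abs_cast]
          _ < L * (1 / H) + L * (1 / H) := by
            refine add_lt_add (lt_of_lt_of_le (mul_lt_mul_of_pos_left ha (by linarith)) ?_)
              (lt_of_lt_of_le (mul_lt_mul_of_pos_left ha0 (by linarith)) ?_) <;> gcongr
          _ ≤ 1 := by
            rw [← two_mul, mul_one_div, ← mul_div_assoc, div_le_one hHR]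
            exact hH2
      have h2 : |(d : ℤ) * a0 - q * a| < 1 := by exact_mod_cast h1
      have := Int.abs_lt_one_iff.1 h2
      linarith
    refine ⟨?_, ?_⟩
    · have : (q : ℤ) ∣ d * a0 := ⟨a, heq⟩
      have := hcop.symm.dvd_of_dvd_mul_right this
      exact_mod_cast this
    · have heqR : (d : ℝ) * a0 = q * a := by exact_mod_cast heq
      have h1 : |x * d - a| * q = |(x * d - a) * q| := by rw [abs_mul, Nat.abs_cast]
      have h2 : d * |x * q - a0| = |d * (x * q - a0)| := by rw [abs_mul, Nat.abs_cast]
      rw [h1, h2]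
      congr 1
      linarith
  -- the maximal element
  set t : ℕ → ℕ := fun j => (j - j0) / q with ht
  have hdiv : ∀ j ∈ D, q ∣ j - j0 := by
    intro j hj
    have hle : j0 ≤ j := D.min'_le _ hj
    rcases hle.eq_or_lt with h | h
    · rw [← h]; simp
    · have hjL := Finset.mem_range.1 (hDL hj)
      obtain ⟨a, ha⟩ := nd_exists (x * ((j : ℝ) - j0))
      refine (key (j - j0) (by omega) (by omega) a ?_).1
      rw [Nat.cast_sub hle, ← ha]
      exact hnd _ hj _ hj0D
  have hinj : Set.InjOn t D := by
    intro j hj j' hj' h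
    have h1 := Nat.div_mul_cancel (hdiv j hj)
    have h2 := Nat.div_mul_cancel (hdiv j' hj')
    have hle : j0 ≤ j := D.min'_le _ hj
    have hle' : j0 ≤ j' := D.min'_le _ hj'
    simp only [ht] at h
    rw [h] at h1
    omega
  obtain ⟨j, hj, hjt⟩ : ∃ j ∈ D, K ≤ t j := by
    by_contra hcon
    push Not at hcon
    have : D.card ≤ (Finset.range K).card := Finset.card_le_card_of_injOn t
      (fun j hj => by simpa using hcon j hj) hinj
    rw [Finset.card_range] at this
    omega
  have hle : j0 ≤ j := D.min'_le _ hj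
  have htj := Nat.div_mul_cancel (hdiv j hj)
  have hqK : q * K ≤ j - j0 := by
    rw [← htj, mul_comm]
    exact Nat.mul_le_mul_right _ hjt
  have hjL := Finset.mem_range.1 (hDL hj)
  refine ⟨q, hq1, by omega, ?_⟩
  obtain ⟨a, ha⟩ := nd_exists (x * ((j : ℝ) - j0))
  have hpos : 1 ≤ q * K := Nat.mul_pos hq1 hK
  have hlt : |x * ((j - j0 : ℕ) : ℝ) - a| < 1 / H := by
    rw [Nat.cast_sub hle, ← ha]
    exact hnd _ hj _ hj0D
  have h2 := (key (j - j0) (by omega) (by omega) a hlt).2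
  have h3 : nd (x * q) ≤ |x * q - a0| := nd_le _ _
  have hqKR : (q : ℝ) * K ≤ ((j - j0 : ℕ) : ℝ) := by exact_mod_cast hqK
  rw [lt_div_iff₀ hHR] at hlt
  have h4 : (q : ℝ) * (K * |x * q - a0|) ≤ q * |x * ((j - j0 : ℕ) : ℝ) - a| := by
    nlinarith [abs_nonneg (x * q - a0)]
  have h5 : K * |x * q - a0| ≤ |x * ((j - j0 : ℕ) : ℝ) - a| := le_of_mul_le_mul_left h4 (by linarith)
  have hKR : (0 : ℝ) ≤ K := by positivity
  calc nd (x * q) * (H * K) ≤ |x * q - a0| * (H * K) := by gcongr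
    _ = (K * |x * q - a0|) * H := by ring
    _ ≤ |x * ((j - j0 : ℕ) : ℝ) - a| * H := by gcongr
    _ ≤ 1 := hlt.le

end SFP


namespace SFP
open Finset

/-- number of solutions of the Vinogradov system (15 variables, degree 5) -/
def JJ (L : ℕ) : ℕ := ((Finset.univ : Finset ((Fin 15 → Fin L) × (Fin 15 → Fin L))).filter fun tt =>
  ∀ l : Fin 5, ∑ m, (tt.1 m : ℕ) ^ ((l : ℕ) + 1) = ∑ m, (tt.2 m : ℕ) ^ ((l : ℕ) + 1)).card

lemma map_sum_char {A ι : Type*} [AddCommMonoid A] (ψ : AddChar A ℂ) (s : Finset ι) (f : ι → A) :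
    ψ (∑ i ∈ s, f i) = ∏ i ∈ s, ψ (f i) := by
  classical
  induction s using Finset.induction_on with
  | empty => simp
  | insert a s ha ih => rw [Finset.sum_insert ha, Finset.prod_insert ha, AddChar.map_add_eq_mul, ih]

/-- linear characters -/
noncomputable def lchar (q k : ℕ) [NeZero q] (w : Fin (k + 1) → ZMod q) : AddChar (Fin (k + 1) → ZMod q) ℂ :=
  (ZMod.stdAddChar (N := q)).compAddMonoidHom
    { toFun := fun x => ∑ j, x j * w j
      map_zero' := by simp
      map_add' := by intro x y; simp [add_mul, Finset.sum_add_distrib] }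

lemma lchar_apply (q k : ℕ) [NeZero q] (w x : Fin (k + 1) → ZMod q) :
    lchar q k w x = ZMod.stdAddChar (∑ j, x j * w j) := rfl

lemma lchar_sum_re (q k : ℕ) [NeZero q] (w : Fin (k + 1) → ZMod q) :
    0 ≤ (∑ x, lchar q k w x).re := by
  classical
  rw [AddChar.sum_eq_ite]
  split_ifs
  · exact (Complex.natCast_re _).symm ▸ Nat.cast_nonneg _
  · simp

lemma JJ_le (L n : ℕ) [Fact (Nat.Prime 7)] :
    (JJ L : ℝ) * ((7 ^ (5 * n) : ℕ) : ℝ) ^ 6 ≤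
      Nm 7 5 n (fun m => m) (fun _ => 1) ((Finset.range L).map Nat.castEmbedding) := by
  set q := 7 ^ (5 * n) with hq
  have h0 : ∀ x, Fs q 5 (fun m => m) (fun _ => 1) ((Finset.range L).map Nat.castEmbedding) x =
      ∑ i : Fin L, ZMod.stdAddChar (ev x ((i : ℕ) : ZMod q)) := by
    intro x
    rw [Fs, Finset.sum_map, Finset.sum_range]
    simp
  have h1 : ∀ x, ((‖Fs q 5 (fun m => m) (fun _ => 1) ((Finset.range L).map Nat.castEmbedding) x‖ ^ (2 * tri 5) : ℝ) : ℂ)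
      = ∑ tt : (Fin 15 → Fin L) × (Fin 15 → Fin L),
        lchar q 5 (fun j => ∑ m, ((tt.1 m : ℕ) : ZMod q) ^ (j : ℕ) - ∑ m, ((tt.2 m : ℕ) : ZMod q) ^ (j : ℕ)) x := by
    intro x
    have e : ((‖Fs q 5 (fun m => m) (fun _ => 1) ((Finset.range L).map Nat.castEmbedding) x‖ ^ (2 * tri 5) : ℝ) : ℂ)
        = (Fs q 5 (fun m => m) (fun _ => 1) ((Finset.range L).map Nat.castEmbedding) x) ^ 15 *
          (starRingEnd ℂ) ((Fs q 5 (fun m => m) (fun _ => 1) ((Finset.range L).map Nat.castEmbedding) x) ^ 15) := by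
      rw [Complex.mul_conj, Complex.normSq_eq_norm_sq, norm_pow, ← pow_mul]
      have : 2 * tri 5 = 15 * 2 := by decide
      rw [this]
    rw [e, h0]
    have e2 : (∑ i : Fin L, ZMod.stdAddChar (ev x ((i : ℕ) : ZMod q)) : ℂ) ^ 15 =
        ∑ t : Fin 15 → Fin L, ZMod.stdAddChar (∑ m, ev x ((t m : ℕ) : ZMod q)) := by
      have e3 : ∀ t : Fin 15 → Fin L, (ZMod.stdAddChar (∑ m, ev x ((t m : ℕ) : ZMod q)) : ℂ) =
          ∏ m, ZMod.stdAddChar (ev x ((t m : ℕ) : ZMod q)) := fun t => map_sum_char _ _ _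
      rw [Finset.sum_congr rfl fun t _ => e3 t]
      have := Finset.prod_univ_sum (ι := Fin 15) (t := fun _ => (Finset.univ : Finset (Fin L)))
        (f := fun _ i => (ZMod.stdAddChar (ev x ((i : ℕ) : ZMod q)) : ℂ))
      rw [Finset.prod_const, Finset.card_univ, Fintype.card_fin, Fintype.piFinset_univ] at this
      exact this
    rw [e2, map_sum, Finset.sum_mul_sum, ← Finset.univ_product_univ, Finset.sum_product]
    refine Finset.sum_congr rfl fun t _ => Finset.sum_congr rfl fun t' _ => ?_
    rw [← AddChar.map_neg_eq_conj, ← AddChar.map_add_eq_mul, lchar_apply]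
    congr 1
    simp only [ev, mul_sub, Finset.sum_sub_distrib, Finset.mul_sum]
    rw [Finset.sum_comm, Finset.sum_comm (γ := Fin 15) (s := Finset.univ) (t := Finset.univ), ← sub_eq_add_neg]
  have h2 : Nm 7 5 n (fun m => m) (fun _ => 1) ((Finset.range L).map Nat.castEmbedding) =
      ∑ tt : (Fin 15 → Fin L) × (Fin 15 → Fin L), (∑ x,
        lchar q 5 (fun j => ∑ m, ((tt.1 m : ℕ) : ZMod q) ^ (j : ℕ) - ∑ m, ((tt.2 m : ℕ) : ZMod q) ^ (j : ℕ)) x).re := by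
    rw [← Complex.re_sum, Finset.sum_comm, ← Finset.sum_congr rfl fun x _ => h1 x, ← Complex.ofReal_sum, Complex.ofReal_re]
    rfl
  rw [h2, JJ]
  have h3 : ∀ tt ∈ ((Finset.univ : Finset ((Fin 15 → Fin L) × (Fin 15 → Fin L))).filter fun tt =>
      ∀ l : Fin 5, ∑ m, (tt.1 m : ℕ) ^ ((l : ℕ) + 1) = ∑ m, (tt.2 m : ℕ) ^ ((l : ℕ) + 1)),
      (q : ℝ) ^ 6 ≤ (∑ x,
        lchar q 5 (fun j => ∑ m, ((tt.1 m : ℕ) : ZMod q) ^ (j : ℕ) - ∑ m, ((tt.2 m : ℕ) : ZMod q) ^ (j : ℕ)) x).re := by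
    intro tt htt
    have htt := (Finset.mem_filter.1 htt).2
    have e : (fun j : Fin 6 => ∑ m, ((tt.1 m : ℕ) : ZMod q) ^ (j : ℕ) - ∑ m, ((tt.2 m : ℕ) : ZMod q) ^ (j : ℕ)) = 0 := by
      funext j
      rw [Pi.zero_apply, sub_eq_zero]
      refine Fin.cases ?_ (fun l => ?_) j
      · simp
      · have := congrArg (Nat.cast : ℕ → ZMod q) (htt l)
        push_cast at this
        simpa using this
    rw [e]
    simp only [lchar_apply, Pi.zero_apply, mul_zero, Finset.sum_const_zero, AddChar.map_zero_eq_one,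
      Finset.sum_const, nsmul_eq_mul, mul_one, Complex.natCast_re, Finset.card_univ]
    rw [Fintype.card_fun, ZMod.card, Fintype.card_fin]
    push_cast
    exact le_rfl
  calc _ ≤ ∑ tt ∈ ((Finset.univ : Finset ((Fin 15 → Fin L) × (Fin 15 → Fin L))).filter fun tt =>
      ∀ l : Fin 5, ∑ m, (tt.1 m : ℕ) ^ ((l : ℕ) + 1) = ∑ m, (tt.2 m : ℕ) ^ ((l : ℕ) + 1)), (∑ x,
        lchar q 5 (fun j => ∑ m, ((tt.1 m : ℕ) : ZMod q) ^ (j : ℕ) - ∑ m, ((tt.2 m : ℕ) : ZMod q) ^ (j : ℕ)) x).re := by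
        rw [← nsmul_eq_mul]
        exact Finset.card_nsmul_le_sum _ _ _ h3
    _ ≤ _ := Finset.sum_le_sum_of_subset_of_nonneg (Finset.filter_subset _ _)
        fun tt _ _ => lchar_sum_re _ _ _

lemma Vn_le (L n : ℕ) [Fact (Nat.Prime 7)] (hL : L ≤ 7 ^ n) :
    Vn 7 5 n (fun m => m) (fun _ => 1) ((Finset.range L).map Nat.castEmbedding) ≤
      L * (((7 ^ (5 * n) : ℕ) : ℝ) ^ 6) ^ ((tri 5 : ℝ)⁻¹) := by
  classical
  set q := 7 ^ (5 * n) with hq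
  set S : Finset ℤ := (Finset.range L).map Nat.castEmbedding with hS
  rw [Vn]
  set f : ZMod (7 ^ n) → ℝ := fun c => (Nm 7 5 n (fun m => m) (fun _ => 1)
    (S.filter fun m => ((m : ℤ) : ZMod (7 ^ n)) = c)) ^ ((tri 5 : ℝ)⁻¹) with hf
  have h1 : ∑ c, f c = ∑ c ∈ S.image (fun m => ((m : ℤ) : ZMod (7 ^ n))), f c := by
    symm
    apply Finset.sum_subset (Finset.subset_univ _)
    intro c _ hc
    simp only [hf]
    have : S.filter (fun m => ((m : ℤ) : ZMod (7 ^ n)) = c) = ∅ := by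
      rw [Finset.filter_eq_empty_iff]
      intro m hm h
      exact hc (Finset.mem_image.2 ⟨m, hm, h⟩)
    rw [this, Nm_empty _ _ _ (by norm_num), Real.zero_rpow]
    have : tri 5 = 15 := by decide
    rw [this]; norm_num
  have h2 : ∀ c ∈ S.image (fun m => ((m : ℤ) : ZMod (7 ^ n))), f c ≤ ((q : ℝ) ^ 6) ^ ((tri 5 : ℝ)⁻¹) := by
    intro c hc
    obtain ⟨m, hm, rfl⟩ := Finset.mem_image.1 hc
    have : S.filter (fun m' => ((m' : ℤ) : ZMod (7 ^ n)) = (m : ZMod (7 ^ n))) = {m} := by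
      ext m'
      rw [Finset.mem_filter, Finset.mem_singleton]
      constructor
      · rintro ⟨h, h'⟩
        rw [class_eq] at h'
        rw [hS, Finset.mem_map] at h hm
        obtain ⟨i, hi, rfl⟩ := h
        obtain ⟨j, hj, rfl⟩ := hm
        rw [Finset.mem_range] at hi hj
        simp only [Nat.castEmbedding_apply] at h' ⊢
        have hb : |(i : ℤ) - j| < 7 ^ n := by
          have : (L : ℤ) ≤ 7 ^ n := by exact_mod_cast hL
          rw [abs_lt]; constructor <;> linarith [(by exact_mod_cast hi : (i : ℤ) < L), (by exact_mod_cast hj : (j : ℤ) < L), (by positivity : (0 : ℤ) ≤ i), (by positivity : (0 : ℤ) ≤ j)]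
        have := Int.eq_zero_of_abs_lt_dvd h' (by exact_mod_cast hb)
        linarith
      · rintro rfl; exact ⟨hm, rfl⟩
    simp only [hf]
    rw [this]
    apply Real.rpow_le_rpow (Nm_nonneg _ _ _ _ _ _) _ (by positivity)
    rw [Nm]
    simp only [Fs, Finset.sum_singleton, one_mul]
    have hn : ∀ z : ZMod q, ‖(ZMod.stdAddChar z : ℂ)‖ = 1 := fun z => AddChar.norm_apply _ _
    simp only [← hq, hn, one_pow, Finset.sum_const, Finset.card_univ, nsmul_eq_mul, mul_one]
    rw [Fintype.card_fun, ZMod.card, Fintype.card_fin]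
    push_cast
    exact le_rfl
  rw [h1]
  refine (Finset.sum_le_card_nsmul _ _ _ h2).trans ?_
  rw [nsmul_eq_mul]
  refine mul_le_mul_of_nonneg_right ?_ (by positivity)
  have : (S.image (fun m => ((m : ℤ) : ZMod (7 ^ n)))).card ≤ L := by
    refine Finset.card_image_le.trans ?_
    rw [hS]; simp
  exact_mod_cast this

theorem vmvt (ε : ℝ) (hε : 0 < ε) : ∃ C : ℝ, 1 ≤ C ∧ ∀ L : ℕ, 1 ≤ L → (JJ L : ℝ) ≤ C * (L : ℝ) ^ (15 + ε) := by
  have : Fact (Nat.Prime 7) := ⟨by norm_num⟩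
  obtain ⟨C, hC, hD⟩ := decoupling 7 5 (by norm_num) (by norm_num) ε hε
  have h7 : (1 : ℝ) ≤ 7 ^ ε := Real.one_le_rpow (by norm_num) hε.le
  refine ⟨C * 7 ^ ε, by nlinarith, fun L hL => ?_⟩
  set n := Nat.clog 7 L with hn
  have hLn : L ≤ 7 ^ n := Nat.le_pow_clog (by norm_num) L
  have hnL : (7 : ℝ) ^ n ≤ 7 * L := by
    rcases Nat.lt_or_ge 1 L with h | h
    · have h1 := Nat.pow_pred_clog_lt_self (b := 7) (by norm_num) h
      have h2 : 0 < Nat.clog 7 L := Nat.clog_pos (by norm_num) h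
      rw [← hn] at h1 h2
      have h3 : 7 ^ n ≤ 7 * L := by
        obtain ⟨m, hm⟩ : ∃ m, n = m + 1 := ⟨n - 1, by omega⟩
        rw [hm] at h1 ⊢
        rw [Nat.pred_eq_sub_one, Nat.add_sub_cancel] at h1
        rw [pow_succ]; omega
      exact_mod_cast h3
    · have : L = 1 := by omega
      rw [hn, this]; simp; 
  have hLR : (1 : ℝ) ≤ L := by exact_mod_cast hL
  have hq : (0 : ℝ) < ((7 ^ (5 * n) : ℕ) : ℝ) ^ 6 := by positivity
  have h1 := (JJ_le L n).trans (hD n (fun m => m) (fun _ => 1) ((Finset.range L).map Nat.castEmbedding))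
  have h2 : Vn 7 5 n (fun m => m) (fun _ => 1) ((Finset.range L).map Nat.castEmbedding) ^ tri 5 ≤
      (L : ℝ) ^ 15 * ((7 ^ (5 * n) : ℕ) : ℝ) ^ 6 := by
    refine (pow_le_pow_left₀ (Vn_nonneg _ _ _ _ _ _) (Vn_le L n hLn) _).trans ?_
    rw [mul_pow, Real.rpow_inv_natCast_pow hq.le (by decide)]
    have : tri 5 = 15 := by decide
    rw [this]
  have h3 : C * ((7 : ℕ) : ℝ) ^ (ε * n) ≤ C * 7 ^ ε * (L : ℝ) ^ ε := by
    rw [mul_assoc, ← Real.mul_rpow (by norm_num) (by positivity), mul_comm ε, Real.rpow_mul (by positivity), Real.rpow_natCast]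
    push_cast
    gcongr
  have h4 : (JJ L : ℝ) * ((7 ^ (5 * n) : ℕ) : ℝ) ^ 6 ≤ (C * 7 ^ ε * (L : ℝ) ^ (15 + ε)) * ((7 ^ (5 * n) : ℕ) : ℝ) ^ 6 := by
    calc _ ≤ _ := h1
      _ ≤ (C * 7 ^ ε * (L : ℝ) ^ ε) * ((L : ℝ) ^ 15 * ((7 ^ (5 * n) : ℕ) : ℝ) ^ 6) :=
        mul_le_mul h3 h2 (pow_nonneg (Vn_nonneg _ _ _ _ _ _) _) (by positivity)
      _ = _ := by
        have e : (L : ℝ) ^ (15 + ε) = (L : ℝ) ^ 15 * (L : ℝ) ^ ε := by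
          rw [Real.rpow_add (by linarith)]
          congr 1
          exact_mod_cast Real.rpow_natCast (L : ℝ) 15
        rw [e]; ring
  exact le_of_mul_le_mul_right h4 hq

end SFP


namespace SFP
open Finset

lemma dual_sieve {T V J : Type*} [Fintype T] [Fintype J] [DecidableEq V] (γ : T → V) (A : T → ℂ)
    (hA : ∀ t, ‖A t‖ ≤ 1) (φ : J → V → ℂ) (B : Finset V) (hB : ∀ t, γ t ∈ B) (Z : ℝ) (hZ0 : 0 ≤ Z)
    (hZ : ∀ j, ∑ j', ‖∑ v ∈ B, φ j v * (starRingEnd ℂ) (φ j' v)‖ ≤ Z) :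
    ∑ j, ‖∑ t, A t * φ j (γ t)‖ ^ 2 ≤
      (((Finset.univ : Finset (T × T)).filter fun tt => γ tt.1 = γ tt.2).card : ℝ) * Z := by
  set R : J → ℂ := fun j => ∑ t, A t * φ j (γ t) with hR
  set X : ℝ := ∑ j, ‖R j‖ ^ 2 with hX
  set N : ℝ := (((Finset.univ : Finset (T × T)).filter fun tt => γ tt.1 = γ tt.2).card : ℝ) with hN
  set a : V → ℂ := fun v => ∑ t with γ t = v, A t with ha
  set W : V → ℂ := fun v => ∑ j, (starRingEnd ℂ) (R j) * φ j v with hW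
  have hX0 : 0 ≤ X := Finset.sum_nonneg fun _ _ => by positivity
  have hRa : ∀ j, R j = ∑ v ∈ B, a v * φ j v := by
    intro j
    simp only [hR, ha]
    rw [← Finset.sum_fiberwise_of_maps_to (s := Finset.univ) (t := B) (g := γ) (fun t _ => hB t)]
    refine Finset.sum_congr rfl fun v _ => ?_
    rw [Finset.sum_mul]
    refine Finset.sum_congr rfl fun t ht => ?_
    rw [(Finset.mem_filter.1 ht).2]
  have e1 : (X : ℂ) = ∑ v ∈ B, a v * W v := by
    rw [hX]
    push_cast
    simp only [hW, Finset.mul_sum]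
    rw [Finset.sum_comm]
    refine Finset.sum_congr rfl fun j _ => ?_
    have : ((‖R j‖ : ℂ)) ^ 2 = (starRingEnd ℂ) (R j) * R j := by
      rw [Complex.conj_mul']
    rw [this]
    conv_lhs => rw [hRa j, Finset.mul_sum]
    rw [hRa j]
    exact Finset.sum_congr rfl fun v _ => by ring
  have e2 : X ≤ ∑ v ∈ B, ‖a v‖ * ‖W v‖ := by
    have : X = ‖(X : ℂ)‖ := by rw [Complex.norm_real, Real.norm_of_nonneg hX0]
    rw [this, e1]
    refine (norm_sum_le _ _).trans (le_of_eq ?_)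
    exact Finset.sum_congr rfl fun v _ => norm_mul _ _
  have e3 : ∑ v ∈ B, ‖a v‖ ^ 2 ≤ N := by
    have h1 : ∀ v ∈ B, ‖a v‖ ^ 2 ≤ (((Finset.univ : Finset T).filter fun t => γ t = v).card : ℝ) ^ 2 := by
      intro v _
      gcongr
      refine (norm_sum_le _ _).trans ?_
      refine (Finset.sum_le_card_nsmul _ _ 1 fun t _ => hA t).trans ?_
      simp
    refine (Finset.sum_le_sum h1).trans ?_
    rw [hN]
    have : ((Finset.univ : Finset (T × T)).filter fun tt => γ tt.1 = γ tt.2).card =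
        ∑ v ∈ B, ((Finset.univ : Finset T).filter fun t => γ t = v).card ^ 2 := by
      rw [Finset.card_eq_sum_card_fiberwise (f := fun tt : T × T => γ tt.1) (t := B) (fun tt _ => hB _)]
      refine Finset.sum_congr rfl fun v _ => ?_
      rw [sq, ← Finset.card_product]
      congr 1
      ext ⟨t, t'⟩
      simp only [Finset.mem_filter, Finset.mem_univ, true_and, Finset.mem_product]
      constructor
      · rintro ⟨h1, h2⟩; exact ⟨h2, h1 ▸ h2⟩
      · rintro ⟨h1, h2⟩; exact ⟨h1.trans h2.symm, h1⟩
    rw [this]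
    push_cast
    exact le_rfl
  have hGs : ∀ j j', ‖∑ v ∈ B, φ j v * (starRingEnd ℂ) (φ j' v)‖ = ‖∑ v ∈ B, φ j' v * (starRingEnd ℂ) (φ j v)‖ := by
    intro j j'
    rw [← Complex.norm_conj, map_sum]
    congr 1
    refine Finset.sum_congr rfl fun v _ => ?_
    rw [map_mul, Complex.conj_conj, mul_comm]
  have e4 : ∑ v ∈ B, ‖W v‖ ^ 2 ≤ X * Z := by
    have h1 : ((∑ v ∈ B, ‖W v‖ ^ 2 : ℝ) : ℂ) = ∑ j, ∑ j', (starRingEnd ℂ) (R j) * R j' *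
        ∑ v ∈ B, φ j v * (starRingEnd ℂ) (φ j' v) := by
      push_cast
      have : ∀ v ∈ B, ((‖W v‖ : ℂ)) ^ 2 = ∑ j, ∑ j', (starRingEnd ℂ) (R j) * R j' *
          (φ j v * (starRingEnd ℂ) (φ j' v)) := by
        intro v _
        rw [← Complex.mul_conj', hW]
        simp only
        rw [map_sum, Finset.sum_mul_sum]
        refine Finset.sum_congr rfl fun j _ => Finset.sum_congr rfl fun j' _ => ?_
        rw [map_mul, Complex.conj_conj]; ring
      rw [Finset.sum_congr rfl this, Finset.sum_comm]
      refine Finset.sum_congr rfl fun j _ => ?_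
      rw [Finset.sum_comm]
      refine Finset.sum_congr rfl fun j' _ => ?_
      exact (Finset.mul_sum _ _ _).symm
    have h2 : ∑ v ∈ B, ‖W v‖ ^ 2 ≤ ∑ j, ∑ j', ‖R j‖ * ‖R j'‖ * ‖∑ v ∈ B, φ j v * (starRingEnd ℂ) (φ j' v)‖ := by
      have : ∑ v ∈ B, ‖W v‖ ^ 2 = ‖((∑ v ∈ B, ‖W v‖ ^ 2 : ℝ) : ℂ)‖ := by
        rw [Complex.norm_real, Real.norm_of_nonneg (Finset.sum_nonneg fun _ _ => by positivity)]
      rw [this, h1]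
      refine (norm_sum_le _ _).trans (Finset.sum_le_sum fun j _ => (norm_sum_le _ _).trans (le_of_eq ?_))
      refine Finset.sum_congr rfl fun j' _ => ?_
      rw [norm_mul, norm_mul, Complex.norm_conj]
    refine h2.trans ?_
    have h3 : ∑ j, ∑ j', ‖R j‖ * ‖R j'‖ * ‖∑ v ∈ B, φ j v * (starRingEnd ℂ) (φ j' v)‖ ≤
        ∑ j, ∑ j', (‖R j‖ ^ 2 / 2 * ‖∑ v ∈ B, φ j v * (starRingEnd ℂ) (φ j' v)‖ +
          ‖R j'‖ ^ 2 / 2 * ‖∑ v ∈ B, φ j v * (starRingEnd ℂ) (φ j' v)‖) := by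
      refine Finset.sum_le_sum fun j _ => Finset.sum_le_sum fun j' _ => ?_
      rw [← add_mul]
      refine mul_le_mul_of_nonneg_right ?_ (norm_nonneg _)
      nlinarith [sq_nonneg (‖R j‖ - ‖R j'‖)]
    refine h3.trans ?_
    simp only [Finset.sum_add_distrib]
    have h4 : ∑ j, ∑ j', ‖R j'‖ ^ 2 / 2 * ‖∑ v ∈ B, φ j v * (starRingEnd ℂ) (φ j' v)‖ =
        ∑ j, ∑ j', ‖R j‖ ^ 2 / 2 * ‖∑ v ∈ B, φ j v * (starRingEnd ℂ) (φ j' v)‖ := by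
      rw [Finset.sum_comm]
      refine Finset.sum_congr rfl fun j _ => Finset.sum_congr rfl fun j' _ => ?_
      rw [hGs]
    rw [h4, ← two_mul, Finset.mul_sum, hX, Finset.sum_mul]
    refine Finset.sum_le_sum fun j _ => ?_
    rw [← Finset.mul_sum]
    have := mul_le_mul_of_nonneg_left (hZ j) (by positivity : 0 ≤ ‖R j‖ ^ 2)
    linarith
  have e5 : X ^ 2 ≤ N * (X * Z) := by
    calc X ^ 2 ≤ (∑ v ∈ B, ‖a v‖ * ‖W v‖) ^ 2 := by gcongr
      _ ≤ (∑ v ∈ B, ‖a v‖ ^ 2) * ∑ v ∈ B, ‖W v‖ ^ 2 := Finset.sum_mul_sq_le_sq_mul_sq _ _ _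
      _ ≤ N * (X * Z) := mul_le_mul e3 e4 (Finset.sum_nonneg fun _ _ => by positivity) (by positivity)
  rcases hX0.eq_or_lt with h | h
  · rw [← h]
    positivity
  · have : X * X ≤ X * (N * Z) := by nlinarith
    exact le_of_mul_le_mul_left this h

/-- the smoothed Weyl sum -/
noncomputable def TT (L : ℕ) (α : ℝ) : ℂ :=
  ∑ j ∈ Finset.range L, ∑ i ∈ Finset.range L, ee (α * ((i : ℝ) + j + 1) ^ 6)

/-- coefficient vector -/
noncomputable def cf (α : ℝ) (j : ℕ) (l : Fin 5) : ℝ :=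
  α * (Nat.choose 6 ((l : ℕ) + 1)) * ((j : ℝ) + 1) ^ (5 - (l : ℕ))

lemma ee_expand (α : ℝ) (i j : ℕ) : ee (α * ((i : ℝ) + j + 1) ^ 6) =
    ee (α * ((j : ℝ) + 1) ^ 6) * (ee (α * (i : ℝ) ^ 6) * ee (∑ l : Fin 5, cf α j l * (i : ℝ) ^ ((l : ℕ) + 1))) := by
  rw [← ee_add, ← ee_add]
  congr 1
  simp only [Fin.sum_univ_five, cf]
  have c1 : Nat.choose 6 1 = 6 := by decide
  have c2 : Nat.choose 6 2 = 15 := by decide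
  have c3 : Nat.choose 6 3 = 20 := by decide
  have c4 : Nat.choose 6 4 = 15 := by decide
  have c5 : Nat.choose 6 5 = 6 := by decide
  have e0 : ((0 : Fin 5) : ℕ) = 0 := rfl
  have e1 : ((1 : Fin 5) : ℕ) = 1 := rfl
  have e2 : ((2 : Fin 5) : ℕ) = 2 := rfl
  have e3 : ((3 : Fin 5) : ℕ) = 3 := rfl
  have e4 : ((4 : Fin 5) : ℕ) = 4 := rfl
  simp only [e0, e1, e2, e3, e4, c1, c2, c3, c4, c5, Nat.reduceAdd, Nat.reduceSub]
  push_cast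
  ring

lemma T_pow (L : ℕ) (hL : 1 ≤ L) (α : ℝ) : ‖TT L α‖ ^ 30 ≤ (L : ℝ) ^ 29 * ∑ j : Fin L,
    ‖∑ t : Fin 15 → Fin L, (∏ m, ee (α * ((t m : ℕ) : ℝ) ^ 6)) *
      ee (∑ l : Fin 5, cf α j l * ((∑ m, (t m : ℕ) ^ ((l : ℕ) + 1) : ℕ) : ℝ))‖ ^ 2 := by
  have hLR : (0 : ℝ) < L := by exact_mod_cast hL
  have h1 : ‖TT L α‖ ≤ ∑ j : Fin L, ‖∑ i : Fin L, ee (α * (i : ℝ) ^ 6) *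
      ee (∑ l : Fin 5, cf α j l * (i : ℝ) ^ ((l : ℕ) + 1))‖ := by
    rw [TT, Finset.sum_range]
    refine (norm_sum_le _ _).trans (Finset.sum_le_sum fun j _ => le_of_eq ?_)
    rw [Finset.sum_range, Finset.sum_congr rfl fun (i : Fin L) _ => ee_expand α (i : ℕ) (j : ℕ), ← Finset.mul_sum, norm_mul, ee_norm, one_mul]
  have h2 := pow_sum_div_card_le_sum_pow (s := (Finset.univ : Finset (Fin L)))
    (f := fun j => ‖∑ i : Fin L, ee (α * (i : ℝ) ^ 6) *
      ee (∑ l : Fin 5, cf α j l * (i : ℝ) ^ ((l : ℕ) + 1))‖) (fun _ _ => norm_nonneg _) 29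
  rw [Finset.card_univ, Fintype.card_fin, div_le_iff₀ (by positivity)] at h2
  calc ‖TT L α‖ ^ 30 ≤ (∑ j : Fin L, ‖∑ i : Fin L, ee (α * (i : ℝ) ^ 6) *
      ee (∑ l : Fin 5, cf α j l * (i : ℝ) ^ ((l : ℕ) + 1))‖) ^ 30 := by gcongr
    _ ≤ _ := h2
    _ = _ := by
      rw [mul_comm]
      congr 1
      refine Finset.sum_congr rfl fun j _ => ?_
      have : (29 + 1 : ℕ) = 15 * 2 := by norm_num
      rw [this, pow_mul, ← norm_pow]
      congr 2
      have := Finset.prod_univ_sum (ι := Fin 15) (t := fun _ => (Finset.univ : Finset (Fin L)))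
        (f := fun _ i => ee (α * ((i : ℕ) : ℝ) ^ 6) *
          ee (∑ l : Fin 5, cf α j l * ((i : ℕ) : ℝ) ^ ((l : ℕ) + 1)))
      rw [Finset.prod_const, Finset.card_univ, Fintype.card_fin, Fintype.piFinset_univ] at this
      rw [this]
      refine Finset.sum_congr rfl fun t _ => ?_
      rw [Finset.prod_mul_distrib, ← ee_sum, ← ee_sum]
      congr 2
      rw [Finset.sum_comm]
      refine Finset.sum_congr rfl fun l _ => ?_
      push_cast
      rw [Finset.mul_sum]

lemma range_shift (x : ℝ) (H : ℕ) : ‖∑ v ∈ Finset.range H, ee ((v : ℝ) * x)‖ =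
    ‖∑ v ∈ Finset.range H, ee (((v : ℝ) + 1) * x)‖ := by
  have : ∑ v ∈ Finset.range H, ee (((v : ℝ) + 1) * x) = ee x * ∑ v ∈ Finset.range H, ee ((v : ℝ) * x) := by
    rw [Finset.mul_sum]
    refine Finset.sum_congr rfl fun v _ => ?_
    rw [← ee_add]; congr 1; ring
  rw [this, norm_mul, ee_norm, one_mul]

lemma box_sum (L : ℕ) (hL : 1 ≤ L) (c c' : Fin 5 → ℝ) :
    ‖∑ v ∈ Fintype.piFinset (fun l : Fin 5 => Finset.range (15 * L ^ ((l : ℕ) + 1))),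
      ee (∑ l, c l * (v l : ℝ)) * (starRingEnd ℂ) (ee (∑ l, c' l * (v l : ℝ)))‖ ≤
    15 ^ 4 * (L : ℝ) ^ 10 * ‖∑ v ∈ Finset.range (15 * L ^ 5), ee (((v : ℝ) + 1) * (c 4 - c' 4))‖ := by
  have h := Finset.prod_univ_sum (ι := Fin 5) (t := fun l : Fin 5 => Finset.range (15 * L ^ ((l : ℕ) + 1)))
        (f := fun l v => ee ((v : ℝ) * (c l - c' l)))
  have h2 : ∑ v ∈ Fintype.piFinset (fun l : Fin 5 => Finset.range (15 * L ^ ((l : ℕ) + 1))),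
      ee (∑ l, c l * (v l : ℝ)) * (starRingEnd ℂ) (ee (∑ l, c' l * (v l : ℝ))) =
      ∏ l : Fin 5, ∑ v ∈ Finset.range (15 * L ^ ((l : ℕ) + 1)), ee ((v : ℝ) * (c l - c' l)) := by
    rw [h]
    refine Finset.sum_congr rfl fun v _ => ?_
    rw [← ee_neg, ← ee_add, ← ee_sum]
    congr 1
    rw [← sub_eq_add_neg, ← Finset.sum_sub_distrib]
    exact Finset.sum_congr rfl fun l _ => by ring
  rw [h2, norm_prod, Fin.prod_univ_five]
  have g : ∀ l : Fin 5, ‖∑ v ∈ Finset.range (15 * L ^ ((l : ℕ) + 1)), ee ((v : ℝ) * (c l - c' l))‖ ≤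
      15 * (L : ℝ) ^ ((l : ℕ) + 1) := by
    intro l
    rw [range_shift]
    refine (geo_triv _ _).trans ?_
    push_cast
    exact le_rfl
  have e4 : ((4 : Fin 5) : ℕ) + 1 = 5 := rfl
  rw [range_shift (c 4 - c' 4), e4]
  refine mul_le_mul_of_nonneg_right ?_ (norm_nonneg _)
  calc _ ≤ (15 * (L : ℝ) ^ (((0 : Fin 5) : ℕ) + 1)) * (15 * (L : ℝ) ^ (((1 : Fin 5) : ℕ) + 1)) *
        (15 * (L : ℝ) ^ (((2 : Fin 5) : ℕ) + 1)) * (15 * (L : ℝ) ^ (((3 : Fin 5) : ℕ) + 1)) := by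
        refine mul_le_mul (mul_le_mul (mul_le_mul (g 0) (g 1) (norm_nonneg _) (by positivity)) (g 2)
          (norm_nonneg _) (by positivity)) (g 3) (norm_nonneg _) (by positivity)
    _ = _ := by
      have e0 : ((0 : Fin 5) : ℕ) = 0 := rfl
      have e1 : ((1 : Fin 5) : ℕ) = 1 := rfl
      have e2 : ((2 : Fin 5) : ℕ) = 2 := rfl
      have e3 : ((3 : Fin 5) : ℕ) = 3 := rfl
      rw [e0, e1, e2, e3]; ring

lemma T_boundZ (L : ℕ) (hL : 1 ≤ L) (α : ℝ) (M : ℕ)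
    (hM : ∀ D ⊆ Finset.range L, (∀ j ∈ D, ∀ j' ∈ D,
      nd (6 * α * ((j : ℝ) - j')) < 1 / ((15 * L ^ 5 : ℕ) : ℝ)) → D.card ≤ M) (j : Fin L) :
    ∑ j' : Fin L, ‖∑ v ∈ Finset.range (15 * L ^ 5), ee (((v : ℝ) + 1) * (cf α j 4 - cf α j' 4))‖ ≤
      (M * (2 * ((15 * L ^ 5 : ℕ) : ℝ) * (1 + Real.log ((15 * L ^ 5 : ℕ) : ℝ)))) := by
  have := Z_bound (-(6 * α)) L (15 * L ^ 5) M (by positivity) (6 * α * j) (by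
    intro D hD hDD
    refine hM D hD fun j hj j' hj' => ?_
    have := hDD j hj j' hj'
    rwa [neg_mul, nd_neg] at this)
  rw [Finset.sum_range] at this
  refine le_trans (le_of_eq ?_) this
  have e4 : ((4 : Fin 5) : ℕ) = 4 := rfl
  have c5 : Nat.choose 6 (4 + 1) = 6 := by decide
  have e : ∀ j' : Fin L, cf α j 4 - cf α j' 4 = -(6 * α) * (j' : ℕ) + 6 * α * (j : ℕ) := by
    intro j'
    simp only [cf]
    rw [e4, c5]
    push_cast
    ring
  refine Finset.sum_congr rfl fun j' _ => ?_
  rw [e]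

lemma JJ_card (L : ℕ) : ((Finset.univ : Finset ((Fin 15 → Fin L) × (Fin 15 → Fin L))).filter fun tt =>
      (fun l : Fin 5 => ∑ m, (tt.1 m : ℕ) ^ ((l : ℕ) + 1)) = (fun l : Fin 5 => ∑ m, (tt.2 m : ℕ) ^ ((l : ℕ) + 1))).card
      ≤ JJ L := by
  rw [JJ]
  refine Finset.card_le_card fun tt ht => ?_
  rw [Finset.mem_filter] at ht ⊢
  exact ⟨ht.1, fun l => congrFun ht.2 l⟩

lemma T_bound (L : ℕ) (hL : 1 ≤ L) (α : ℝ) (M : ℕ)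
    (hM : ∀ D ⊆ Finset.range L, (∀ j ∈ D, ∀ j' ∈ D,
      nd (6 * α * ((j : ℝ) - j')) < 1 / ((15 * L ^ 5 : ℕ) : ℝ)) → D.card ≤ M) :
    ‖TT L α‖ ^ 30 ≤ (L : ℝ) ^ 29 * (JJ L * (15 ^ 4 * (L : ℝ) ^ 10 *
      (M * (2 * ((15 * L ^ 5 : ℕ) : ℝ) * (1 + Real.log ((15 * L ^ 5 : ℕ) : ℝ)))))) := by
  refine (T_pow L hL α).trans ?_
  refine mul_le_mul_of_nonneg_left ?_ (by positivity)
  set W : ℝ := (M * (2 * ((15 * L ^ 5 : ℕ) : ℝ) * (1 + Real.log ((15 * L ^ 5 : ℕ) : ℝ)))) with hW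
  have hbox : ∀ t : Fin 15 → Fin L, (fun l : Fin 5 => ∑ m, (t m : ℕ) ^ ((l : ℕ) + 1)) ∈
      (Fintype.piFinset (fun l : Fin 5 => Finset.range (15 * L ^ ((l : ℕ) + 1)))) := by
    intro t
    rw [Fintype.mem_piFinset]
    intro l
    rw [Finset.mem_range]
    calc ∑ m, (t m : ℕ) ^ ((l : ℕ) + 1) < ∑ m : Fin 15, L ^ ((l : ℕ) + 1) :=
          Finset.sum_lt_sum_of_nonempty ⟨0, Finset.mem_univ _⟩ fun m _ =>
            Nat.pow_lt_pow_left (t m).2 (by omega)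
      _ = _ := by simp
  have hW0 : 0 ≤ W := by
    have : 0 ≤ Real.log ((15 * L ^ 5 : ℕ) : ℝ) := Real.log_natCast_nonneg _
    positivity
  have hz : ∀ j : Fin L, ∑ j' : Fin L, ‖∑ v ∈ Fintype.piFinset (fun l : Fin 5 => Finset.range (15 * L ^ ((l : ℕ) + 1))),
      ee (∑ l, cf α j l * (v l : ℝ)) * (starRingEnd ℂ) (ee (∑ l, cf α j' l * (v l : ℝ)))‖ ≤
      15 ^ 4 * (L : ℝ) ^ 10 * W := by
    intro j
    refine (Finset.sum_le_sum fun j' _ => box_sum L hL _ _).trans ?_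
    rw [← Finset.mul_sum]
    exact mul_le_mul_of_nonneg_left (T_boundZ L hL α M hM j) (by positivity)
  have h := dual_sieve (T := Fin 15 → Fin L) (V := Fin 5 → ℕ) (J := Fin L)
    (fun t l => ∑ m, (t m : ℕ) ^ ((l : ℕ) + 1)) (fun t => ∏ m, ee (α * ((t m : ℕ) : ℝ) ^ 6))
    (fun t => by rw [norm_prod]; simp [ee_norm])
    (fun j v => ee (∑ l, cf α j l * (v l : ℝ)))
    (Fintype.piFinset (fun l : Fin 5 => Finset.range (15 * L ^ ((l : ℕ) + 1)))) hbox
    (15 ^ 4 * (L : ℝ) ^ 10 * W) (by positivity) hz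
  refine h.trans ?_
  refine mul_le_mul_of_nonneg_right ?_ (mul_nonneg (by positivity) hW0)
  rw [Nat.cast_le]
  exact JJ_card L

end SFP


namespace SFP
open Finset

/-- large powers beat constants -/
lemma ev_const (κ : ℝ) (hκ : 0 < κ) (C : ℝ) : ∃ L0 : ℕ, 1 ≤ L0 ∧ ∀ L : ℕ, L0 ≤ L → C < (L : ℝ) ^ κ := by
  have h := (tendsto_rpow_atTop hκ).comp (tendsto_natCast_atTop_atTop (R := ℝ))
  obtain ⟨a, ha⟩ := Filter.eventually_atTop.1 (h.eventually_gt_atTop C)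
  exact ⟨max a 1, le_max_right _ _, fun L hL => ha L (le_trans (le_max_left _ _) hL)⟩

lemma log_aux (κ : ℝ) (hκ : 0 < κ) (L : ℕ) (hL : 1 ≤ L) :
    1 + Real.log ((15 * L ^ 5 : ℕ) : ℝ) ≤ (16 + 5 / κ) * (L : ℝ) ^ κ := by
  have hL' : (1 : ℝ) ≤ L := by exact_mod_cast hL
  push_cast
  rw [Real.log_mul (by norm_num) (by positivity), Real.log_pow]
  have h1 : Real.log 15 ≤ 15 := by
    have := Real.log_le_sub_one_of_pos (show (0:ℝ) < 15 by norm_num); linarith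
  have h2 : Real.log L ≤ (L : ℝ) ^ κ / κ := Real.log_le_rpow_div (by linarith) hκ
  have h3 : 1 ≤ (L : ℝ) ^ κ := Real.one_le_rpow hL' hκ.le
  have : (16 + 5 / κ) * (L : ℝ) ^ κ = 16 * (L : ℝ) ^ κ + 5 * ((L : ℝ) ^ κ / κ) := by
    field_simp
  rw [this]
  push_cast
  linarith

theorem weyl (κ : ℝ) (hκ : 0 < κ) : ∃ L0 : ℕ, 1 ≤ L0 ∧ ∀ L : ℕ, L0 ≤ L → ∀ α P : ℝ, 1 ≤ P →
    P ^ 30 * (L : ℝ) ^ κ ≤ L → (L : ℝ) ^ 2 ≤ P * ‖TT L α‖ →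
    ∃ q : ℕ, 1 ≤ q ∧ (q : ℝ) ≤ P ^ 30 * (L : ℝ) ^ κ ∧ nd (α * q) * (L : ℝ) ^ 6 ≤ P ^ 30 * (L : ℝ) ^ κ := by
  obtain ⟨C, hC1, hC⟩ := vmvt (κ / 4) (by linarith)
  obtain ⟨L0, hL01, hL0⟩ := ev_const (κ / 2) (by linarith) (C * 15 ^ 4 * 12 * 2 * 15 * (16 + 5 / (κ / 4)))
  refine ⟨L0, hL01, fun L hL α P hP hPL hT => ?_⟩
  have hL1 : 1 ≤ L := hL01.trans hL
  have hL1' : (1 : ℝ) ≤ L := by exact_mod_cast hL1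
  have hLpos : (0 : ℝ) < L := by linarith
  have hPpos : 0 < P := by linarith
  set R : ℝ := P ^ 30 * (L : ℝ) ^ κ with hR
  have hRpos : 0 < R := by positivity
  set K : ℕ := ⌈6 * L / R⌉₊ with hK
  have hy : 6 ≤ 6 * L / R := by rw [le_div_iff₀ hRpos]; linarith
  have hKge : 6 * L / R ≤ K := Nat.le_ceil _
  have hKlt : (K : ℝ) < 6 * L / R + 1 := Nat.ceil_lt_add_one (by positivity)
  have hK1 : 1 ≤ K := by
    have : (1 : ℝ) ≤ K := by linarith
    exact_mod_cast this
  have hKpos : (0 : ℝ) < K := by exact_mod_cast hK1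
  have hKR : 6 * L ≤ K * R := by rwa [div_le_iff₀ hRpos] at hKge
  by_cases hD : ∃ D ⊆ Finset.range L, (∀ j ∈ D, ∀ j' ∈ D,
      nd (6 * α * ((j : ℝ) - j')) < 1 / ((15 * L ^ 5 : ℕ) : ℝ)) ∧ K + 1 ≤ D.card
  · obtain ⟨D, hDs, hDn, hDc⟩ := hD
    have h2L : 2 * L ≤ 15 * L ^ 5 := by
      have : L ≤ L ^ 5 := Nat.le_self_pow (by norm_num) L
      omega
    obtain ⟨q, hq1, hqK, hqn⟩ := lattice (6 * α) L (15 * L ^ 5) h2L D hDs K hK1 hDc hDn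
    have hqK' : (q : ℝ) * K ≤ L := by exact_mod_cast hqK
    refine ⟨6 * q, by omega, ?_, ?_⟩
    · push_cast
      have : 6 * ((q : ℝ) * K) ≤ K * R := by linarith
      have h : (6 * (q : ℝ)) * K ≤ R * K := by linarith
      exact le_of_mul_le_mul_right h hKpos
    · have e : α * ((6 * q : ℕ) : ℝ) = 6 * α * q := by push_cast; ring
      rw [e]
      push_cast at hqn
      have hn0 := nd_nonneg (6 * α * q)
      have h1 : nd (6 * α * q) * (L : ℝ) ^ 5 * K ≤ 1 := by
        have : 0 ≤ nd (6 * α * q) * (L : ℝ) ^ 5 * K := by positivity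
        nlinarith
      have h2 : (nd (6 * α * q) * (L : ℝ) ^ 6) * K ≤ R * K := by
        calc (nd (6 * α * q) * (L : ℝ) ^ 6) * K = (nd (6 * α * q) * (L : ℝ) ^ 5 * K) * (L : ℝ) := by ring
          _ ≤ 1 * (L : ℝ) := by gcongr
          _ ≤ R * K := by linarith
      exact le_of_mul_le_mul_right h2 hKpos
  · exfalso
    have hM : ∀ D ⊆ Finset.range L, (∀ j ∈ D, ∀ j' ∈ D,
        nd (6 * α * ((j : ℝ) - j')) < 1 / ((15 * L ^ 5 : ℕ) : ℝ)) → D.card ≤ K := by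
      intro D hDs hDn
      by_contra hc
      exact hD ⟨D, hDs, hDn, by omega⟩
    have hTb := T_bound L hL1 α K hM
    have hJ := hC L hL1
    have hlog := log_aux (κ / 4) (by linarith) L hL1
    have hK12 : (K : ℝ) * R ≤ 12 * L := by
      have : (K : ℝ) ≤ 12 * L / R := by
        have : 12 * L / R = 6 * L / R + 6 * L / R := by ring
        linarith
      rwa [le_div_iff₀ hRpos] at this
    have hlog0 : 0 ≤ 1 + Real.log ((15 * L ^ 5 : ℕ) : ℝ) := by
      have : 0 ≤ Real.log ((15 * L ^ 5 : ℕ) : ℝ) := Real.log_natCast_nonneg _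
      linarith
    set lg := 1 + Real.log ((15 * L ^ 5 : ℕ) : ℝ) with hlg
    set A : ℝ := 16 + 5 / (κ / 4) with hA
    have hA0 : 0 < A := by positivity
    -- combine
    have h1 : (L : ℝ) ^ 60 ≤ P ^ 30 * ‖TT L α‖ ^ 30 := by
      calc (L : ℝ) ^ 60 = ((L : ℝ) ^ 2) ^ 30 := by ring
        _ ≤ (P * ‖TT L α‖) ^ 30 := by gcongr
        _ = _ := by ring
    have h2 : ‖TT L α‖ ^ 30 ≤ (L : ℝ) ^ 29 * ((C * (L : ℝ) ^ (15 + κ / 4)) * (15 ^ 4 * (L : ℝ) ^ 10 *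
      (K * (2 * ((15 * L ^ 5 : ℕ) : ℝ) * (A * (L : ℝ) ^ (κ / 4)))))) := by
      refine hTb.trans ?_
      gcongr
    have e1 : (L : ℝ) ^ (15 + κ / 4) = (L : ℝ) ^ 15 * (L : ℝ) ^ (κ / 4) := by
      rw [Real.rpow_add hLpos]; norm_cast
    have e2 : (L : ℝ) ^ κ = (L : ℝ) ^ (κ / 4) * (L : ℝ) ^ (κ / 4) * (L : ℝ) ^ (κ / 2) := by
      rw [← Real.rpow_add hLpos, ← Real.rpow_add hLpos]; congr 1; ring
    set x := (L : ℝ) ^ (κ / 4) with hx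
    set z := (L : ℝ) ^ (κ / 2) with hz
    have hxpos : 0 < x := by positivity
    have hzpos : 0 < z := by positivity
    have h3 : (L : ℝ) ^ 60 * z ≤ C * 15 ^ 4 * 12 * 2 * 15 * A * (L : ℝ) ^ 60 := by
      calc (L : ℝ) ^ 60 * z ≤ (P ^ 30 * ((L : ℝ) ^ 29 * ((C * (L : ℝ) ^ (15 + κ / 4)) * (15 ^ 4 * (L : ℝ) ^ 10 *
      (K * (2 * ((15 * L ^ 5 : ℕ) : ℝ) * (A * x))))))) * z := by
            refine mul_le_mul_of_nonneg_right (h1.trans ?_) hzpos.le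
            exact mul_le_mul_of_nonneg_left h2 (by positivity)
        _ = (C * 15 ^ 4 * 2 * 15 * A * (L : ℝ) ^ 59) * (K * R) := by
            rw [hR, e1, e2]; push_cast; ring
        _ ≤ (C * 15 ^ 4 * 2 * 15 * A * (L : ℝ) ^ 59) * (12 * L) := by
            refine mul_le_mul_of_nonneg_left hK12 (by positivity)
        _ = _ := by ring
    have h4 := hL0 L hL
    have : (C * 15 ^ 4 * 12 * 2 * 15 * A) * (L : ℝ) ^ 60 < z * (L : ℝ) ^ 60 :=
      mul_lt_mul_of_pos_right h4 (by positivity)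
    linarith

end SFP


namespace SFP
open Finset

theorem divisor_bound (κ : ℝ) (hκ : 0 < κ) : ∃ C : ℝ, 1 ≤ C ∧ ∀ n : ℕ, 1 ≤ n →
    ((n.divisors.card : ℕ) : ℝ) ≤ C * (n : ℝ) ^ κ := by
  obtain ⟨p0, _, hp0⟩ := ev_const κ hκ 2
  set x : ℝ := min 1 ((2 : ℝ) ^ κ - 1) with hx
  have h2 : (1 : ℝ) < (2 : ℝ) ^ κ := Real.one_lt_rpow (by norm_num) hκ
  have hx0 : 0 < x := lt_min one_pos (by linarith)
  have hx1 : x ≤ 1 := min_le_left _ _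
  have hx2 : x ≤ (2 : ℝ) ^ κ - 1 := min_le_right _ _
  have hA1 : 1 ≤ 1 / x := by rw [le_div_iff₀ hx0]; linarith
  refine ⟨(1 / x) ^ p0, one_le_pow₀ hA1, fun n hn => ?_⟩
  have hn0 : n ≠ 0 := by omega
  have key : ∀ p ∈ n.primeFactors, ((n.factorization p + 1 : ℕ) : ℝ) ≤
      (if p < p0 then 1 / x else 1) * ((p : ℝ) ^ (n.factorization p)) ^ κ := by
    intro p hp
    have hpp := (Nat.prime_of_mem_primeFactors hp).two_le
    have hp2 : (2 : ℝ) ≤ p := by exact_mod_cast hpp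
    set e := n.factorization p
    have hcomm : ((p : ℝ) ^ e) ^ κ = ((p : ℝ) ^ κ) ^ e := by
      rw [← Real.rpow_natCast, ← Real.rpow_mul (by positivity), mul_comm, Real.rpow_mul (by positivity), Real.rpow_natCast]
    rw [hcomm]
    split_ifs with h
    · have hb : x * ((e : ℝ) + 1) ≤ ((2 : ℝ) ^ κ) ^ e := by
        have := one_add_mul_le_pow (a := x) (by linarith) e
        calc x * ((e : ℝ) + 1) ≤ 1 + e * x := by nlinarith
          _ ≤ (1 + x) ^ e := this
          _ ≤ _ := by gcongr; linarith
      have hb2 : ((2 : ℝ) ^ κ) ^ e ≤ ((p : ℝ) ^ κ) ^ e := by gcongr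
      rw [one_div, ← div_eq_inv_mul, le_div_iff₀ hx0]
      push_cast
      linarith
    · have : (2 : ℝ) < (p : ℝ) ^ κ := hp0 p (by omega)
      rw [one_mul]
      calc ((e + 1 : ℕ) : ℝ) ≤ ((2 ^ e : ℕ) : ℝ) := by exact_mod_cast Nat.lt_two_pow_self
        _ = (2 : ℝ) ^ e := by push_cast; rfl
        _ ≤ _ := by gcongr
  rw [Nat.card_divisors hn0]
  push_cast
  calc _ ≤ ∏ p ∈ n.primeFactors, ((if p < p0 then 1 / x else 1) * ((p : ℝ) ^ (n.factorization p)) ^ κ) := by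
        refine Finset.prod_le_prod (fun p _ => by positivity) fun p hp => ?_
        have := key p hp
        push_cast at this
        exact this
    _ = (∏ p ∈ n.primeFactors, (if p < p0 then 1 / x else 1)) * (∏ p ∈ n.primeFactors, (p : ℝ) ^ (n.factorization p)) ^ κ := by
        rw [Finset.prod_mul_distrib, Real.finsetProd_rpow _ _ (fun _ _ => by positivity)]
    _ ≤ _ := by
        have hprod : (∏ p ∈ n.primeFactors, (p : ℝ) ^ (n.factorization p)) = n := by
          have := Nat.prod_factorization_pow_eq_self hn0
          conv_rhs => rw [← this]
          rw [Finsupp.prod]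
          push_cast
          rfl
        rw [hprod]
        refine mul_le_mul_of_nonneg_right ?_ (by positivity)
        rw [Finset.prod_ite, Finset.prod_const, Finset.prod_const_one, mul_one]
        refine pow_le_pow_right₀ hA1 ?_
        calc _ ≤ (Finset.range p0).card := Finset.card_le_card (fun p hp => by
              rw [Finset.mem_filter] at hp; exact Finset.mem_range.2 hp.2)
          _ = p0 := by simp

/-- nearest integer distance of a fraction -/
lemma nd_frac_zero_iff (c : ℤ) (w : ℕ) (hw : 1 ≤ w) : nd ((c : ℝ) / w) = 0 ↔ (w : ℤ) ∣ c := by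
  have hw0 : (w : ℝ) ≠ 0 := by positivity
  constructor
  · intro h
    obtain ⟨n, hn⟩ := nd_exists ((c : ℝ) / w)
    rw [h] at hn
    have h2 : (c : ℝ) / w = n := by
      have := abs_eq_zero.1 hn.symm; linarith
    rw [div_eq_iff hw0] at h2
    refine ⟨n, ?_⟩
    have : (c : ℝ) = ((w * n : ℤ) : ℝ) := by push_cast; linarith
    exact_mod_cast this
  · rintro ⟨n, rfl⟩
    have : (((w : ℤ) * n : ℤ) : ℝ) / w = 0 + (n : ℤ) := by push_cast; field_simp; ring
    rw [this, nd_add_int]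
    apply le_antisymm _ (nd_nonneg _)
    have := nd_le 0 0; simpa using this

lemma nd_frac_count (c : ℤ) (w : ℕ) (hw : 1 ≤ w) (δ : ℝ) (hδ : 0 ≤ δ) (S : Finset ℕ) (hS : S ⊆ Finset.range w)
    (h : ∀ v ∈ S, ¬ (w : ℤ) ∣ c * v ∧ nd ((c * v : ℝ) / w) ≤ δ) : (S.card : ℝ) ≤ 2 * δ * w := by
  classical
  have hwpos : (0 : ℝ) < w := by exact_mod_cast hw
  set g : ℕ := Int.gcd c w with hg
  have hgpos : 0 < g := Int.gcd_pos_of_ne_zero_right _ (by exact_mod_cast (show w ≠ 0 by omega))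
  have hgw : g ∣ w := by
    have : (g : ℤ) ∣ (w : ℤ) := Int.gcd_dvd_right ..
    exact_mod_cast this
  have hgc : (g : ℤ) ∣ c := Int.gcd_dvd_left ..
  obtain ⟨w', hw'⟩ := hgw
  obtain ⟨c', hc'⟩ := hgc
  have hw'pos : 0 < w' := by
    rcases Nat.eq_zero_or_pos w' with h0 | h0
    · rw [h0] at hw'; omega
    · exact h0
  have hcop : IsCoprime (w' : ℤ) c' := by
    have h1 : Int.gcd c w = g * Int.gcd c' w' := by
      conv_lhs => rw [hc', hw']
      push_cast
      rw [Int.gcd_mul_left]; simp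
    have : Int.gcd c' w' = 1 := by
      rw [← hg] at h1
      exact Nat.eq_of_mul_eq_mul_left hgpos (by omega)
    exact (Int.isCoprime_iff_gcd_eq_one.2 this).symm
  -- the map
  choose f hf using fun v : ℕ => nd_exists ((c * v : ℝ) / w)
  set F : ℕ → ℤ := fun v => c' * v - w' * f v with hF
  have hFval : ∀ v, |(F v : ℝ)| * g = nd ((c * v : ℝ) / w) * w := by
    intro v
    rw [hf v]
    have : (c * v : ℝ) / w - f v = (F v : ℝ) * g / w := by
      rw [hF]
      have h1 : (c : ℝ) = g * c' := by exact_mod_cast hc'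
      have h2 : (w : ℝ) = g * w' := by exact_mod_cast hw'
      have : (g : ℝ) ≠ 0 := by positivity
      have : (w' : ℝ) ≠ 0 := by positivity
      rw [h1, h2]
      push_cast
      field_simp
    rw [this, abs_div, abs_mul, abs_of_pos hwpos, Nat.abs_cast]
    field_simp
  set K : ℕ := ⌊δ * w / g⌋₊ with hK
  have himg : S.image F ⊆ (Finset.Icc (-(K : ℤ)) K).erase 0 := by
    intro j hj
    rw [Finset.mem_image] at hj
    obtain ⟨v, hv, rfl⟩ := hj
    obtain ⟨h1, h2⟩ := h v hv
    have hgp : (0 : ℝ) < g := by exact_mod_cast hgpos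
    rw [Finset.mem_erase, Finset.mem_Icc]
    constructor
    · intro h0
      apply h1
      rw [hc', hw']
      have : c' * v = w' * f v := by have : F v = c' * v - w' * f v := rfl
                                     omega
      exact ⟨f v, by push_cast; rw [mul_assoc, this]; ring⟩
    · have h3 : |(F v : ℝ)| ≤ δ * w / g := by
        rw [le_div_iff₀ hgp, hFval v]; gcongr
      have h4 : (F v).natAbs ≤ K := by
        rw [hK, Nat.le_floor_iff (by positivity)]
        rwa [Nat.cast_natAbs, Int.cast_abs]
      omega
  have hfib : ∀ j ∈ S.image F, (S.filter fun v => F v = j).card ≤ g := by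
    intro j _
    calc (S.filter fun v => F v = j).card ≤ (Finset.range g).card := by
          refine Finset.card_le_card_of_injOn (fun v => v / w') ?_ ?_
          · intro v hv
            have hv' := Finset.mem_range.1 (hS (Finset.mem_filter.1 hv).1)
            simp only [Finset.coe_range, Set.mem_Iio]
            rw [Nat.div_lt_iff_lt_mul hw'pos, ← hw']
            exact hv'
          · intro v hv v' hv' hvv
            have e1 := (Finset.mem_filter.1 hv).2
            have e2 := (Finset.mem_filter.1 hv').2
            have e3 : c' * ((v : ℤ) - v') = w' * (f v - f v') := by
              have : F v = c' * v - w' * f v := rfl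
              have : F v' = c' * v' - w' * f v' := rfl
              linarith
            have e4 : (w' : ℤ) ∣ (v : ℤ) - v' := hcop.dvd_of_dvd_mul_left ⟨_, e3⟩
            have e5 : v % w' = v' % w' := by
              have h6 : (v : ℤ) % w' = (v' : ℤ) % w' := Int.emod_eq_emod_iff_emod_sub_eq_zero.2 (Int.emod_eq_zero_of_dvd e4)
              exact_mod_cast h6
            rw [← Nat.div_add_mod v w', ← Nat.div_add_mod v' w', e5]
            simp only at hvv
            rw [hvv]
      _ = g := by simp
  have hc1 := Finset.card_le_mul_card_image (f := F) S g hfib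
  have hc2 : (S.image F).card ≤ 2 * K := by
    refine (Finset.card_le_card himg).trans ?_
    rw [Finset.card_erase_of_mem (by simp), Int.card_Icc]
    omega
  have hKle : (K : ℝ) * g ≤ δ * w := by
    have : (K : ℝ) ≤ δ * w / g := Nat.floor_le (by positivity)
    rwa [le_div_iff₀ (by exact_mod_cast hgpos)] at this
  have : (S.card : ℝ) ≤ g * (2 * K) := by
    have : S.card ≤ g * (2 * K) := hc1.trans (Nat.mul_le_mul_left _ hc2)
    exact_mod_cast this
  linarith

end SFP


namespace SFP
open Finset

lemma root_count (m : ℕ) : ∀ [NeZero m], Squarefree m → ∀ c : ZMod m,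
    ((Finset.univ : Finset (ZMod m)).filter fun y => y ^ 6 = c).card ≤ 6 ^ m.primeFactors.card := by
  induction m using Nat.recOnPosPrimePosCoprime with
  | prime_pow p n hp hn =>
    intro _ hsq c
    have hn1 : n = 1 := by
      rcases Nat.lt_or_ge n 2 with h | h
      · omega
      · exfalso
        have : p * p ∣ p ^ n := by rw [← sq]; exact pow_dvd_pow p h
        exact hp.not_isUnit (hsq p this)
    subst hn1
    rw [Nat.primeFactors_prime_pow one_ne_zero hp, Finset.card_singleton]
    show _ ≤ 6
    have hp' : Fact (p ^ 1).Prime := ⟨by rwa [pow_one]⟩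
    have h := Polynomial.card_nthRoots 6 c
    refine le_trans ?_ h
    calc _ ≤ (Polynomial.nthRoots 6 c).toFinset.card := by
          refine Finset.card_le_card fun y hy => ?_
          rw [Multiset.mem_toFinset, Polynomial.mem_nthRoots (by norm_num)]
          exact (Finset.mem_filter.1 hy).2
      _ ≤ _ := Multiset.toFinset_card_le _
  | zero => intro h; exact absurd rfl h.out
  | one =>
    intro _ _ c
    refine (Finset.card_filter_le _ _).trans ?_
    simp
  | coprime a b ha hb hab iha ihb =>
    intro _ hsq c
    have : NeZero a := ⟨by omega⟩
    have : NeZero b := ⟨by omega⟩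
    have hsa : Squarefree a := hsq.squarefree_of_dvd (dvd_mul_right a b)
    have hsb : Squarefree b := hsq.squarefree_of_dvd (dvd_mul_left b a)
    rw [Nat.Coprime.primeFactors_mul hab, Finset.card_union_of_disjoint hab.disjoint_primeFactors, pow_add]
    let e := ZMod.chineseRemainder hab
    refine le_trans ?_ (Nat.mul_le_mul (iha hsa (e c).1) (ihb hsb (e c).2))
    rw [← Finset.card_product]
    refine Finset.card_le_card_of_injOn e ?_ e.injective.injOn
    intro y hy
    have hy' : y ^ 6 = c := (Finset.mem_filter.1 hy).2
    have : (e y) ^ 6 = e c := by rw [← map_pow, hy']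
    simp only [Finset.coe_product, Finset.coe_filter, Finset.mem_univ, true_and, Set.mem_prod, Set.mem_ofPred_eq]
    exact ⟨by rw [← this]; rfl, by rw [← this]; rfl⟩

/-- complete exponential sum -/
noncomputable def SS (m : ℕ) [NeZero m] (c : ZMod m) : ℂ := ∑ x : ZMod m, ZMod.stdAddChar (c * x ^ 6)

lemma SS_parseval (m : ℕ) [NeZero m] (hsq : Squarefree m) :
    ∑ v : ZMod m, ‖SS m v‖ ^ 2 ≤ (m : ℝ) * (m * 6 ^ m.primeFactors.card) := by
  have hC : ((∑ v : ZMod m, ‖SS m v‖ ^ 2 : ℝ) : ℂ) =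
      ∑ x : ZMod m, ∑ y : ZMod m, (if y ^ 6 = x ^ 6 then (m : ℂ) else 0) := by
    push_cast
    have h1 : ∀ v : ZMod m, ((‖SS m v‖ : ℂ)) ^ 2 =
        ∑ x : ZMod m, ∑ y : ZMod m, ZMod.stdAddChar (v * (x ^ 6 - y ^ 6)) := by
      intro v
      rw [← Complex.mul_conj', SS, map_sum, Finset.sum_mul_sum]
      refine Finset.sum_congr rfl fun x _ => Finset.sum_congr rfl fun y _ => ?_
      rw [← AddChar.map_neg_eq_conj, ← AddChar.map_add_eq_mul]
      congr 1; ring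
    simp_rw [h1]
    rw [Finset.sum_comm]
    refine Finset.sum_congr rfl fun x _ => ?_
    rw [Finset.sum_comm]
    refine Finset.sum_congr rfl fun y _ => ?_
    have := AddChar.sum_mulShift (R := ZMod m) (R' := ℂ) (ψ := ZMod.stdAddChar) (x ^ 6 - y ^ 6) (ZMod.isPrimitive_stdAddChar m)
    rw [this, ZMod.card]
    simp only [sub_eq_zero, eq_comm]
    push_cast
    rfl
  have hR : (∑ v : ZMod m, ‖SS m v‖ ^ 2 : ℝ) = ∑ x : ZMod m, ∑ y : ZMod m, (if y ^ 6 = x ^ 6 then (m : ℝ) else 0) := by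
    have h2 : ((∑ v : ZMod m, ‖SS m v‖ ^ 2 : ℝ) : ℂ) = ((∑ x : ZMod m, ∑ y : ZMod m, (if y ^ 6 = x ^ 6 then (m : ℝ) else 0) : ℝ) : ℂ) := by
      rw [hC]; push_cast
      exact Finset.sum_congr rfl fun x _ => Finset.sum_congr rfl fun y _ => by split_ifs <;> simp
    exact_mod_cast h2
  rw [hR]
  calc _ ≤ ∑ x : ZMod m, (m : ℝ) * 6 ^ m.primeFactors.card := by
        refine Finset.sum_le_sum fun x _ => ?_
        rw [← Finset.sum_filter, Finset.sum_const, nsmul_eq_mul, mul_comm]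
        have := root_count m hsq (x ^ 6)
        gcongr
        exact_mod_cast this
    _ = _ := by simp [ZMod.card]

lemma SS_bound (m : ℕ) [NeZero m] (hsq : Squarefree m) (c : (ZMod m)ˣ) :
    (m.totient : ℝ) * ‖SS m c‖ ^ 2 ≤ (m : ℝ) ^ 2 * 36 ^ m.primeFactors.card := by
  have h1 : ∀ t : (ZMod m)ˣ, SS m (c * (t : ZMod m) ^ 6) = SS m c := by
    intro t
    rw [SS, SS]
    refine Fintype.sum_equiv (Units.mulLeft t) _ _ fun x => ?_
    rw [Units.mulLeft_apply]
    congr 1; ring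
  have h2 : (m.totient : ℝ) * ‖SS m c‖ ^ 2 = ∑ t : (ZMod m)ˣ, ‖SS m (c * (t : ZMod m) ^ 6)‖ ^ 2 := by
    simp_rw [h1]
    rw [Finset.sum_const, nsmul_eq_mul, Finset.card_univ, ZMod.card_units_eq_totient]
  rw [h2]
  have h3 : ∑ t : (ZMod m)ˣ, ‖SS m (c * (t : ZMod m) ^ 6)‖ ^ 2 =
      ∑ v : ZMod m, ∑ t ∈ (Finset.univ : Finset (ZMod m)ˣ).filter (fun t : (ZMod m)ˣ => (c * (t : ZMod m) ^ 6) = v), ‖SS m v‖ ^ 2 := by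
    rw [← Finset.sum_fiberwise_of_maps_to (s := Finset.univ) (t := Finset.univ) (g := fun t : (ZMod m)ˣ => (c : ZMod m) * (t : ZMod m) ^ 6) (fun t _ => Finset.mem_univ _)]
    refine Finset.sum_congr rfl fun v _ => Finset.sum_congr rfl fun t ht => ?_
    rw [(Finset.mem_filter.1 ht).2]
  rw [h3]
  calc _ ≤ ∑ v : ZMod m, (6 : ℝ) ^ m.primeFactors.card * ‖SS m v‖ ^ 2 := by
        refine Finset.sum_le_sum fun v _ => ?_
        rw [Finset.sum_const, nsmul_eq_mul]
        refine mul_le_mul_of_nonneg_right ?_ (by positivity)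
        have hr := root_count m hsq ((c⁻¹ : (ZMod m)ˣ) * v)
        have : ((Finset.univ : Finset (ZMod m)ˣ).filter fun t : (ZMod m)ˣ => (c : ZMod m) * (t : ZMod m) ^ 6 = v).card ≤
            6 ^ m.primeFactors.card := by
          refine le_trans ?_ hr
          refine Finset.card_le_card_of_injOn (fun t => (t : ZMod m)) ?_ Units.val_injective.injOn
          intro t ht
          have ht' := (Finset.mem_filter.1 ht).2
          simp only [Finset.coe_filter, Finset.mem_univ, true_and, Set.mem_ofPred_eq]
          rw [← ht', ← mul_assoc, Units.inv_mul, one_mul]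
        exact_mod_cast this
    _ = 6 ^ m.primeFactors.card * ∑ v : ZMod m, ‖SS m v‖ ^ 2 := by rw [Finset.mul_sum]
    _ ≤ 6 ^ m.primeFactors.card * ((m : ℝ) * (m * 6 ^ m.primeFactors.card)) :=
        mul_le_mul_of_nonneg_left (SS_parseval m hsq) (by positivity)
    _ = _ := by
        have : (36 : ℝ) = 6 * 6 := by norm_num
        rw [this, mul_pow]; ring

/-- consequence with all primes large -/
lemma SS_bound' (m : ℕ) [NeZero m] (hm1 : 1 < m) (hsq : Squarefree m) (hp : ∀ p ∈ m.primeFactors, 288 ^ 2 ≤ p) (c : (ZMod m)ˣ) :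
    4 * ‖SS m c‖ ^ 2 ≤ (m : ℝ) * (m : ℝ) ^ (1 / 2 : ℝ) := by
  set ω := m.primeFactors.card with hω
  have hmpos : (0 : ℝ) < m := by positivity
  have hprod : ∏ p ∈ m.primeFactors, p = m := Nat.prod_primeFactors_of_squarefree hsq
  have htot : (m : ℝ) ≤ 2 ^ ω * m.totient := by
    have h1 := Nat.totient_mul_prod_primeFactors m
    rw [hprod] at h1
    have h2 : m.totient = ∏ p ∈ m.primeFactors, (p - 1) :=
      Nat.eq_of_mul_eq_mul_right (show 0 < m by omega) (by rw [h1]; ring)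
    have h3 : m ≤ 2 ^ ω * m.totient := by
      rw [h2, hω, ← Finset.prod_const, ← Finset.prod_mul_distrib]
      conv_lhs => rw [← hprod]
      refine Finset.prod_le_prod' fun p hp => ?_
      have := (Nat.prime_of_mem_primeFactors hp).two_le
      omega
    exact_mod_cast h3
  have h288 : (288 : ℝ) ^ ω ≤ (m : ℝ) ^ (1 / 2 : ℝ) := by
    have h1 : ((288 ^ ω) ^ 2 : ℕ) ≤ m := by
      conv_rhs => rw [← hprod]
      rw [← pow_mul, mul_comm, pow_mul, hω, ← Finset.prod_const]
      exact Finset.prod_le_prod' fun p hp' => hp p hp'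
    rw [← Real.sqrt_eq_rpow]
    apply Real.le_sqrt_of_sq_le
    exact_mod_cast h1
  have hω1 : 1 ≤ ω := Finset.card_pos.2 (Nat.nonempty_primeFactors.2 hm1)
  have hb := SS_bound m hsq c
  have hmul : (m : ℝ) * ‖SS m c‖ ^ 2 ≤ (m : ℝ) * ((m : ℝ) * 72 ^ ω) := by
    calc (m : ℝ) * ‖SS m c‖ ^ 2 ≤ (2 ^ ω * m.totient) * ‖SS m c‖ ^ 2 := by gcongr
      _ = 2 ^ ω * ((m.totient : ℝ) * ‖SS m c‖ ^ 2) := by ring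
      _ ≤ 2 ^ ω * ((m : ℝ) ^ 2 * 36 ^ ω) := by gcongr
      _ = _ := by
        have : (72 : ℝ) = 2 * 36 := by norm_num
        rw [this, mul_pow]; ring
  have h1 := le_of_mul_le_mul_left hmul hmpos
  have h4 : (4 : ℝ) ≤ 4 ^ ω := le_self_pow₀ (by norm_num) (by omega)
  calc 4 * ‖SS m c‖ ^ 2 ≤ 4 ^ ω * ((m : ℝ) * 72 ^ ω) := by gcongr
    _ = m * 288 ^ ω := by
      have : (288 : ℝ) = 4 * 72 := by norm_num
      rw [this, mul_pow]; ring
    _ ≤ _ := by gcongr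

end SFP


namespace SFP
open Finset

lemma block_sum (m : ℕ) [NeZero m] (F : ZMod m → ℂ) (a : ℕ) :
    ∑ i ∈ Finset.range m, F ((i + a : ℕ) : ZMod m) = ∑ x, F x := by
  refine Finset.sum_bij' (fun i _ => ((i + a : ℕ) : ZMod m)) (fun x _ => (x - (a : ZMod m)).val) ?_ ?_ ?_ ?_ ?_
  · intro i _; exact Finset.mem_univ _
  · intro x _; exact Finset.mem_range.2 (ZMod.val_lt _)
  · intro i hi
    push_cast
    rw [add_sub_cancel_right, ZMod.val_natCast, Nat.mod_eq_of_lt (Finset.mem_range.1 hi)]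
  · intro x _
    push_cast
    rw [ZMod.natCast_zmod_val, sub_add_cancel]
  · intro i _; rfl

lemma incomplete (m : ℕ) [NeZero m] (F : ZMod m → ℂ) (hF : ∀ x, ‖F x‖ ≤ 1) (L a : ℕ) :
    ‖∑ i ∈ Finset.range L, F ((i + a : ℕ) : ZMod m)‖ ≤ (L : ℝ) / m * ‖∑ x, F x‖ + m := by
  have hm : (0 : ℝ) < m := by exact_mod_cast Nat.pos_of_ne_zero (NeZero.ne m)
  have hm' : 0 < m := Nat.pos_of_ne_zero (NeZero.ne m)
  induction L using Nat.strong_induction_on with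
  | _ L ih =>
    rcases Nat.lt_or_ge L m with h | h
    · have h1 : ‖∑ i ∈ Finset.range L, F ((i + a : ℕ) : ZMod m)‖ ≤ L := by
        refine (norm_sum_le _ _).trans ?_
        refine (Finset.sum_le_card_nsmul _ _ 1 fun t _ => hF _).trans ?_
        simp
      have h2 : (L : ℝ) ≤ m := by exact_mod_cast h.le
      have h3 : 0 ≤ (L : ℝ) / m * ‖∑ x, F x‖ := by positivity
      linarith
    · obtain ⟨L', rfl⟩ := Nat.exists_eq_add_of_le h
      rw [Finset.sum_range_add, block_sum]
      have e : ∑ i ∈ Finset.range L', F ((m + i + a : ℕ) : ZMod m) = ∑ i ∈ Finset.range L', F ((i + a : ℕ) : ZMod m) := by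
        refine Finset.sum_congr rfl fun i _ => ?_
        push_cast; simp
      rw [e]
      have h1 := ih L' (by omega)
      refine (norm_add_le _ _).trans ?_
      have : ((m + L' : ℕ) : ℝ) / m * ‖∑ x, F x‖ = ‖∑ x, F x‖ + (L' : ℝ) / m * ‖∑ x, F x‖ := by
        push_cast; field_simp
      rw [this]
      linarith

lemma ee_frac (m : ℕ) [NeZero m] (c : ℤ) (n : ℕ) :
    ee ((c : ℝ) / m * ((n : ℝ)) ^ 6) = ZMod.stdAddChar ((c : ZMod m) * (n : ZMod m) ^ 6) := by
  have : (c : ZMod m) * (n : ZMod m) ^ 6 = ((c * (n : ℤ) ^ 6 : ℤ) : ZMod m) := by push_cast; rfl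
  rw [this, ZMod.stdAddChar_coe, ee]
  push_cast
  congr 1
  ring

lemma TT_triv (L : ℕ) (α : ℝ) : ‖TT L α‖ ≤ (L : ℝ) ^ 2 := by
  rw [TT]
  calc _ ≤ ∑ j ∈ Finset.range L, (L : ℝ) := by
        refine norm_sum_le_of_le _ fun j _ => ?_
        refine (norm_sum_le _ _).trans ?_
        refine (Finset.sum_le_card_nsmul _ _ 1 fun t _ => (ee_norm _).le).trans ?_
        simp
    _ = _ := by simp [sq]

lemma TT_small (m L : ℕ) (hm : 1 ≤ m) (hsq : Squarefree m) (hp : ∀ p ∈ m.primeFactors, 288 ^ 2 ≤ p)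
    (c : ℤ) (hc : IsCoprime c (m : ℤ)) (hL : 2 * (m : ℝ) ^ (5 / 4 : ℝ) ≤ L) :
    ‖TT L ((c : ℝ) / m)‖ ≤ (L : ℝ) ^ 2 * (m : ℝ) ^ (-(1 / 4) : ℝ) := by
  rcases Nat.eq_or_lt_of_le hm with h1 | h1
  · rw [← h1]; simpa using TT_triv L _
  have : NeZero m := ⟨by omega⟩
  have hmpos : (0 : ℝ) < m := by positivity
  have hunit : IsUnit ((c : ZMod m)) := (ZMod.coe_int_isUnit_iff_isCoprime c m).2 hc.symm
  obtain ⟨u, hu⟩ := hunit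
  have hb := SS_bound' m h1 hsq hp u
  rw [hu] at hb
  have hin : ∀ j : ℕ, ‖∑ i ∈ Finset.range L, ee ((c : ℝ) / m * ((i : ℝ) + j + 1) ^ 6)‖ ≤ (L : ℝ) / m * ‖SS m c‖ + m := by
    intro j
    have := incomplete m (fun x => ZMod.stdAddChar ((c : ZMod m) * x ^ 6)) (fun x => (AddChar.norm_apply _ _).le) L (j + 1)
    rw [SS]
    refine le_trans (le_of_eq ?_) this
    congr 1
    refine Finset.sum_congr rfl fun i _ => ?_
    rw [← ee_frac]
    push_cast
    ring_nf
  have hT : ‖TT L ((c : ℝ) / m)‖ ≤ L * ((L : ℝ) / m * ‖SS m c‖ + m) := by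
    rw [TT]
    refine (norm_sum_le_of_le _ fun j _ => hin j).trans (le_of_eq ?_)
    rw [Finset.sum_const, Finset.card_range, nsmul_eq_mul]
  have hr : (m : ℝ) ^ (5 / 4 : ℝ) = m * (m : ℝ) ^ (1 / 4 : ℝ) := by
    rw [← Real.rpow_one_add' hmpos.le (by norm_num)]; norm_num
  have hi : (m : ℝ) ^ (-(1 / 4) : ℝ) = ((m : ℝ) ^ (1 / 4 : ℝ))⁻¹ := Real.rpow_neg hmpos.le _
  have hh : (m : ℝ) ^ (1 / 2 : ℝ) = ((m : ℝ) ^ (1 / 4 : ℝ)) ^ 2 := by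
    rw [← Real.rpow_natCast, ← Real.rpow_mul hmpos.le]; norm_num
  have hfull : (m : ℝ) = ((m : ℝ) ^ (1 / 4 : ℝ)) ^ 4 := by
    rw [← Real.rpow_natCast, ← Real.rpow_mul hmpos.le]; norm_num
  rw [hr] at hL
  rw [hh] at hb
  rw [hi]
  set z := (m : ℝ) ^ (1 / 4 : ℝ) with hz
  have hzpos : 0 < z := by positivity
  have hS : 2 * ‖SS m c‖ * z ≤ m := by
    have h2 : (2 * ‖SS m c‖) ^ 2 ≤ (z ^ 3) ^ 2 := by
      calc (2 * ‖SS m c‖) ^ 2 = 4 * ‖SS m c‖ ^ 2 := by ring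
        _ ≤ m * z ^ 2 := hb
        _ = (z ^ 3) ^ 2 := by rw [hfull]; ring
    have h3 : 2 * ‖SS m c‖ ≤ z ^ 3 := abs_le_of_sq_le_sq'  h2 (by positivity) |>.2
    calc 2 * ‖SS m c‖ * z ≤ z ^ 3 * z := by gcongr
      _ = m := by rw [hfull]; ring
  refine hT.trans ?_
  rw [← div_eq_mul_inv, le_div_iff₀ hzpos]
  have e1 : (L : ℝ) / m * ‖SS m c‖ * z ≤ L / 2 := by
    calc (L : ℝ) / m * ‖SS m c‖ * z = (L : ℝ) / m / 2 * (2 * ‖SS m c‖ * z) := by ring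
      _ ≤ (L : ℝ) / m / 2 * m := by gcongr
      _ = L / 2 := by field_simp
  have e2 : m * z ≤ (L : ℝ) / 2 := by linarith
  calc L * ((L : ℝ) / m * ‖SS m c‖ + m) * z = L * ((L : ℝ) / m * ‖SS m c‖ * z + m * z) := by ring
    _ ≤ L * (L / 2 + L / 2) := by gcongr
    _ = _ := by ring

end SFP


namespace SFP
open Finset

lemma not_dvd_aux (w : ℕ) (hw : 1 ≤ w) (b : ℤ) (v q : ℕ) (hv : Nat.Coprime v w) (hq : 1 ≤ q)
    (hqm : q < w / Int.gcd b w) : ¬ (w : ℤ) ∣ (b * q) * v := by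
  intro h
  have h1 : (w : ℤ) ∣ b * q := by
    have hc : IsCoprime (w : ℤ) (v : ℤ) := Nat.isCoprime_iff_coprime.2 hv.symm
    exact hc.dvd_of_dvd_mul_right h
  set g := Int.gcd b w with hg
  have hgpos : 0 < g := Int.gcd_pos_of_ne_zero_right _ (by exact_mod_cast (show w ≠ 0 by omega))
  have hgw : g ∣ w := by
    have : (g : ℤ) ∣ (w : ℤ) := Int.gcd_dvd_right ..
    exact_mod_cast this
  have hgcd : g = Nat.gcd b.natAbs w := rfl
  have h2 : w ∣ b.natAbs * q := by
    have := Int.natAbs_dvd_natAbs.2 h1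
    rwa [Int.natAbs_mul, Int.natAbs_natCast, Int.natAbs_natCast] at this
  have h3 : w / g ∣ q := by
    rw [hgcd, Nat.gcd_comm]
    exact Nat.Coprime.dvd_of_dvd_mul_left (Nat.coprime_div_gcd_div_gcd (Nat.gcd_pos_of_pos_left _ (by omega)))
      (by
        have : w / Nat.gcd w b.natAbs ∣ b.natAbs * q / Nat.gcd w b.natAbs :=
          Nat.div_dvd_div (Nat.gcd_dvd_left _ _) h2
        rwa [Nat.mul_div_right_comm (Nat.gcd_dvd_right _ _)] at this)
  have := Nat.le_of_dvd (by omega) h3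
  omega

lemma moment (κ : ℝ) (hκ : 0 < κ) : ∃ L0 : ℕ, 1 ≤ L0 ∧ ∀ L : ℕ, L0 ≤ L → ∀ N : ℝ, (L : ℝ) ≤ N →
    ∀ w : ℕ, 1 ≤ w → ∀ (b : ℤ) (M μ : ℝ), M ≤ L → 1 ≤ μ → μ ^ 30 ≤ M →
    μ ^ 30 ≤ ((w / Int.gcd b w : ℕ) : ℝ) →
    ∑ v ∈ (Finset.range w).filter (fun v => Nat.Coprime v w),
      (‖TT L ((b : ℝ) * v / w)‖ / (L : ℝ) ^ 2 * μ) ^ 56 ≤ w * ((N ^ κ) ^ 56 + 2) := by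
  classical
  obtain ⟨L0, hL01, hL0⟩ := weyl κ hκ
  refine ⟨L0, hL01, fun L hL N hLN w hw b M μ hML hμ1 hμM hμm => ?_⟩
  have hL1 : (1 : ℝ) ≤ L := by exact_mod_cast hL01.trans hL
  have hLpos : (0 : ℝ) < L := by linarith
  have hwpos : (0 : ℝ) < w := by exact_mod_cast hw
  set ν := N ^ κ with hν
  have hν1 : 1 ≤ ν := Real.one_le_rpow (by linarith) hκ.le
  have hLν : (L : ℝ) ^ κ ≤ ν := Real.rpow_le_rpow hLpos.le hLN hκ.le
  have hM1 : 1 ≤ M := (one_le_pow₀ hμ1).trans hμM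
  set S := (Finset.range w).filter (fun v => Nat.Coprime v w) with hS
  set a : ℕ → ℝ := fun v => ‖TT L ((b : ℝ) * v / w)‖ / (L : ℝ) ^ 2 * μ with ha
  have ha0 : ∀ v, 0 ≤ a v := fun v => by positivity
  have haμ : ∀ v, a v ≤ μ := by
    intro v
    have : ‖TT L ((b : ℝ) * v / w)‖ / (L : ℝ) ^ 2 ≤ 1 := by
      rw [div_le_one (by positivity)]; exact TT_triv _ _
    calc a v ≤ 1 * μ := by simp only [ha]; gcongr
      _ = μ := one_mul _
  set E := S.filter (fun v => ν < a v) with hE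
  set Eq : ℕ → Finset ℕ := fun q => (Finset.range w).filter (fun v => ¬ (w : ℤ) ∣ (b * q) * v ∧
      nd (((b * q : ℤ) * v : ℝ) / w) ≤ 1 / (L : ℝ) ^ 5) with hEq
  have hEsub : E ⊆ (Finset.Icc 1 ⌊M⌋₊).biUnion Eq := by
    intro v hv
    obtain ⟨hvS, hva⟩ := Finset.mem_filter.1 hv
    obtain ⟨hvw, hvc⟩ := Finset.mem_filter.1 hvS
    have hTpos : 0 < ‖TT L ((b : ℝ) * v / w)‖ := by
      by_contra h0
      have : ‖TT L ((b : ℝ) * v / w)‖ = 0 := le_antisymm (not_lt.1 h0) (norm_nonneg _)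
      simp only [ha, this] at hva
      simp at hva; linarith
    set τ := ‖TT L ((b : ℝ) * v / w)‖ with hτ
    set P : ℝ := (L : ℝ) ^ 2 / τ with hP
    have hP1 : 1 ≤ P := by rw [hP, le_div_iff₀ hTpos, one_mul]; exact TT_triv _ _
    have hPν : P * ν ≤ μ := by
      have h1 : ν ≤ τ / (L : ℝ) ^ 2 * μ := hva.le
      calc P * ν ≤ P * (τ / (L : ℝ) ^ 2 * μ) := by gcongr
        _ = μ := by rw [hP]; field_simp
    have hPν' : P * ν < μ := by
      have h1 : ν < τ / (L : ℝ) ^ 2 * μ := hva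
      calc P * ν < P * (τ / (L : ℝ) ^ 2 * μ) := by
            apply mul_lt_mul_of_pos_left h1; positivity
        _ = μ := by rw [hP]; field_simp
    have hPL : P ^ 30 * (L : ℝ) ^ κ < μ ^ 30 := by
      calc P ^ 30 * (L : ℝ) ^ κ ≤ P ^ 30 * ν ^ 30 := by
            gcongr; exact hLν.trans (le_self_pow₀ hν1 (by norm_num))
        _ = (P * ν) ^ 30 := by ring
        _ < μ ^ 30 := by gcongr
    obtain ⟨q, hq1, hqP, hqn⟩ := hL0 L hL ((b : ℝ) * v / w) P hP1 (by linarith) (by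
      rw [hP, ← hτ]; exact le_of_eq (by field_simp))
    have hqM : (q : ℝ) ≤ M := by linarith
    have hqm : (q : ℝ) < ((w / Int.gcd b w : ℕ) : ℝ) := by linarith
    rw [Finset.mem_biUnion]
    refine ⟨q, Finset.mem_Icc.2 ⟨hq1, Nat.le_floor hqM⟩, ?_⟩
    rw [hEq, Finset.mem_filter]
    refine ⟨hvw, not_dvd_aux w hw b v q hvc hq1 (by exact_mod_cast hqm), ?_⟩
    have e : (((b * q : ℤ) * v : ℝ) / w) = (b : ℝ) * v / w * q := by push_cast; ring
    rw [e, le_div_iff₀ (by positivity)]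
    have h2 : nd ((b : ℝ) * v / w * q) * (L : ℝ) ^ 5 * L ≤ 1 * L := by
      calc nd ((b : ℝ) * v / w * q) * (L : ℝ) ^ 5 * (L : ℝ) = nd ((b : ℝ) * v / w * q) * (L : ℝ) ^ 6 := by ring
        _ ≤ 1 * (L : ℝ) := by linarith
    exact le_of_mul_le_mul_right h2 hLpos
  have hEqc : ∀ q, ((Eq q).card : ℝ) ≤ 2 * (1 / (L : ℝ) ^ 5) * w := by
    intro q
    refine nd_frac_count (b * q) w hw _ (by positivity) _ (Finset.filter_subset _ _) fun v hv => ?_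
    exact (Finset.mem_filter.1 hv).2
  have hEc : (E.card : ℝ) ≤ 2 * w / (L : ℝ) ^ 4 := by
    calc (E.card : ℝ) ≤ (((Finset.Icc 1 ⌊M⌋₊).biUnion Eq).card : ℝ) := by
          exact_mod_cast Finset.card_le_card hEsub
      _ ≤ ((∑ q ∈ Finset.Icc 1 ⌊M⌋₊, (Eq q).card : ℕ) : ℝ) := by exact_mod_cast Finset.card_biUnion_le
      _ = ∑ q ∈ Finset.Icc 1 ⌊M⌋₊, ((Eq q).card : ℝ) := by push_cast; rfl
      _ ≤ ∑ q ∈ Finset.Icc 1 ⌊M⌋₊, 2 * (1 / (L : ℝ) ^ 5) * w := Finset.sum_le_sum fun q _ => hEqc q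
      _ = ⌊M⌋₊ * (2 * (1 / (L : ℝ) ^ 5) * w) := by simp
      _ ≤ L * (2 * (1 / (L : ℝ) ^ 5) * w) := by
          exact mul_le_mul_of_nonneg_right ((Nat.floor_le (by linarith)).trans hML) (by positivity)
      _ = _ := by field_simp
  have hμ56 : μ ^ 56 ≤ (L : ℝ) ^ 2 := by
    calc μ ^ 56 ≤ μ ^ 60 := pow_le_pow_right₀ hμ1 (by norm_num)
      _ = (μ ^ 30) ^ 2 := by ring
      _ ≤ (L : ℝ) ^ 2 := by gcongr; linarith
  have hsplit := Finset.sum_filter_add_sum_filter_not S (fun v => ν < a v) (fun v => a v ^ 56)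
  rw [← hsplit]
  have p1 : ∑ v ∈ S.filter (fun v => ν < a v), a v ^ 56 ≤ 2 * w := by
    calc _ ≤ ∑ v ∈ E, (L : ℝ) ^ 2 := by
          refine Finset.sum_le_sum fun v _ => le_trans ?_ hμ56
          have := ha0 v; have := haμ v
          gcongr
      _ = E.card * (L : ℝ) ^ 2 := by simp
      _ ≤ 2 * w / (L : ℝ) ^ 4 * (L : ℝ) ^ 2 := by gcongr
      _ = 2 * w / (L : ℝ) ^ 2 := by field_simp
      _ ≤ 2 * w := by
          apply div_le_self (by positivity); exact one_le_pow₀ hL1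
  have p2 : ∑ v ∈ S.filter (fun v => ¬ ν < a v), a v ^ 56 ≤ w * ν ^ 56 := by
    calc _ ≤ ∑ v ∈ S.filter (fun v => ¬ ν < a v), ν ^ 56 := by
          refine Finset.sum_le_sum fun v hv => ?_
          have h1 := not_lt.1 (Finset.mem_filter.1 hv).2
          have := ha0 v
          gcongr
      _ = (S.filter (fun v => ¬ ν < a v)).card * ν ^ 56 := by simp
      _ ≤ w * ν ^ 56 := by
          gcongr
          calc _ ≤ (Finset.range w).card := Finset.card_le_card ((Finset.filter_subset _ _).trans (Finset.filter_subset _ _))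
            _ = w := by simp
  calc _ ≤ 2 * (w : ℝ) + w * ν ^ 56 := add_le_add p1 p2
    _ = _ := by ring

end SFP


namespace SFP
open Finset

lemma TT_fin (L : ℕ) (α : ℝ) : TT L α = ∑ x : Fin L × Fin L, ee (α * (((x.2 : ℕ) : ℝ) + (x.1 : ℕ) + 1) ^ 6) := by
  rw [TT, Finset.sum_range, Fintype.sum_prod_type]
  refine Finset.sum_congr rfl fun j _ => ?_
  rw [Finset.sum_range]

lemma TT_prod {ι : Type} [Fintype ι] [DecidableEq ι] (L : ι → ℕ) (α : ι → ℝ) :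
    ∑ t : (∀ i, Fin (L i) × Fin (L i)), ee (∑ i, α i * ((((t i).2 : ℕ) + ((t i).1 : ℕ) + 1 : ℕ) : ℝ) ^ 6) = ∏ i, TT (L i) (α i) := by
  simp_rw [TT_fin]
  rw [Finset.prod_univ_sum, Fintype.piFinset_univ]
  refine Finset.sum_congr rfl fun t _ => ?_
  rw [ee_sum]
  refine Finset.prod_congr rfl fun i _ => ?_
  push_cast
  rfl

lemma ortho (G : ℕ) (hG : 1 ≤ G) (c : ℤ) (hc : ¬ (G : ℤ) ∣ c) :
    ∑ u ∈ Finset.range G, ee ((u : ℝ) * ((c : ℝ) / G)) = 0 := by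
  simp_rw [ee_nat_mul]
  have h1 : ee ((c : ℝ) / G) ≠ 1 := by
    intro h
    have := ee_sub_one ((c : ℝ) / G)
    rw [h, sub_self, norm_zero] at this
    have h0 : nd ((c : ℝ) / G) = 0 := le_antisymm (by linarith) (nd_nonneg _)
    exact hc ((nd_frac_zero_iff c G hG).1 h0)
  rw [geom_sum_eq h1, ← ee_nat_mul]
  have : (G : ℝ) * ((c : ℝ) / G) = c := by
    have : (G : ℝ) ≠ 0 := by positivity
    field_simp
  rw [this, ee_int]
  simp

lemma solve {ι : Type} [Fintype ι] [DecidableEq ι] (L : ι → ℕ) (hL : ∀ i, 1 ≤ L i) (b : ι → ℤ) (G : ℕ) (hG : 1 ≤ G)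
    (h : ∑ u ∈ (Finset.range G).filter (fun u => u ≠ 0), ∏ i, (‖TT (L i) ((b i : ℝ) * ((u : ℝ) / G))‖ / (L i : ℝ) ^ 2) < 1) :
    ∃ n : ι → ℕ, (∀ i, 1 ≤ n i ∧ n i ≤ 2 * L i) ∧ (G : ℤ) ∣ ∑ i, b i * (n i : ℤ) ^ 6 := by
  by_contra hcon
  push Not at hcon
  have hzero : ∑ u ∈ Finset.range G, ∏ i, TT (L i) ((b i : ℝ) * ((u : ℝ) / G)) = 0 := by
    simp_rw [← TT_prod]
    rw [Finset.sum_comm]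
    refine Finset.sum_eq_zero fun t _ => ?_
    have := ortho G hG (∑ i, b i * ((((t i).2 : ℕ) + ((t i).1 : ℕ) + 1 : ℕ) : ℤ) ^ 6) (hcon _ fun i => by
      have := (t i).1.2; have := (t i).2.2; omega)
    refine Eq.trans ?_ this
    refine Finset.sum_congr rfl fun u _ => ?_
    congr 1
    push_cast
    rw [Finset.sum_div, Finset.mul_sum]
    exact Finset.sum_congr rfl fun i _ => by ring
  have hs : Finset.range G = insert 0 ((Finset.range G).filter (fun u => u ≠ 0)) := by
    ext u
    simp only [Finset.mem_range, Finset.mem_insert, Finset.mem_filter]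
    omega
  rw [hs, Finset.sum_insert (by simp)] at hzero
  have hT0 : ∏ i, TT (L i) ((b i : ℝ) * (((0 : ℕ) : ℝ) / G)) = ((∏ i, (L i : ℝ) ^ 2 : ℝ) : ℂ) := by
    push_cast
    refine Finset.prod_congr rfl fun i _ => ?_
    simp [TT, ee_zero, sq]
  rw [hT0] at hzero
  have hpos : 0 < ∏ i, (L i : ℝ) ^ 2 := Finset.prod_pos fun i _ => by
    have : (1 : ℝ) ≤ L i := by exact_mod_cast hL i
    positivity
  have h2 : (∏ i, (L i : ℝ) ^ 2 : ℝ) ≤ ∑ u ∈ (Finset.range G).filter (fun u => u ≠ 0), ∏ i, ‖TT (L i) ((b i : ℝ) * ((u : ℝ) / G))‖ := by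
    have h3 := eq_neg_of_add_eq_zero_left hzero
    have h4 : ‖((∏ i, (L i : ℝ) ^ 2 : ℝ) : ℂ)‖ = ∏ i, (L i : ℝ) ^ 2 := by
      rw [Complex.norm_real, Real.norm_of_nonneg hpos.le]
    rw [← h4, h3, norm_neg]
    refine (norm_sum_le _ _).trans (le_of_eq ?_)
    exact Finset.sum_congr rfl fun u _ => norm_prod _ _
  have h5 : ∑ u ∈ (Finset.range G).filter (fun u => u ≠ 0), ∏ i, (‖TT (L i) ((b i : ℝ) * ((u : ℝ) / G))‖ / (L i : ℝ) ^ 2)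
      = (∑ u ∈ (Finset.range G).filter (fun u => u ≠ 0), ∏ i, ‖TT (L i) ((b i : ℝ) * ((u : ℝ) / G))‖) / ∏ i, (L i : ℝ) ^ 2 := by
    rw [Finset.sum_div]
    exact Finset.sum_congr rfl fun u _ => Finset.prod_div_distrib ..
  rw [h5, div_lt_one hpos] at h
  linarith

lemma group_den (G : ℕ) (hG : 1 ≤ G) (F : ℝ → ℝ) (hF : ∀ x, 0 ≤ F x) :
    ∑ u ∈ (Finset.range G).filter (fun u => u ≠ 0), F ((u : ℝ) / G) ≤
      ∑ w ∈ G.divisors.filter (fun w => w ≠ 1), ∑ v ∈ (Finset.range w).filter (fun v => Nat.Coprime v w), F ((v : ℝ) / w) := by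
  classical
  rw [Finset.sum_sigma']
  have hgp : ∀ u, 0 < Nat.gcd u G := fun u => Nat.gcd_pos_of_pos_right _ (by omega)
  have hquot : ∀ u : ℕ, ((u / Nat.gcd u G : ℕ) : ℝ) / ((G / Nat.gcd u G : ℕ) : ℝ) = (u : ℝ) / G := by
    intro u
    have h0 : ((Nat.gcd u G : ℕ) : ℝ) ≠ 0 := by have := hgp u; positivity
    have hG0 : (G : ℝ) ≠ 0 := by positivity
    rw [Nat.cast_div (Nat.gcd_dvd_left _ _) h0, Nat.cast_div (Nat.gcd_dvd_right _ _) h0]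
    field_simp
  let φ : ℕ → (Σ _ : ℕ, ℕ) := fun u => ⟨G / Nat.gcd u G, u / Nat.gcd u G⟩
  have hinj : Set.InjOn φ ((Finset.range G).filter (fun u => u ≠ 0) : Finset ℕ) := by
    intro u _ u' _ he
    have e1 : G / Nat.gcd u G = G / Nat.gcd u' G := congrArg Sigma.fst he
    have e2 : u / Nat.gcd u G = u' / Nat.gcd u' G := by
      have := congrArg (fun x : (Σ _ : ℕ, ℕ) => x.2) he
      exact this
    have h3 := hquot u
    rw [e1, e2, hquot u'] at h3
    have hG0 : (G : ℝ) ≠ 0 := by positivity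
    have h4 : (u' : ℝ) = u := by field_simp at h3; exact h3
    exact_mod_cast h4.symm
  have e : ∑ u ∈ (Finset.range G).filter (fun u => u ≠ 0), F ((u : ℝ) / G) =
      ∑ x ∈ ((Finset.range G).filter (fun u => u ≠ 0)).image φ, F ((x.2 : ℝ) / x.1) := by
    rw [Finset.sum_image hinj]
    exact Finset.sum_congr rfl fun u _ => by simp only [φ]; rw [hquot]
  rw [e]
  refine Finset.sum_le_sum_of_subset_of_nonneg ?_ (fun _ _ _ => hF _)
  intro x hx
  obtain ⟨u, hu, rfl⟩ := Finset.mem_image.1 hx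
  obtain ⟨hu1, hu0⟩ := Finset.mem_filter.1 hu
  have hu1 := Finset.mem_range.1 hu1
  simp only [φ, Finset.mem_sigma, Finset.mem_filter, Nat.mem_divisors, Finset.mem_range]
  have hgu : Nat.gcd u G ≤ u := Nat.le_of_dvd (by omega) (Nat.gcd_dvd_left _ _)
  refine ⟨⟨⟨Nat.div_dvd_of_dvd (Nat.gcd_dvd_right _ _), by omega⟩, ?_⟩, ?_, ?_⟩
  · intro h1
    have := Nat.div_mul_cancel (Nat.gcd_dvd_right u G)
    rw [h1] at this
    omega
  · exact Nat.div_lt_div_of_lt_of_dvd (Nat.gcd_dvd_right _ _) hu1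
  · exact Nat.coprime_div_gcd_div_gcd (hgp u)

lemma prod_le_one_add {ι : Type} [Fintype ι] (hc : Fintype.card ι ≤ 56) (a : ι → ℝ) (ha : ∀ i, 0 ≤ a i) :
    ∏ i, a i ≤ 1 + ∑ i, a i ^ 56 := by
  classical
  have hs0 : 0 ≤ ∑ i, a i ^ 56 := Finset.sum_nonneg fun i _ => pow_nonneg (ha i) _
  by_cases h : ∀ i, a i ≤ 1
  · have : ∏ i, a i ≤ 1 := Finset.prod_le_one (fun i _ => ha i) fun i _ => h i
    linarith
  · push Not at h
    obtain ⟨i0, hi0⟩ := h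
    obtain ⟨j, _, hj⟩ := Finset.exists_max_image Finset.univ a ⟨i0, Finset.mem_univ _⟩
    have h1 : 1 ≤ a j := hi0.le.trans (hj i0 (Finset.mem_univ _))
    calc ∏ i, a i ≤ ∏ _i : ι, a j := Finset.prod_le_prod (fun i _ => ha i) fun i hi => hj i hi
      _ = a j ^ Fintype.card ι := by simp
      _ ≤ a j ^ 56 := pow_le_pow_right₀ h1 hc
      _ ≤ ∑ i, a i ^ 56 := Finset.single_le_sum (f := fun i => a i ^ 56) (fun i _ => pow_nonneg (ha i) _) (Finset.mem_univ j)
      _ ≤ _ := by linarith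

end SFP


namespace SFP
open Finset

lemma md_facts (w : ℕ) (hw : 1 ≤ w) (b : ℤ) : 1 ≤ w / Int.gcd b w ∧ w / Int.gcd b w ∣ w ∧
    ∀ v : ℕ, Nat.Coprime v w → ∃ c : ℤ, IsCoprime c ((w / Int.gcd b w : ℕ) : ℤ) ∧
      (b : ℝ) * ((v : ℝ) / w) = (c : ℝ) / ((w / Int.gcd b w : ℕ) : ℝ) := by
  set g := Int.gcd b w with hg
  have hgpos : 0 < g := Int.gcd_pos_of_ne_zero_right _ (by exact_mod_cast (show w ≠ 0 by omega))
  have hgw : g ∣ w := by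
    have : (g : ℤ) ∣ (w : ℤ) := Int.gcd_dvd_right ..
    exact_mod_cast this
  refine ⟨Nat.div_pos (Nat.le_of_dvd (by omega) hgw) hgpos, Nat.div_dvd_of_dvd hgw, fun v hv => ?_⟩
  obtain ⟨b', hb'⟩ : (g : ℤ) ∣ b := Int.gcd_dvd_left ..
  obtain ⟨w', hw'⟩ := hgw
  have hdiv : w / g = w' := by rw [hw']; exact Nat.mul_div_cancel_left _ hgpos
  rw [hdiv]
  have hw'pos : 0 < w' := by
    rcases Nat.eq_zero_or_pos w' with h0 | h0
    · rw [h0] at hw'; omega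
    · exact h0
  have hcop : IsCoprime b' (w' : ℤ) := by
    have h1 : Int.gcd b w = g * Int.gcd b' w' := by
      conv_lhs => rw [hb', hw']
      push_cast
      rw [Int.gcd_mul_left]; simp
    have : Int.gcd b' w' = 1 := by
      rw [← hg] at h1
      exact Nat.eq_of_mul_eq_mul_left hgpos (by omega)
    exact Int.isCoprime_iff_gcd_eq_one.2 this
  have hv' : IsCoprime (v : ℤ) (w' : ℤ) := Nat.isCoprime_iff_coprime.2 (hv.coprime_dvd_right ⟨g, by rw [hw']; ring⟩)
  refine ⟨b' * v, hcop.mul_left hv', ?_⟩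
  have h1 : (b : ℝ) = g * b' := by exact_mod_cast hb'
  have h2 : (w : ℝ) = g * w' := by exact_mod_cast hw'
  have : (g : ℝ) ≠ 0 := by positivity
  have : (w' : ℝ) ≠ 0 := by positivity
  rw [h1, h2]
  push_cast
  field_simp

lemma small_w {ι : Type} [Fintype ι] (L : ι → ℕ) (hL : ∀ i, 1 ≤ L i) (b : ι → ℤ) (w : ℕ) (hw : 1 ≤ w)
    (hsq : Squarefree w) (hp : ∀ p ∈ w.primeFactors, 288 ^ 2 ≤ p)
    (hm : ∀ i, 2 * ((w / Int.gcd (b i) w : ℕ) : ℝ) ^ (5 / 4 : ℝ) ≤ L i)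
    (hprod : (w : ℝ) ≤ ∏ i, ((w / Int.gcd (b i) w : ℕ) : ℝ) ^ (1 / 30 : ℝ)) :
    ∑ v ∈ (Finset.range w).filter (fun v => Nat.Coprime v w),
      ∏ i, (‖TT (L i) ((b i : ℝ) * ((v : ℝ) / w))‖ / (L i : ℝ) ^ 2) ≤ 1 / (w : ℝ) ^ 3 := by
  have hwpos : (0 : ℝ) < w := by exact_mod_cast hw
  have hterm : ∀ v ∈ (Finset.range w).filter (fun v => Nat.Coprime v w),
      ∏ i, (‖TT (L i) ((b i : ℝ) * ((v : ℝ) / w))‖ / (L i : ℝ) ^ 2) ≤ 1 / (w : ℝ) ^ 4 := by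
    intro v hv
    have hvc := (Finset.mem_filter.1 hv).2
    calc _ ≤ ∏ i, ((((w / Int.gcd (b i) w : ℕ) : ℝ) ^ (1 / 30 : ℝ)) ^ 4)⁻¹ := by
          refine Finset.prod_le_prod (fun i _ => by positivity) fun i _ => ?_
          obtain ⟨h1, h2, h3⟩ := md_facts w hw (b i)
          obtain ⟨c, hc, he⟩ := h3 v hvc
          have hLp : (0 : ℝ) < L i := by exact_mod_cast hL i
          have hm1 : (1 : ℝ) ≤ ((w / Int.gcd (b i) w : ℕ) : ℝ) := by exact_mod_cast h1
          have hT := TT_small (w / Int.gcd (b i) w) (L i) h1 (hsq.squarefree_of_dvd h2)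
            (fun p hp' => hp p (Nat.primeFactors_mono h2 (by omega) hp')) c hc (hm i)
          rw [he, div_le_iff₀ (by positivity), mul_comm]
          refine hT.trans ?_
          refine mul_le_mul_of_nonneg_left ?_ (by positivity)
          rw [← Real.rpow_natCast, ← Real.rpow_mul (by positivity), ← Real.rpow_neg (by positivity)]
          exact Real.rpow_le_rpow_of_exponent_le hm1 (by norm_num)
      _ = ((∏ i, ((w / Int.gcd (b i) w : ℕ) : ℝ) ^ (1 / 30 : ℝ)) ^ 4)⁻¹ := by
          rw [Finset.prod_inv_distrib, Finset.prod_pow]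
      _ ≤ 1 / (w : ℝ) ^ 4 := by
          rw [one_div ((w : ℝ) ^ 4)]
          exact inv_anti₀ (by positivity) (pow_le_pow_left₀ hwpos.le hprod 4)
  calc _ ≤ ∑ v ∈ (Finset.range w).filter (fun v => Nat.Coprime v w), 1 / (w : ℝ) ^ 4 := Finset.sum_le_sum hterm
    _ = ((Finset.range w).filter (fun v => Nat.Coprime v w)).card * (1 / (w : ℝ) ^ 4) := by simp
    _ ≤ w * (1 / (w : ℝ) ^ 4) := by
        gcongr
        exact (Finset.card_filter_le _ _).trans (by simp)
    _ = _ := by field_simp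

lemma large_w {ι : Type} [Fintype ι] (hc : Fintype.card ι ≤ 56) (L : ι → ℕ) (b : ι → ℤ) (w : ℕ) (hw : 1 ≤ w)
    (μ : ι → ℝ) (hμ : ∀ i, 1 ≤ μ i) (A W : ℝ) (hA : 1 ≤ A) (hW : 0 < W)
    (hmom : ∀ i, ∑ v ∈ (Finset.range w).filter (fun v => Nat.Coprime v w),
      (‖TT (L i) ((b i : ℝ) * v / w)‖ / (L i : ℝ) ^ 2 * μ i) ^ 56 ≤ w * A)
    (hprod : (w : ℝ) * W ≤ ∏ i, μ i) :
    ∑ v ∈ (Finset.range w).filter (fun v => Nat.Coprime v w),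
      ∏ i, (‖TT (L i) ((b i : ℝ) * ((v : ℝ) / w))‖ / (L i : ℝ) ^ 2) ≤ 57 * A / W := by
  have hwpos : (0 : ℝ) < w := by exact_mod_cast hw
  have hμpos : 0 < ∏ i, μ i := Finset.prod_pos fun i _ => by linarith [hμ i]
  have hterm : ∀ v ∈ (Finset.range w).filter (fun v => Nat.Coprime v w),
      ∏ i, (‖TT (L i) ((b i : ℝ) * ((v : ℝ) / w))‖ / (L i : ℝ) ^ 2) ≤
      (1 + ∑ i, (‖TT (L i) ((b i : ℝ) * v / w)‖ / (L i : ℝ) ^ 2 * μ i) ^ 56) / (w * W) := by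
    intro v _
    have h0 := prod_le_one_add hc (fun i => ‖TT (L i) ((b i : ℝ) * v / w)‖ / (L i : ℝ) ^ 2 * μ i)
      (fun i => by have := hμ i; positivity)
    rw [Finset.prod_mul_distrib] at h0
    rw [le_div_iff₀ (by positivity)]
    refine le_trans ?_ h0
    have e : ∏ i, (‖TT (L i) ((b i : ℝ) * ((v : ℝ) / w))‖ / (L i : ℝ) ^ 2) = ∏ i, (‖TT (L i) ((b i : ℝ) * v / w)‖ / (L i : ℝ) ^ 2) :=
      Finset.prod_congr rfl fun i _ => by rw [mul_div_assoc]
    rw [e]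
    exact mul_le_mul_of_nonneg_left hprod (Finset.prod_nonneg fun i _ => by positivity)
  refine (Finset.sum_le_sum hterm).trans ?_
  rw [← Finset.sum_div, Finset.sum_add_distrib, Finset.sum_comm, Finset.sum_const, nsmul_eq_mul, mul_one]
  have h1 : (((Finset.range w).filter (fun v => Nat.Coprime v w)).card : ℝ) ≤ w := by
    have := Finset.card_filter_le (Finset.range w) (fun v => Nat.Coprime v w)
    rw [Finset.card_range] at this
    exact_mod_cast this
  have h2 : ∑ i, ∑ v ∈ (Finset.range w).filter (fun v => Nat.Coprime v w),
      (‖TT (L i) ((b i : ℝ) * v / w)‖ / (L i : ℝ) ^ 2 * μ i) ^ 56 ≤ 56 * (w * A) := by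
    calc _ ≤ ∑ _i : ι, (w : ℝ) * A := Finset.sum_le_sum fun i _ => hmom i
      _ = Fintype.card ι * (w * A) := by simp
      _ ≤ _ := by
        have : (Fintype.card ι : ℝ) ≤ 56 := by exact_mod_cast hc
        gcongr
  rw [div_le_div_iff₀ (by positivity) hW]
  have h3 : (w : ℝ) ≤ w * A := by nlinarith
  calc _ ≤ ((w : ℝ) * A + 56 * (w * A)) * W := by gcongr; linarith
    _ = _ := by ring

lemma core (κ ε : ℝ) (hκ : 0 < κ) (hε : 0 < ε) : ∃ N0 : ℕ, 1 ≤ N0 ∧ ∀ N : ℕ, N0 ≤ N →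
    ∀ (ι : Type) [Fintype ι] [DecidableEq ι], Fintype.card ι ≤ 56 → ∀ (Y : ι → ℝ) (b : ι → ℤ) (G : ℕ), 1 ≤ G →
    (∀ i, (N : ℝ) ^ (2 * ε) ≤ Y i ∧ Y i ≤ N) → Squarefree G → (∀ p ∈ G.primeFactors, 288 ^ 2 ≤ p) →
    (∀ w ∈ G.divisors, (w : ℝ) ^ (1 + κ) ≤
      ∏ i, (min ((w / Int.gcd (b i) w : ℕ) : ℝ) (Y i / (N : ℝ) ^ (2 * ε))) ^ (1 / 30 : ℝ)) →
    ∃ n : ι → ℕ, (∀ i, 1 ≤ n i ∧ (n i : ℝ) ≤ Y i) ∧ (G : ℤ) ∣ ∑ i, b i * (n i : ℤ) ^ 6 := by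
  set κ1 := κ * ε / 224 with hκ1
  have hκ1p : 0 < κ1 := by positivity
  set κ2 := κ * ε / 8 with hκ2
  have hκ2p : 0 < κ2 := by positivity
  obtain ⟨L0, hL01, hmom⟩ := moment κ1 hκ1p
  obtain ⟨C, hC1, hdiv⟩ := divisor_bound κ2 hκ2p
  obtain ⟨Na, _, hNa⟩ := ev_const (2 * ε) (by linarith) (4 * L0)
  obtain ⟨Nb, _, hNb⟩ := ev_const (3 / 4 * ε) (by linarith) 8
  obtain ⟨Nc, _, hNc⟩ := ev_const (κ * ε / 2) (by positivity) (4 * (57 * 3 * C))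
  refine ⟨max 1 (max Na (max Nb Nc)), le_max_left _ _, fun N hN ι _ _ hcard Y b G hG hY hsq hp hw => ?_⟩
  have hN1 : 1 ≤ N := le_trans (le_max_left _ _) hN
  have hN2 := le_trans (le_max_right _ _) hN
  have ha := hNa N (le_trans (le_max_left _ _) hN2)
  have hN3 := le_trans (le_max_right _ _) hN2
  have hb := hNb N (le_trans (le_max_left _ _) hN3)
  have hcc := hNc N (le_trans (le_max_right _ _) hN3)
  have hN1' : (1 : ℝ) ≤ N := by exact_mod_cast hN1
  have hNpos : (0 : ℝ) < N := by linarith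
  have hL01' : (1 : ℝ) ≤ L0 := by exact_mod_cast hL01
  set D : ℝ := (N : ℝ) ^ (2 * ε) with hD
  have hD4 : 4 < D := by linarith
  have hDpos : 0 < D := by linarith
  set L : ι → ℕ := fun i => ⌊Y i / 2⌋₊ with hLdef
  have hLle : ∀ i, 2 * (L i : ℝ) ≤ Y i := by
    intro i
    have : (L i : ℝ) ≤ Y i / 2 := Nat.floor_le (by have := (hY i).1; linarith)
    linarith
  have hLge : ∀ i, Y i / 4 ≤ L i := by
    intro i
    have : Y i / 2 < (L i : ℝ) + 1 := Nat.lt_floor_add_one _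
    have := (hY i).1
    linarith
  have hLL0 : ∀ i, L0 ≤ L i := by
    intro i
    have h1 := hLge i; have h2 := (hY i).1
    have : (L0 : ℝ) ≤ L i := by linarith
    exact_mod_cast this
  have hL1 : ∀ i, 1 ≤ L i := fun i => hL01.trans (hLL0 i)
  have hLN : ∀ i, (L i : ℝ) ≤ N := by
    intro i; have := hLle i; have := (hY i).2
    have : (0 : ℝ) ≤ L i := Nat.cast_nonneg _
    linarith
  have hM1 : ∀ i, 1 ≤ Y i / D := fun i => by rw [le_div_iff₀ hDpos, one_mul]; exact (hY i).1
  have hML : ∀ i, Y i / D ≤ L i := by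
    intro i
    refine le_trans ?_ (hLge i)
    have : 0 ≤ Y i := by have := (hY i).1; linarith
    exact div_le_div_of_nonneg_left this (by norm_num) hD4.le
  have hG2 : (G : ℝ) ≤ (N : ℝ) ^ 2 := by
    have hGr : (1 : ℝ) ≤ G := by exact_mod_cast hG
    have h1 := hw G (Nat.mem_divisors_self _ (by omega))
    calc (G : ℝ) = (G : ℝ) ^ (1 : ℝ) := (Real.rpow_one _).symm
      _ ≤ (G : ℝ) ^ (1 + κ) := Real.rpow_le_rpow_of_exponent_le hGr (by linarith)
      _ ≤ _ := h1
      _ ≤ ∏ _i : ι, (N : ℝ) ^ (1 / 30 : ℝ) := by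
          refine Finset.prod_le_prod (fun i _ => ?_) fun i _ => ?_
          · have := hM1 i
            have : (0 : ℝ) ≤ ((G / Int.gcd (b i) G : ℕ) : ℝ) := Nat.cast_nonneg _
            positivity
          · have h0 := hM1 i
            apply Real.rpow_le_rpow _ _ (by norm_num)
            · have : (0 : ℝ) ≤ ((G / Int.gcd (b i) G : ℕ) : ℝ) := Nat.cast_nonneg _
              positivity
            · exact (min_le_right _ _).trans ((hML i).trans (hLN i))
      _ = ((N : ℝ) ^ (1 / 30 : ℝ)) ^ (Fintype.card ι) := by simp
      _ ≤ ((N : ℝ) ^ (1 / 30 : ℝ)) ^ 60 := pow_le_pow_right₀ (Real.one_le_rpow hN1' (by norm_num)) (by omega)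
      _ = (N : ℝ) ^ 2 := by
          rw [← Real.rpow_natCast, ← Real.rpow_mul hNpos.le]; norm_num
  -- apply solve
  suffices h : ∑ u ∈ (Finset.range G).filter (fun u => u ≠ 0), ∏ i, (‖TT (L i) ((b i : ℝ) * ((u : ℝ) / G))‖ / (L i : ℝ) ^ 2) < 1 by
    obtain ⟨n, hn, hdvd⟩ := solve L hL1 b G hG h
    refine ⟨n, fun i => ⟨(hn i).1, ?_⟩, hdvd⟩
    have : (n i : ℝ) ≤ 2 * L i := by exact_mod_cast (hn i).2
    exact this.trans (hLle i)
  refine lt_of_le_of_lt (group_den G hG (fun x => ∏ i, (‖TT (L i) ((b i : ℝ) * x)‖ / (L i : ℝ) ^ 2))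
    (fun x => Finset.prod_nonneg fun i _ => by positivity)) ?_
  -- bound each w
  set X : ℝ := 57 * (3 * (N : ℝ) ^ (κ * ε / 4)) / (N : ℝ) ^ (κ * ε) with hX
  have hX0 : 0 ≤ X := by positivity
  have hbound : ∀ w ∈ G.divisors.filter (fun w => w ≠ 1),
      ∑ v ∈ (Finset.range w).filter (fun v => Nat.Coprime v w),
      ∏ i, (‖TT (L i) ((b i : ℝ) * ((v : ℝ) / w))‖ / (L i : ℝ) ^ 2) ≤ 1 / (w : ℝ) ^ 3 + X := by
    intro w hwm
    obtain ⟨hwd, hw1⟩ := Finset.mem_filter.1 hwm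
    have hwG := (Nat.mem_divisors.1 hwd).1
    have hwpos : 1 ≤ w := Nat.pos_of_dvd_of_pos hwG (by omega)
    have hwr : (1 : ℝ) ≤ w := by exact_mod_cast hwpos
    have hww := hw w hwd
    by_cases hsm : (w : ℝ) ≤ (N : ℝ) ^ ε
    · refine le_trans (small_w L hL1 b w hwpos (hsq.squarefree_of_dvd hwG)
        (fun p hp' => hp p (Nat.primeFactors_mono hwG (by omega) hp')) ?_ ?_) (by linarith)
      · intro i
        obtain ⟨h1, h2, _⟩ := md_facts w hwpos (b i)
        have h3 : ((w / Int.gcd (b i) w : ℕ) : ℝ) ≤ (N : ℝ) ^ ε := by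
          refine le_trans ?_ hsm
          exact_mod_cast Nat.le_of_dvd (by omega) h2
        have h4 : ((w / Int.gcd (b i) w : ℕ) : ℝ) ^ (5 / 4 : ℝ) ≤ (N : ℝ) ^ (5 / 4 * ε) := by
          calc _ ≤ ((N : ℝ) ^ ε) ^ (5 / 4 : ℝ) := Real.rpow_le_rpow (Nat.cast_nonneg _) h3 (by norm_num)
            _ = _ := by rw [← Real.rpow_mul hNpos.le, mul_comm]
        have h5 : D = (N : ℝ) ^ (5 / 4 * ε) * (N : ℝ) ^ (3 / 4 * ε) := by
          rw [hD, ← Real.rpow_add hNpos]; congr 1; ring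
        have h6 : (N : ℝ) ^ (5 / 4 * ε) * 8 ≤ D := by rw [h5]; gcongr
        have := hLge i; have := (hY i).1
        linarith
      · calc (w : ℝ) = (w : ℝ) ^ (1 : ℝ) := (Real.rpow_one _).symm
          _ ≤ (w : ℝ) ^ (1 + κ) := Real.rpow_le_rpow_of_exponent_le hwr (by linarith)
          _ ≤ _ := hww
          _ ≤ _ := by
            refine Finset.prod_le_prod (fun i _ => ?_) fun i _ => ?_
            · have := hM1 i
              have : (0 : ℝ) ≤ ((w / Int.gcd (b i) w : ℕ) : ℝ) := Nat.cast_nonneg _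
              positivity
            · have := hM1 i
              have : (0 : ℝ) ≤ ((w / Int.gcd (b i) w : ℕ) : ℝ) := Nat.cast_nonneg _
              exact Real.rpow_le_rpow (by positivity) (min_le_left _ _) (by norm_num)
    · push Not at hsm
      have hmin1 : ∀ i, 1 ≤ min ((w / Int.gcd (b i) w : ℕ) : ℝ) (Y i / D) := by
        intro i
        have := (md_facts w hwpos (b i)).1
        exact le_min (by exact_mod_cast this) (hM1 i)
      have hpow : ∀ i, ((min ((w / Int.gcd (b i) w : ℕ) : ℝ) (Y i / D)) ^ (1 / 30 : ℝ)) ^ 30 =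
          min ((w / Int.gcd (b i) w : ℕ) : ℝ) (Y i / D) := by
        intro i
        rw [← Real.rpow_natCast, ← Real.rpow_mul (by linarith [hmin1 i])]; norm_num
      have hb2 := large_w hcard L b w hwpos (fun i => (min ((w / Int.gcd (b i) w : ℕ) : ℝ) (Y i / D)) ^ (1 / 30 : ℝ))
        (fun i => Real.one_le_rpow (hmin1 i) (by norm_num)) (3 * (N : ℝ) ^ (κ * ε / 4)) ((N : ℝ) ^ (κ * ε))
        (by have := Real.one_le_rpow hN1' (show 0 ≤ κ * ε / 4 by positivity); linarith) (by positivity)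
        (by
          intro i
          refine (hmom (L i) (hLL0 i) N (hLN i) w hwpos (b i) (Y i / D) _ (hML i)
            (Real.one_le_rpow (hmin1 i) (by norm_num)) ?_ ?_).trans ?_
          · rw [hpow i]; exact min_le_right _ _
          · rw [hpow i]; exact min_le_left _ _
          · refine mul_le_mul_of_nonneg_left ?_ (by linarith)
            have e1 : ((N : ℝ) ^ κ1) ^ 56 = (N : ℝ) ^ (κ * ε / 4) := by
              rw [← Real.rpow_natCast, ← Real.rpow_mul hNpos.le, hκ1]; congr 1; push_cast; ring
            rw [e1]
            have := Real.one_le_rpow hN1' (show 0 ≤ κ * ε / 4 by positivity)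
            linarith)
        (by
          refine le_trans ?_ hww
          rw [Real.rpow_add (by linarith), Real.rpow_one]
          gcongr
          calc (N : ℝ) ^ (κ * ε) = ((N : ℝ) ^ ε) ^ κ := by rw [← Real.rpow_mul hNpos.le, mul_comm]
            _ ≤ _ := Real.rpow_le_rpow (by positivity) hsm.le hκ.le)
      refine hb2.trans ?_
      have : 0 ≤ 1 / (w : ℝ) ^ 3 := by positivity
      linarith
  refine lt_of_le_of_lt (Finset.sum_le_sum hbound) ?_
  rw [Finset.sum_add_distrib, Finset.sum_const, nsmul_eq_mul]
  have hpart1 : ∑ w ∈ G.divisors.filter (fun w => w ≠ 1), 1 / (w : ℝ) ^ 3 ≤ 1 / 2 := by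
    have hsub : G.divisors.filter (fun w => w ≠ 1) ⊆ Finset.Ioc 1 G := by
      intro w hwm
      obtain ⟨hwd, hw1⟩ := Finset.mem_filter.1 hwm
      have hwG := (Nat.mem_divisors.1 hwd).1
      have := Nat.pos_of_dvd_of_pos hwG (by omega)
      have := Nat.le_of_dvd (by omega) hwG
      exact Finset.mem_Ioc.2 ⟨by omega, this⟩
    calc _ ≤ ∑ w ∈ Finset.Ioc 1 G, 1 / (w : ℝ) ^ 3 := Finset.sum_le_sum_of_subset_of_nonneg hsub fun _ _ _ => by positivity
      _ ≤ ∑ w ∈ Finset.Ioc 1 G, 1 / 2 * ((w : ℝ) ^ 2)⁻¹ := by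
          refine Finset.sum_le_sum fun w hw => ?_
          have h2 : (2 : ℝ) ≤ w := by exact_mod_cast (Finset.mem_Ioc.1 hw).1
          have hwp : (0 : ℝ) < w := by linarith
          rw [← div_eq_mul_inv, div_le_div_iff₀ (by positivity) (by positivity)]
          have : 0 < (w : ℝ) ^ 2 := by positivity
          nlinarith
      _ = 1 / 2 * ∑ w ∈ Finset.Ioc 1 G, ((w : ℝ) ^ 2)⁻¹ := by rw [Finset.mul_sum]
      _ ≤ 1 / 2 * ((1 : ℕ) : ℝ)⁻¹ := by
          refine mul_le_mul_of_nonneg_left ?_ (by norm_num)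
          refine (sum_Ioc_inv_sq_le_sub one_ne_zero hG).trans ?_
          have : 0 ≤ ((G : ℝ))⁻¹ := by positivity
          linarith
      _ = 1 / 2 := by norm_num
  have hpart2 : ((G.divisors.filter (fun w => w ≠ 1)).card : ℝ) * X < 1 / 2 := by
    have hd : ((G.divisors.filter (fun w => w ≠ 1)).card : ℝ) ≤ C * (N : ℝ) ^ (κ * ε / 4) := by
      calc _ ≤ (G.divisors.card : ℝ) := by exact_mod_cast Finset.card_filter_le _ _
        _ ≤ C * (G : ℝ) ^ κ2 := hdiv G hG
        _ ≤ C * ((N : ℝ) ^ 2) ^ κ2 := by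
            gcongr
        _ = C * (N : ℝ) ^ (κ * ε / 4) := by
            rw [← Real.rpow_natCast, ← Real.rpow_mul hNpos.le, hκ2]; congr 2; push_cast; ring
    calc _ ≤ C * (N : ℝ) ^ (κ * ε / 4) * X := by gcongr
      _ = (57 * 3 * C) / (N : ℝ) ^ (κ * ε / 2) := by
          have e1 : (N : ℝ) ^ (κ * ε) = (N : ℝ) ^ (κ * ε / 4) * (N : ℝ) ^ (κ * ε / 4) * (N : ℝ) ^ (κ * ε / 2) := by
            rw [← Real.rpow_add hNpos, ← Real.rpow_add hNpos]; congr 1; ring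
          rw [hX, e1]
          have : (N : ℝ) ^ (κ * ε / 4) ≠ 0 := by positivity
          have : (N : ℝ) ^ (κ * ε / 2) ≠ 0 := by positivity
          field_simp
      _ < 1 / 2 := by
          have : 0 < (N : ℝ) ^ (κ * ε / 2) := by positivity
          rw [div_lt_div_iff₀ this (by norm_num)]
          linarith
  linarith

end SFP

namespace SFP
open Finset

lemma md_mul (b : ℤ) (w v : ℕ) (hw : 1 ≤ w) (hv : 1 ≤ v) (hc : Nat.Coprime w v) :
    (w * v) / Int.gcd b (w * v : ℕ) = (w / Int.gcd b w) *
        (v / Int.gcd ((b / (Int.gcd b w : ℤ)) * ((w / Int.gcd b w : ℕ) : ℤ) ^ 5) v) ∧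
      b * ((w / Int.gcd b w : ℕ) : ℤ) ^ 6
        = w * ((b / (Int.gcd b w : ℤ)) * ((w / Int.gcd b w : ℕ) : ℤ) ^ 5) := by
  obtain ⟨g, hg⟩ : ∃ g, g = Int.gcd b w := ⟨_, rfl⟩
  have hgw : g ∣ w := by
    rw [hg]; exact_mod_cast Int.gcd_dvd_right b (w : ℤ)
  have hgb : (g : ℤ) ∣ b := by rw [hg]; exact Int.gcd_dvd_left b (w : ℤ)
  have hgpos : 0 < g := Nat.pos_of_dvd_of_pos hgw (by omega)
  rw [← hg]
  obtain ⟨m, hm⟩ := hgw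
  obtain ⟨c, hcb⟩ := hgb
  have hg0 : (g : ℤ) ≠ 0 := by exact_mod_cast hgpos.ne'
  have e1 : w / g = m := by rw [hm]; exact Nat.mul_div_cancel_left m hgpos
  have e2 : b / (g : ℤ) = c := by rw [hcb]; exact Int.mul_ediv_cancel_left c hg0
  rw [e1, e2]
  have hgv : Nat.Coprime g v := Nat.Coprime.coprime_dvd_left (Dvd.intro _ hm.symm) hc
  have hmv : Nat.Coprime m v := Nat.Coprime.coprime_dvd_left (Dvd.intro_left _ hm.symm) hc
  constructor
  · have h1 : Int.gcd b (w * v : ℕ) = g * Int.gcd b v := by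
      rw [hg]
      simp only [Int.gcd, Int.natAbs_natCast]
      exact Nat.Coprime.gcd_mul _ hc
    have h2 : Int.gcd (c * (m : ℤ) ^ 5) v = Int.gcd b v := by
      simp only [Int.gcd, Int.natAbs_natCast, Int.natAbs_mul, Int.natAbs_pow, hcb]
      rw [Nat.Coprime.gcd_mul_right_cancel _ (hmv.pow_left 5), Nat.Coprime.gcd_mul_left_cancel _ hgv]
    rw [h1, h2, hm]
    have h3 : Int.gcd b v ∣ v := by exact_mod_cast Int.gcd_dvd_right b (v : ℤ)
    obtain ⟨t, ht⟩ := h3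
    have hpos : 0 < Int.gcd b v := Nat.pos_of_dvd_of_pos (Dvd.intro _ ht.symm) (by omega)
    have e3 : v / Int.gcd b v = t := by
      conv_lhs => rw [ht]
      rw [← ht]
      exact Nat.div_eq_of_eq_mul_right hpos ht
    rw [e3]
    apply Nat.div_eq_of_eq_mul_right (by positivity)
    conv_lhs => rw [ht]
    ring
  · rw [hcb, hm]; push_cast; ring

lemma ml_sqf (ε : ℝ) (hε : 0 < ε) : ∃ N0 : ℕ, 1 ≤ N0 ∧ ∀ N : ℕ, N0 ≤ N →
    ∀ (ι : Type) [Fintype ι] [DecidableEq ι], Fintype.card ι ≤ 56 → ∀ (X : ι → ℝ) (b : ι → ℤ) (G : ℕ), 1 ≤ G →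
    (∀ i, 0 < X i ∧ X i ≤ N) → Squarefree G → (∀ p ∈ G.primeFactors, 288 ^ 2 ≤ p) →
    (G : ℝ) ≤ (∏ i, X i ^ (1 / 30 : ℝ)) * (N : ℝ) ^ (-ε) →
    ∃ n : ι → ℕ, (∃ i, n i ≠ 0) ∧ (∀ i, (n i : ℝ) ≤ X i) ∧ (G : ℤ) ∣ ∑ i, b i * (n i : ℤ) ^ 6 := by
  classical
  obtain ⟨N0, hN0, hcore⟩ := core (ε / 8) (ε / 8) (by positivity) (by positivity)
  refine ⟨N0 + 2, by omega, ?_⟩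
  intro N hN ι _ _ hcard X b G hG hX hsq hp hGX
  have hN2 : (1 : ℝ) < N := by exact_mod_cast (by omega : 1 < N)
  have hN1 : (0 : ℝ) < N := by linarith
  set D0 : ℝ := (N : ℝ) ^ (2 * (ε / 8)) with hD0
  have hD0pos : 0 < D0 := by positivity
  set wi : ℕ → ι → ℕ := fun w i => w / Int.gcd (b i) w with hwi
  set D : ℕ → ℝ := fun w => ∏ i, (min ((wi w i : ℕ) : ℝ) (X i / D0)) ^ (1 / 30 : ℝ) with hD
  have hMpos : ∀ i, 0 < X i / D0 := fun i => div_pos (hX i).1 hD0pos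
  have hwi1 : ∀ w, 1 ≤ w → ∀ i, 1 ≤ wi w i := fun w hw i => (md_facts w hw (b i)).1
  have hwi1' : ∀ w, 1 ≤ w → ∀ i, (1 : ℝ) ≤ wi w i := fun w hw i => by exact_mod_cast hwi1 w hw i
  have hminpos : ∀ w, 1 ≤ w → ∀ i, 0 < min ((wi w i : ℕ) : ℝ) (X i / D0) := fun w hw i =>
    lt_min (by linarith [hwi1' w hw i]) (hMpos i)
  have hDpos : ∀ w, 1 ≤ w → 0 < D w := fun w hw =>
    Finset.prod_pos fun i _ => Real.rpow_pos_of_pos (hminpos w hw i) _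
  obtain ⟨w, hwG, hmax⟩ := Finset.exists_max_image G.divisors (fun w => (w : ℝ) ^ (1 + ε / 8) / D w)
    ⟨1, by simp; omega⟩
  have hwdvd : w ∣ G := Nat.dvd_of_mem_divisors hwG
  have hw1 : 1 ≤ w := Nat.pos_of_dvd_of_pos hwdvd (by omega)
  have hwpos : (0 : ℝ) < w := by exact_mod_cast hw1
  have hmax' : ∀ u ∈ G.divisors, (u : ℝ) ^ (1 + ε / 8) * D w ≤ (w : ℝ) ^ (1 + ε / 8) * D u := by
    intro u hu
    have hu1 : 1 ≤ u := Nat.pos_of_dvd_of_pos (Nat.dvd_of_mem_divisors hu) (by omega)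
    have := hmax u hu
    rwa [div_le_div_iff₀ (hDpos u hu1) (hDpos w hw1)] at this
  by_cases hne : ∃ i, ((wi w i : ℕ) : ℝ) ≤ X i / D0
  · obtain ⟨G', hG'⟩ := hwdvd
    have hcop : Nat.Coprime w G' := by
      rw [hG'] at hsq
      exact Nat.coprime_of_squarefree_mul hsq
    have hG'1 : 1 ≤ G' := by
      rcases Nat.eq_zero_or_pos G' with h | h
      · rw [h] at hG'; omega
      · exact h
    have hG'dvd : G' ∣ G := Dvd.intro_left _ hG'.symm
    set b' : ι → ℤ := fun i => (b i / (Int.gcd (b i) w : ℤ)) * ((w / Int.gcd (b i) w : ℕ) : ℤ) ^ 5 with hb'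
    let I' := {i : ι // ((wi w i : ℕ) : ℝ) ≤ X i / D0}
    have hres := hcore N (by omega) I' (le_trans (Fintype.card_subtype_le _) hcard)
      (fun i => X i.1 / (wi w i.1 : ℝ)) (fun i => b' i.1) G' hG'1 ?_ (hsq.squarefree_of_dvd hG'dvd)
      (fun p hp' => hp p (Nat.primeFactors_mono hG'dvd (by omega) hp')) ?_
    · obtain ⟨n, hn1, hn2⟩ := hres
      refine ⟨fun i => if h : ((wi w i : ℕ) : ℝ) ≤ X i / D0 then wi w i * n ⟨i, h⟩ else 0, ?_, ?_, ?_⟩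
      · obtain ⟨i, hi⟩ := hne
        refine ⟨i, ?_⟩
        beta_reduce
        rw [dif_pos hi]
        have h1 := hwi1 w hw1 i
        have h2 := (hn1 ⟨i, hi⟩).1
        positivity
      · intro i
        beta_reduce
        by_cases h : ((wi w i : ℕ) : ℝ) ≤ X i / D0
        · rw [dif_pos h]
          have h2 := (hn1 ⟨i, h⟩).2
          have h1 := hwi1' w hw1 i
          rw [le_div_iff₀ (by linarith)] at h2
          push_cast
          linarith
        · rw [dif_neg h]
          simpa using (hX i).1.le
      · have hsum : ∑ i, b i * (((if h : ((wi w i : ℕ) : ℝ) ≤ X i / D0 then wi w i * n ⟨i, h⟩ else 0 : ℕ)) : ℤ) ^ 6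
            = w * ∑ i : I', b' i.1 * (n i : ℤ) ^ 6 := by
          rw [Finset.mul_sum]
          symm
          have h0 : ∀ i ∈ (Finset.univ : Finset ι), i ∉ Finset.univ.filter (fun i => ((wi w i : ℕ) : ℝ) ≤ X i / D0) →
              b i * (((if h : ((wi w i : ℕ) : ℝ) ≤ X i / D0 then wi w i * n ⟨i, h⟩ else 0 : ℕ)) : ℤ) ^ 6 = 0 := by
            intro i _ hi
            have : ¬ ((wi w i : ℕ) : ℝ) ≤ X i / D0 := by simpa using hi
            rw [dif_neg this]; simp
          rw [← Finset.sum_subset (Finset.subset_univ _) h0]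
          rw [Finset.sum_subtype (p := fun i => ((wi w i : ℕ) : ℝ) ≤ X i / D0) _ (by intro x; simp)
            (fun i => b i * (((if h : ((wi w i : ℕ) : ℝ) ≤ X i / D0 then wi w i * n ⟨i, h⟩ else 0 : ℕ)) : ℤ) ^ 6)]
          refine Finset.sum_congr rfl ?_
          · rintro ⟨i, hi⟩ _
            simp only [dif_pos hi]
            have h1 := (md_mul (b i) w G' hw1 hG'1 hcop).2
            have h2 : (wi w i : ℤ) = ((w / Int.gcd (b i) w : ℕ) : ℤ) := rfl
            rw [Nat.cast_mul, mul_pow, ← mul_assoc (b i), h2, h1]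
            ring
        rw [hsum, hG']
        push_cast
        exact mul_dvd_mul_left _ hn2
    · rintro ⟨i, hi⟩
      have h1 := hwi1' w hw1 i
      constructor
      · rw [le_div_iff₀ (by linarith)]
        rw [le_div_iff₀ hD0pos] at hi
        linarith
      · exact (div_le_self (hX i).1.le h1).trans (hX i).2
    · intro v hv
      have hvdvd : v ∣ G' := Nat.dvd_of_mem_divisors hv
      have hv1 : 1 ≤ v := Nat.pos_of_dvd_of_pos hvdvd (by omega)
      have hcv : Nat.Coprime w v := Nat.Coprime.coprime_dvd_right hvdvd hcop
      have hmx := hmax' (w * v) (by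
        rw [Nat.mem_divisors]; exact ⟨by rw [hG']; exact mul_dvd_mul_left _ hvdvd, by omega⟩)
      have e1 : ((w * v : ℕ) : ℝ) ^ (1 + ε / 8) = (w : ℝ) ^ (1 + ε / 8) * (v : ℝ) ^ (1 + ε / 8) := by
        push_cast
        rw [Real.mul_rpow (by positivity) (by positivity)]
      rw [e1, mul_assoc] at hmx
      have hmx2 : (v : ℝ) ^ (1 + ε / 8) * D w ≤ D (w * v) := le_of_mul_le_mul_left hmx (by positivity)
      have hfac : D (w * v) = D w * ∏ i : I', (min ((v / Int.gcd (b' i.1) v : ℕ) : ℝ)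
          (X i.1 / (wi w i.1 : ℝ) / D0)) ^ (1 / 30 : ℝ) := by
        have hsub : ∏ i : I', (min ((v / Int.gcd (b' i.1) v : ℕ) : ℝ)
          (X i.1 / (wi w i.1 : ℝ) / D0)) ^ (1 / 30 : ℝ) = ∏ i, (if ((wi w i : ℕ) : ℝ) ≤ X i / D0 then
            (min ((v / Int.gcd (b' i) v : ℕ) : ℝ) (X i / (wi w i : ℝ) / D0)) ^ (1 / 30 : ℝ) else 1) := by
          rw [← Finset.prod_filter]
          rw [Finset.prod_subtype (p := fun i => ((wi w i : ℕ) : ℝ) ≤ X i / D0) _ (by intro x; simp)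
            (fun i => (min ((v / Int.gcd (b' i) v : ℕ) : ℝ) (X i / (wi w i : ℝ) / D0)) ^ (1 / 30 : ℝ))]
        rw [hsub, hD]
        simp only
        rw [← Finset.prod_mul_distrib]
        refine Finset.prod_congr rfl fun i _ => ?_
        have h1 := (md_mul (b i) w v hw1 hv1 hcv).1
        have h2 : wi (w * v) i = wi w i * (v / Int.gcd (b' i) v) := h1
        have hw1' := hwi1' w hw1 i
        have hwp : (0 : ℝ) < wi w i := by linarith
        have hvi : (1 : ℝ) ≤ ((v / Int.gcd (b' i) v : ℕ) : ℝ) := by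
          exact_mod_cast (md_facts v hv1 (b' i)).1
        rw [h2]
        split_ifs with hi
        · rw [min_eq_left hi, ← Real.mul_rpow hwp.le (le_min (by linarith) (by
            have := (hX i).1; positivity))]
          congr 1
          rw [mul_min_of_nonneg _ _ hwp.le]
          push_cast
          congr 1
          field_simp
        · have hi' : X i / D0 ≤ (wi w i : ℝ) := (not_le.1 hi).le
          rw [min_eq_right hi', mul_one, min_eq_right]
          push_cast
          nlinarith
      rw [hfac, mul_comm] at hmx2
      exact le_of_mul_le_mul_left hmx2 (hDpos w hw1)
  · exfalso
    push Not at hne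
    have h1 := hmax' 1 (by simp; omega)
    have hD1 : D 1 ≤ 1 := by
      refine Finset.prod_le_one (fun i _ => (Real.rpow_pos_of_pos (hminpos 1 le_rfl i) _).le) fun i _ => ?_
      refine Real.rpow_le_one (hminpos 1 le_rfl i).le ?_ (by norm_num)
      refine (min_le_left _ _).trans ?_
      simp [hwi]
    have hDw : D w = (∏ i, X i ^ (1 / 30 : ℝ)) / (D0 ^ (1 / 30 : ℝ)) ^ (Fintype.card ι) := by
      rw [hD]
      simp only
      rw [← Finset.card_univ, ← Finset.prod_const, ← Finset.prod_div_distrib]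
      refine Finset.prod_congr rfl fun i _ => ?_
      rw [min_eq_right (hne i).le, Real.div_rpow (hX i).1.le hD0pos.le]
    have hcost : (D0 ^ (1 / 30 : ℝ)) ^ (Fintype.card ι) ≤ (N : ℝ) ^ (ε / 2) := by
      rw [hD0, ← Real.rpow_natCast, ← Real.rpow_mul (by positivity), ← Real.rpow_mul (by positivity)]
      apply Real.rpow_le_rpow_of_exponent_le hN2.le
      have : ((Fintype.card ι : ℕ) : ℝ) ≤ 56 := by exact_mod_cast hcard
      nlinarith
    have hPX : (G : ℝ) * (N : ℝ) ^ ε ≤ ∏ i, X i ^ (1 / 30 : ℝ) := by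
      rw [Real.rpow_neg hN1.le] at hGX
      rw [← le_div_iff₀ (by positivity)]
      exact hGX
    have hGpos : (0 : ℝ) < G := by exact_mod_cast hG
    have hG1 : (1 : ℝ) ≤ G := by exact_mod_cast hG
    have h2 : (G : ℝ) * (N : ℝ) ^ (ε / 2) ≤ D w := by
      rw [hDw, le_div_iff₀ (by positivity)]
      refine le_trans ?_ hPX
      rw [mul_assoc]
      refine mul_le_mul_of_nonneg_left ?_ hGpos.le
      calc (N : ℝ) ^ (ε / 2) * _ ≤ (N : ℝ) ^ (ε / 2) * (N : ℝ) ^ (ε / 2) :=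
            mul_le_mul_of_nonneg_left hcost (by positivity)
        _ = _ := by rw [← Real.rpow_add hN1]; ring_nf
    have hPle : ∏ i, X i ^ (1 / 30 : ℝ) ≤ (N : ℝ) ^ (2 : ℝ) := by
      calc ∏ i, X i ^ (1 / 30 : ℝ) ≤ ∏ i : ι, (N : ℝ) ^ (1 / 30 : ℝ) :=
            Finset.prod_le_prod (fun i _ => Real.rpow_nonneg (hX i).1.le _) fun i _ =>
              Real.rpow_le_rpow (hX i).1.le (hX i).2 (by norm_num)
        _ = (N : ℝ) ^ ((1 / 30 : ℝ) * (Fintype.card ι : ℕ)) := by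
            rw [Finset.prod_const, Finset.card_univ, Real.rpow_mul hN1.le, Real.rpow_natCast]
        _ ≤ _ := by
            apply Real.rpow_le_rpow_of_exponent_le hN2.le
            have : ((Fintype.card ι : ℕ) : ℝ) ≤ 56 := by exact_mod_cast hcard
            linarith
    have hGle : (G : ℝ) ≤ (N : ℝ) ^ (2 : ℝ) := by
      have : (1 : ℝ) ≤ (N : ℝ) ^ ε := Real.one_le_rpow hN2.le hε.le
      nlinarith
    have hwle : (w : ℝ) ≤ G := by exact_mod_cast Nat.le_of_dvd (by omega) hwdvd
    have h3 : D w ≤ (G : ℝ) * (N : ℝ) ^ (ε / 4) := by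
      calc D w ≤ (w : ℝ) ^ (1 + ε / 8) * D 1 := by simpa using h1
        _ ≤ (w : ℝ) ^ (1 + ε / 8) * 1 := mul_le_mul_of_nonneg_left hD1 (by positivity)
        _ ≤ (G : ℝ) ^ (1 + ε / 8) := by
            rw [mul_one]; exact Real.rpow_le_rpow hwpos.le hwle (by positivity)
        _ = (G : ℝ) * (G : ℝ) ^ (ε / 8) := by rw [Real.rpow_add hGpos, Real.rpow_one]
        _ ≤ (G : ℝ) * ((N : ℝ) ^ (2 : ℝ)) ^ (ε / 8) := by
            refine mul_le_mul_of_nonneg_left ?_ hGpos.le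
            exact Real.rpow_le_rpow hGpos.le hGle (by positivity)
        _ = _ := by rw [← Real.rpow_mul hN1.le]; ring_nf
    have h4 : (N : ℝ) ^ (ε / 4) < (N : ℝ) ^ (ε / 2) := Real.rpow_lt_rpow_of_exponent_lt hN2 (by linarith)
    nlinarith

end SFP

namespace SFP
open Finset

lemma ml (ε : ℝ) (hε : 0 < ε) : ∃ N0 : ℕ, 1 ≤ N0 ∧ ∀ N : ℕ, N0 ≤ N →
    ∀ (ι : Type) [Fintype ι] [DecidableEq ι], Fintype.card ι ≤ 56 → ∀ (X : ι → ℝ) (b : ι → ℤ) (G : ℕ), 1 ≤ G →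
    (∀ i, 0 < X i ∧ X i ≤ N) →
    (G : ℝ) ≤ (∏ i, X i ^ (1 / 30 : ℝ)) * (N : ℝ) ^ (-ε) →
    ∃ n : ι → ℕ, (∃ i, n i ≠ 0) ∧ (∀ i, (n i : ℝ) ≤ X i) ∧ (G : ℤ) ∣ ∑ i, b i * (n i : ℤ) ^ 6 := by
  obtain ⟨W, hW⟩ : ∃ W : ℕ, W = (288 ^ 2).factorial := ⟨_, rfl⟩
  have hWpos : 1 ≤ W := by rw [hW]; exact Nat.factorial_pos _
  have hWd : ∀ p : ℕ, p.Prime → p < 288 ^ 2 → p ∣ W := by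
    intro p hp hlt
    rw [hW]
    exact Nat.dvd_factorial hp.pos hlt.le
  clear hW
  obtain ⟨N1, hN1, hml⟩ := ml_sqf (ε / 2) (by positivity)
  obtain ⟨N2, hN2, hW2⟩ := ev_const (ε / 2) (by positivity) ((W : ℝ) ^ 2)
  refine ⟨N1 + N2, by omega, ?_⟩
  intro N hN ι _ _ hcard X β G hG hX hGX
  have hNpos : (0 : ℝ) < N := by exact_mod_cast (by omega : 0 < N)
  have hWN := hW2 N (by omega)
  obtain ⟨a, b, hab, hsq⟩ := Nat.sq_mul_squarefree G
  have hb1 : 1 ≤ b := by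
    rcases Nat.eq_zero_or_pos b with h | h
    · rw [h] at hab; simp at hab; omega
    · exact h
  have ha1 : 1 ≤ a := by
    rcases Nat.eq_zero_or_pos a with h | h
    · rw [h] at hab; simp at hab; omega
    · exact h
  obtain ⟨g, hg⟩ : ∃ g, g = Nat.gcd a W := ⟨_, rfl⟩
  obtain ⟨a', ha'⟩ : g ∣ a := by rw [hg]; exact Nat.gcd_dvd_left _ _
  have hgW : g ∣ W := by rw [hg]; exact Nat.gcd_dvd_right _ _
  have hgpos : 1 ≤ g := Nat.pos_of_dvd_of_pos hgW (by omega)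
  have ha'1 : 1 ≤ a' := by
    rcases Nat.eq_zero_or_pos a' with h | h
    · rw [h] at ha'; omega
    · exact h
  have ha'd : a' ∣ a := Dvd.intro_left _ ha'.symm
  have hbW : (1 : ℝ) ≤ (b : ℝ) * W := by exact_mod_cast Nat.mul_pos hb1 hWpos
  have hbWpos : (0 : ℝ) < (b : ℝ) * W := by linarith
  obtain ⟨n, hn0, hn1, hn2⟩ := hml N (by omega) ι hcard (fun i => X i / ((b : ℝ) * W)) β a' ha'1
    (fun i => ⟨div_pos (hX i).1 hbWpos, (div_le_self (hX i).1.le hbW).trans (hX i).2⟩)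
    (hsq.squarefree_of_dvd ha'd) (by
      intro p hp
      have hpp := Nat.prime_of_mem_primeFactors hp
      have hpd := Nat.dvd_of_mem_primeFactors hp
      by_contra hlt
      have h1 : p ∣ g := by
        rw [hg]; exact Nat.dvd_gcd (hpd.trans ha'd) (hWd p hpp (by omega))
      have h2 : p * p ∣ a := by rw [ha']; exact mul_dvd_mul h1 hpd
      exact hpp.one_lt.ne' (Nat.isUnit_iff.1 (hsq p h2))) (by
      have hcost : (((b : ℝ) * W) ^ (1 / 30 : ℝ)) ^ (Fintype.card ι) ≤ ((b : ℝ) * W) ^ 2 := by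
        rw [← Real.rpow_natCast, ← Real.rpow_mul hbWpos.le, ← Real.rpow_natCast _ 2]
        apply Real.rpow_le_rpow_of_exponent_le hbW
        have : ((Fintype.card ι : ℕ) : ℝ) ≤ 56 := by exact_mod_cast hcard
        push_cast
        linarith
      have hprod : ∏ i, (X i / ((b : ℝ) * W)) ^ (1 / 30 : ℝ)
          = (∏ i, X i ^ (1 / 30 : ℝ)) / (((b : ℝ) * W) ^ (1 / 30 : ℝ)) ^ (Fintype.card ι) := by
        rw [← Finset.card_univ, ← Finset.prod_const, ← Finset.prod_div_distrib]
        exact Finset.prod_congr rfl fun i _ => Real.div_rpow (hX i).1.le hbWpos.le _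
      rw [hprod]
      obtain ⟨Q, hQ⟩ : ∃ Q, Q = ∏ i, X i ^ (1 / 30 : ℝ) := ⟨_, rfl⟩
      rw [← hQ] at hGX ⊢
      have hcp : 0 < (((b : ℝ) * W) ^ (1 / 30 : ℝ)) ^ (Fintype.card ι) := by positivity
      rw [div_mul_eq_mul_div, le_div_iff₀ hcp]
      have hNe : (N : ℝ) ^ (-ε) = (N : ℝ) ^ (-(ε / 2)) * (N : ℝ) ^ (-(ε / 2)) := by
        rw [← Real.rpow_add hNpos]; ring_nf
      have hinv : (N : ℝ) ^ (-(ε / 2)) * (N : ℝ) ^ (ε / 2) = 1 := by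
        rw [← Real.rpow_add hNpos]; simp
      have hGr : (G : ℝ) = (b : ℝ) ^ 2 * a := by rw [← hab]; push_cast; ring
      have ha'a : (a' : ℝ) ≤ a := by exact_mod_cast Nat.le_of_dvd (by omega) ha'd
      have hQ0 : 0 ≤ Q * (N : ℝ) ^ (-ε) := le_trans (by positivity) hGX
      calc (a' : ℝ) * _ ≤ (a : ℝ) * ((b : ℝ) * W) ^ 2 := by
            exact mul_le_mul ha'a hcost hcp.le (by positivity)
        _ = (G : ℝ) * (W : ℝ) ^ 2 := by rw [hGr]; ring
        _ ≤ (Q * (N : ℝ) ^ (-ε)) * (N : ℝ) ^ (ε / 2) := mul_le_mul hGX hWN.le (by positivity) hQ0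
        _ = Q * (N : ℝ) ^ (-(ε / 2)) * ((N : ℝ) ^ (-(ε / 2)) * (N : ℝ) ^ (ε / 2)) := by rw [hNe]; ring
        _ = _ := by rw [hinv, mul_one])
  refine ⟨fun i => b * W * n i, ?_, ?_, ?_⟩
  · obtain ⟨i, hi⟩ := hn0
    refine ⟨i, ?_⟩
    have : 0 < n i := Nat.pos_of_ne_zero hi
    beta_reduce
    positivity
  · intro i
    have := hn1 i
    rw [le_div_iff₀ hbWpos] at this
    push_cast
    linarith
  · obtain ⟨c, hc⟩ := hn2
    obtain ⟨d, hd⟩ := hgW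
    have : ∑ i, β i * ((b * W * n i : ℕ) : ℤ) ^ 6 = ((b : ℤ) * W) ^ 6 * ∑ i, β i * (n i : ℤ) ^ 6 := by
      rw [Finset.mul_sum]
      refine Finset.sum_congr rfl fun i _ => ?_
      push_cast; ring
    rw [this, hc, ← hab, ha']
    refine ⟨(b : ℤ) ^ 4 * W ^ 5 * d * c, ?_⟩
    have hWz : (W : ℤ) = g * d := by exact_mod_cast hd
    have : ((b : ℤ) * W) ^ 6 * (a' * c) = (b : ℤ) ^ 6 * W ^ 5 * W * (a' * c) := by ring
    rw [this]
    nth_rewrite 2 [hWz]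
    push_cast
    ring

end SFP

namespace SFP
open Finset

lemma coeffs (H : ℕ) (hH : 1 ≤ H) (r : ℕ) (hr : 1 ≤ r) : ∃ c : ℕ → ℝ, (∀ m, 0 ≤ c m) ∧
    (∀ m, c m ≤ (H : ℝ) ^ (r - 1)) ∧
    (∀ z : ℂ, (∑ v ∈ Finset.range H, z ^ v) ^ r = ∑ m ∈ Finset.range (r * H), (c m : ℂ) * z ^ m) ∧
    ∑ m ∈ Finset.range (r * H), c m = (H : ℝ) ^ r := by
  obtain ⟨Q, hQ⟩ : ∃ Q : Polynomial ℝ, Q = ∑ v ∈ Finset.range H, Polynomial.X ^ v := ⟨_, rfl⟩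
  have hQc : ∀ m, Q.coeff m = if m < H then 1 else 0 := by
    intro m
    rw [hQ, Polynomial.finsetSum_coeff]
    simp [Polynomial.coeff_X_pow]
  have hstep : ∀ (P : Polynomial ℝ) m, (P * Q).coeff m = ∑ v ∈ Finset.range H, if v ≤ m then P.coeff (m - v) else 0 := by
    intro P m
    rw [hQ, Finset.mul_sum, Polynomial.finsetSum_coeff]
    exact Finset.sum_congr rfl fun v _ => Polynomial.coeff_mul_X_pow' P v m
  have hb : ∀ k m, 0 ≤ (Q ^ (k + 1)).coeff m ∧ (Q ^ (k + 1)).coeff m ≤ (H : ℝ) ^ k := by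
    intro k
    induction k with
    | zero =>
      intro m
      rw [zero_add, pow_one, hQc]
      split_ifs <;> simp
    | succ k ih =>
      intro m
      rw [pow_succ, hstep]
      constructor
      · refine Finset.sum_nonneg fun v _ => ?_
        split_ifs
        · exact (ih _).1
        · exact le_rfl
      · calc _ ≤ ∑ v ∈ Finset.range H, (H : ℝ) ^ k := by
              refine Finset.sum_le_sum fun v _ => ?_
              split_ifs
              · exact (ih _).2
              · positivity
          _ = _ := by simp [pow_succ, mul_comm]
  obtain ⟨k, rfl⟩ : ∃ k, r = k + 1 := ⟨r - 1, by omega⟩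
  have hdeg : (Q ^ (k + 1)).natDegree < (k + 1) * H := by
    have h1 : Q.natDegree ≤ H - 1 := by
      rw [hQ]
      refine Polynomial.natDegree_sum_le_of_forall_le _ _ fun v hv => ?_
      rw [Polynomial.natDegree_X_pow]
      have := Finset.mem_range.1 hv
      omega
    have h2 := (Polynomial.natDegree_pow_le (p := Q) (n := k + 1)).trans (Nat.mul_le_mul_left (k + 1) h1)
    refine lt_of_le_of_lt h2 ?_
    exact Nat.mul_lt_mul_of_pos_left (by omega) (by omega)
  have hz : ∀ z : ℂ, (∑ v ∈ Finset.range H, z ^ v) ^ (k + 1)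
      = ∑ m ∈ Finset.range ((k + 1) * H), ((Q ^ (k + 1)).coeff m : ℂ) * z ^ m := by
    intro z
    have := Polynomial.aeval_eq_sum_range' hdeg z
    rw [map_pow, hQ, map_sum] at this
    simp only [map_pow, Polynomial.aeval_X] at this
    rw [this, hQ]
    refine Finset.sum_congr rfl fun m _ => ?_
    rw [Complex.real_smul]
  refine ⟨fun m => (Q ^ (k + 1)).coeff m, fun m => (hb k m).1, fun m => (hb k m).2, hz, ?_⟩
  have := hz 1
  simp only [one_pow, mul_one, Finset.sum_const, Finset.card_range, nsmul_eq_mul] at this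
  exact_mod_cast this.symm

lemma detect {T : Type} [Fintype T] (θ : T → ℝ) (Δ : ℝ) (hΔ : 0 < Δ) (hθ : ∀ t, Δ ≤ nd (θ t))
    (H r : ℕ) (hH : 1 ≤ H) (hr : 1 ≤ r) :
    (Fintype.card T : ℝ) * (1 / r - H * (1 / (2 * Δ * H)) ^ (2 * r))
      ≤ 2 * ∑ h ∈ Finset.Icc 1 (r * H), ‖∑ t, ee ((h : ℝ) * θ t)‖ := by
  obtain ⟨c, hc0, hcb, hcz, hcs⟩ := coeffs H hH r hr
  set M := r * H with hM
  have hHpos : (0 : ℝ) < H := by exact_mod_cast hH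
  have hrpos : (0 : ℝ) < r := by exact_mod_cast hr
  set s : ℕ → ℝ := fun h => ‖∑ t, ee ((h : ℝ) * θ t)‖ with hs
  have hs0 : ∀ h, 0 ≤ s h := fun h => norm_nonneg _
  set F : T → ℂ := fun t => ∑ m ∈ Finset.range M, (c m : ℂ) * ee ((m : ℝ) * θ t) with hF
  have hFb : ∀ t, ‖F t‖ ^ 2 ≤ (1 / (2 * Δ)) ^ (2 * r) := by
    intro t
    have h1 : F t = (∑ v ∈ Finset.range H, ee (θ t) ^ v) ^ r := by
      rw [hcz, hF]
      exact Finset.sum_congr rfl fun m _ => by rw [ee_nat_mul]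
    have h2 : ‖∑ v ∈ Finset.range H, ee (θ t) ^ v‖ = ‖∑ v ∈ Finset.range H, ee ((v + 1) * θ t)‖ := by
      have : ∑ v ∈ Finset.range H, ee ((v + 1) * θ t) = ee (θ t) * ∑ v ∈ Finset.range H, ee (θ t) ^ v := by
        rw [Finset.mul_sum]
        refine Finset.sum_congr rfl fun v _ => ?_
        rw [add_mul, one_mul, ee_add, ee_nat_mul, mul_comm]
      rw [this, norm_mul, ee_norm, one_mul]
    have h3 : ‖∑ v ∈ Finset.range H, ee (θ t) ^ v‖ ≤ 1 / (2 * Δ) := by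
      rw [h2, le_div_iff₀ (by positivity)]
      have := geo_bound (θ t) H
      have h4 := mul_le_mul_of_nonneg_left (hθ t) (norm_nonneg (∑ v ∈ Finset.range H, ee ((v + 1) * θ t)))
      linarith
    rw [h1, norm_pow, ← pow_mul, mul_comm r 2]
    exact pow_le_pow_left₀ (norm_nonneg _) h3 _
  set S : ℕ → ℕ → ℂ := fun m m' => ∑ t, ee ((m : ℝ) * θ t) * (starRingEnd ℂ) (ee ((m' : ℝ) * θ t)) with hS
  have hSd : ∀ m, S m m = Fintype.card T := by
    intro m
    rw [hS]
    simp [Complex.mul_conj', ee_norm]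
  have hS1 : ∀ m h, ‖S (m + h) m‖ = s h := by
    intro m h
    rw [hS, hs]
    congr 1
    refine Finset.sum_congr rfl fun t _ => ?_
    rw [← ee_neg, ← ee_add]
    congr 1
    push_cast
    ring
  have hS2 : ∀ m h, ‖S m (m + h)‖ = s h := by
    intro m h
    rw [← hS1 m h, ← Complex.norm_conj]
    congr 1
    rw [hS]
    simp only [map_sum, map_mul, Complex.conj_conj]
    exact Finset.sum_congr rfl fun t _ => mul_comm _ _
  have hid : ((∑ t, ‖F t‖ ^ 2 : ℝ) : ℂ)
      = ∑ m ∈ Finset.range M, ∑ m' ∈ Finset.range M, (c m : ℂ) * c m' * S m m' := by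
    push_cast
    have : ∀ t, ((‖F t‖ : ℂ)) ^ 2 = ∑ m ∈ Finset.range M, ∑ m' ∈ Finset.range M,
        (c m : ℂ) * c m' * (ee ((m : ℝ) * θ t) * (starRingEnd ℂ) (ee ((m' : ℝ) * θ t))) := by
      intro t
      rw [← Complex.mul_conj', hF, map_sum, Finset.sum_mul_sum]
      refine Finset.sum_congr rfl fun m _ => Finset.sum_congr rfl fun m' _ => ?_
      rw [map_mul, Complex.conj_ofReal]
      ring
    rw [Finset.sum_congr rfl fun t _ => this t, Finset.sum_comm]
    refine Finset.sum_congr rfl fun m _ => ?_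
    rw [Finset.sum_comm]
    refine Finset.sum_congr rfl fun m' _ => ?_
    rw [hS, Finset.mul_sum]
  have hsplit : ∑ m ∈ Finset.range M, ∑ m' ∈ Finset.range M, (c m : ℂ) * c m' * S m m'
      = ((Fintype.card T * ∑ m ∈ Finset.range M, c m ^ 2 : ℝ) : ℂ)
        + ∑ m ∈ Finset.range M, ∑ m' ∈ Finset.range M, (if m = m' then 0 else (c m : ℂ) * c m' * S m m') := by
    push_cast
    rw [Finset.mul_sum, ← Finset.sum_add_distrib]
    refine Finset.sum_congr rfl fun m hm => ?_
    have h1 : ∀ m' ∈ Finset.range M, (c m : ℂ) * c m' * S m m' =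
        (if m = m' then (c m : ℂ) * c m' * S m m' else 0) + (if m = m' then 0 else (c m : ℂ) * c m' * S m m') := by
      intro m' _
      split_ifs <;> simp
    rw [Finset.sum_congr rfl h1, Finset.sum_add_distrib, Finset.sum_ite_eq, if_pos hm, hSd]
    congr 1
    ring
  set E : ℂ := ∑ m ∈ Finset.range M, ∑ m' ∈ Finset.range M, (if m = m' then 0 else (c m : ℂ) * c m' * S m m') with hE
  have hEb : ‖E‖ ≤ 2 * ((H : ℝ) ^ (r - 1) * (H : ℝ) ^ r) * ∑ h ∈ Finset.Icc 1 M, s h := by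
    have h1 : ∀ m ∈ Finset.range M, ∀ m' ∈ Finset.range M, ‖(if m = m' then 0 else (c m : ℂ) * c m' * S m m')‖
        ≤ ∑ h ∈ Finset.Icc 1 M, ((if m' = m + h then c m * c m' * s h else 0)
          + (if m = m' + h then c m * c m' * s h else 0)) := by
      intro m hm m' hm'
      have hnn : ∀ h ∈ Finset.Icc 1 M, 0 ≤ ((if m' = m + h then c m * c m' * s h else 0)
          + (if m = m' + h then c m * c m' * s h else 0)) := by
        intro h _
        have := mul_nonneg (mul_nonneg (hc0 m) (hc0 m')) (hs0 h)
        split_ifs <;> linarith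
      have hm1 := Finset.mem_range.1 hm
      have hm2 := Finset.mem_range.1 hm'
      have hn : ‖(c m : ℂ) * c m' * S m m'‖ = c m * c m' * ‖S m m'‖ := by
        rw [norm_mul, norm_mul, Complex.norm_real, Complex.norm_real, Real.norm_of_nonneg (hc0 m),
          Real.norm_of_nonneg (hc0 m')]
      rcases lt_trichotomy m m' with hlt | heq | hgt
      · rw [if_neg hlt.ne, hn]
        refine le_trans ?_ (Finset.single_le_sum hnn (Finset.mem_Icc.2 ⟨by omega, by omega⟩ : m' - m ∈ Finset.Icc 1 M))
        rw [if_pos (by omega), if_neg (by omega), add_zero]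
        rw [← hS2 m (m' - m), Nat.add_sub_cancel' hlt.le]
      · rw [if_pos heq, norm_zero]
        exact Finset.sum_nonneg hnn
      · rw [if_neg hgt.ne', hn]
        refine le_trans ?_ (Finset.single_le_sum hnn (Finset.mem_Icc.2 ⟨by omega, by omega⟩ : m - m' ∈ Finset.Icc 1 M))
        rw [if_neg (by omega), if_pos (by omega), zero_add]
        rw [← hS1 m' (m - m'), Nat.add_sub_cancel' hgt.le]
    have hA : ∀ h, ∑ m ∈ Finset.range M, ∑ m' ∈ Finset.range M, (if m' = m + h then c m * c m' * s h else 0)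
        ≤ (H : ℝ) ^ (r - 1) * (H : ℝ) ^ r * s h := by
      intro h
      rw [← hcs, mul_assoc, Finset.sum_mul, Finset.mul_sum]
      refine Finset.sum_le_sum fun m hm => ?_
      rw [Finset.sum_ite_eq']
      have h0 := mul_nonneg (hc0 m) (hs0 h)
      split_ifs
      · have := mul_le_mul_of_nonneg_right (hcb (m + h)) h0
        calc _ = c (m + h) * (c m * s h) := by ring
          _ ≤ _ := this
      · positivity
    have hB : ∀ h, ∑ m ∈ Finset.range M, ∑ m' ∈ Finset.range M, (if m = m' + h then c m * c m' * s h else 0)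
        ≤ (H : ℝ) ^ (r - 1) * (H : ℝ) ^ r * s h := by
      intro h
      rw [Finset.sum_comm]
      refine le_trans (le_of_eq ?_) (hA h)
      refine Finset.sum_congr rfl fun m _ => Finset.sum_congr rfl fun m' _ => ?_
      rw [mul_comm (c m') (c m)]
    calc ‖E‖ ≤ ∑ m ∈ Finset.range M, ∑ m' ∈ Finset.range M, ‖(if m = m' then 0 else (c m : ℂ) * c m' * S m m')‖ :=
          (norm_sum_le _ _).trans (Finset.sum_le_sum fun m _ => norm_sum_le _ _)
      _ ≤ ∑ m ∈ Finset.range M, ∑ m' ∈ Finset.range M, ∑ h ∈ Finset.Icc 1 M,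
          ((if m' = m + h then c m * c m' * s h else 0) + (if m = m' + h then c m * c m' * s h else 0)) :=
          Finset.sum_le_sum fun m hm => Finset.sum_le_sum fun m' hm' => h1 m hm m' hm'
      _ = ∑ h ∈ Finset.Icc 1 M, ((∑ m ∈ Finset.range M, ∑ m' ∈ Finset.range M, (if m' = m + h then c m * c m' * s h else 0))
          + ∑ m ∈ Finset.range M, ∑ m' ∈ Finset.range M, (if m = m' + h then c m * c m' * s h else 0)) := by
          rw [Finset.sum_congr rfl fun m _ => Finset.sum_comm, Finset.sum_comm]
          refine Finset.sum_congr rfl fun h _ => ?_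
          simp only [Finset.sum_add_distrib]
      _ ≤ ∑ h ∈ Finset.Icc 1 M, ((H : ℝ) ^ (r - 1) * (H : ℝ) ^ r * s h + (H : ℝ) ^ (r - 1) * (H : ℝ) ^ r * s h) :=
          Finset.sum_le_sum fun h _ => add_le_add (hA h) (hB h)
      _ = _ := by rw [Finset.mul_sum]; exact Finset.sum_congr rfl fun h _ => by ring
  have hcs2 : (H : ℝ) ^ (2 * r) ≤ (M : ℝ) * ∑ m ∈ Finset.range M, c m ^ 2 := by
    have := sq_sum_le_card_mul_sum_sq (s := Finset.range M) (f := c)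
    rw [hcs, Finset.card_range, ← pow_mul, mul_comm r 2] at this
    exact this
  have hmain : (Fintype.card T : ℝ) * ∑ m ∈ Finset.range M, c m ^ 2
      ≤ Fintype.card T * (1 / (2 * Δ)) ^ (2 * r) + ‖E‖ := by
    have h1 : (((Fintype.card T : ℝ) * ∑ m ∈ Finset.range M, c m ^ 2 : ℝ) : ℂ)
        = ((∑ t, ‖F t‖ ^ 2 : ℝ) : ℂ) - E := by rw [hid, hsplit]; ring
    have h2 := norm_sub_le (((∑ t, ‖F t‖ ^ 2 : ℝ) : ℂ)) E
    rw [← h1, Complex.norm_real, Complex.norm_real, Real.norm_of_nonneg (by positivity),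
      Real.norm_of_nonneg (by positivity)] at h2
    refine h2.trans (add_le_add ?_ le_rfl)
    calc ∑ t, ‖F t‖ ^ 2 ≤ ∑ t : T, (1 / (2 * Δ)) ^ (2 * r) := Finset.sum_le_sum fun t _ => hFb t
      _ = _ := by rw [Finset.sum_const, Finset.card_univ, nsmul_eq_mul]
  obtain ⟨k, rfl⟩ : ∃ k, r = k + 1 := ⟨r - 1, by omega⟩
  have hK : (0 : ℝ) < (H : ℝ) ^ (2 * k + 1) := by positivity
  refine le_of_mul_le_mul_left ?_ hK
  have e1 : (H : ℝ) ^ (k + 1 - 1) * (H : ℝ) ^ (k + 1) = (H : ℝ) ^ (2 * k + 1) := by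
    rw [← pow_add]; congr 1; omega
  rw [e1] at hEb
  have e2 : (H : ℝ) ^ (2 * k + 1) * (1 / ((k + 1 : ℕ) : ℝ)) ≤ ∑ m ∈ Finset.range M, c m ^ 2 := by
    rw [mul_one_div, div_le_iff₀ hrpos]
    have : (M : ℝ) = ((k + 1 : ℕ) : ℝ) * H := by rw [hM]; push_cast; ring
    rw [this] at hcs2
    have e3 : (H : ℝ) ^ (2 * (k + 1)) = (H : ℝ) ^ (2 * k + 1) * H := by ring
    rw [e3] at hcs2
    refine le_of_mul_le_mul_right ?_ hHpos
    calc _ ≤ _ := hcs2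
      _ = _ := by ring
  have e4 : (H : ℝ) ^ (2 * k + 1) * (H * (1 / (2 * Δ * H)) ^ (2 * (k + 1))) = (1 / (2 * Δ)) ^ (2 * (k + 1)) := by
    have : (1 / (2 * Δ * H)) = (1 / (2 * Δ)) * (1 / H) := by field_simp
    rw [this, mul_pow]
    have h5 : (H : ℝ) ^ (2 * k + 1) * H * (1 / H) ^ (2 * (k + 1)) = 1 := by
      rw [← pow_succ, one_div, inv_pow, show 2 * k + 1 + 1 = 2 * (k + 1) by ring]
      exact mul_inv_cancel₀ (by positivity)
    calc _ = (1 / (2 * Δ)) ^ (2 * (k + 1)) * ((H : ℝ) ^ (2 * k + 1) * H * (1 / H) ^ (2 * (k + 1))) := by ring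
      _ = _ := by rw [h5, mul_one]
  have hT0 : (0 : ℝ) ≤ Fintype.card T := by positivity
  calc (H : ℝ) ^ (2 * k + 1) * ((Fintype.card T : ℝ) * (1 / ((k + 1 : ℕ) : ℝ) - H * (1 / (2 * Δ * H)) ^ (2 * (k + 1))))
      = (Fintype.card T : ℝ) * ((H : ℝ) ^ (2 * k + 1) * (1 / ((k + 1 : ℕ) : ℝ)))
        - Fintype.card T * ((H : ℝ) ^ (2 * k + 1) * (H * (1 / (2 * Δ * H)) ^ (2 * (k + 1)))) := by ring
    _ ≤ (Fintype.card T : ℝ) * (∑ m ∈ Finset.range M, c m ^ 2)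
        - Fintype.card T * (1 / (2 * Δ)) ^ (2 * (k + 1)) := by
        rw [e4]
        exact sub_le_sub_right (mul_le_mul_of_nonneg_left e2 hT0) _
    _ ≤ ‖E‖ := by linarith
    _ ≤ _ := hEb
    _ = _ := by ring

end SFP

namespace SFP
open Finset

lemma class_exists (N κ t : ℝ) (ht1 : t ≤ 1) (J : ℕ) : ∃ j : Fin (J + 1),
    t ≤ N ^ (-(κ * (j : ℕ))) ∧ ((j : ℕ) < J → N ^ (-(κ * ((j : ℕ) + 1))) ≤ t) := by
  classical
  have hne : ((Finset.univ : Finset (Fin (J + 1))).filter (fun j : Fin (J + 1) => t ≤ N ^ (-(κ * ((j : ℕ) : ℝ))))).Nonempty :=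
    ⟨0, by simp [ht1]⟩
  obtain ⟨j, hj, hmax⟩ := Finset.exists_max_image _ (fun j : Fin (J + 1) => (j : ℕ)) hne
  refine ⟨j, (Finset.mem_filter.1 hj).2, ?_⟩
  intro hlt
  by_contra hcon
  have := hmax ⟨(j : ℕ) + 1, by omega⟩ (by
    rw [Finset.mem_filter]
    refine ⟨Finset.mem_univ _, ?_⟩
    push_cast
    linarith)
  simp at this

lemma arc_step (β δ : ℝ) (ρ : ℚ) (h q : ℕ) (hh : 1 ≤ h) (hq : 1 ≤ q) (hnd : nd (h * β * q) ≤ δ)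
    (h1 : δ * ρ.den < 1 / 2) (h2 : q * h * |β - ρ| * ρ.den < 1 / 2) :
    ρ.den / Nat.gcd ρ.den h ≤ q ∧ ((ρ.den / Nat.gcd ρ.den h : ℕ) : ℝ) * h * |β - ρ| ≤ δ := by
  obtain ⟨a, ha⟩ := nd_exists (h * β * q)
  have hr : (0 : ℝ) < ρ.den := by exact_mod_cast ρ.den_pos
  have hρ : (ρ : ℝ) * ρ.den = ρ.num := by exact_mod_cast Rat.mul_den_eq_num ρ
  have hqh : (0 : ℝ) ≤ (q : ℝ) * h := by positivity
  have hk : |((q : ℝ) * h * ρ.num - a * ρ.den)| < 1 := by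
    have e : (q : ℝ) * h * ρ.num - a * ρ.den
        = (h * β * q - a) * ρ.den - q * h * (β - ρ) * ρ.den := by rw [← hρ]; ring
    rw [e]
    refine lt_of_le_of_lt (abs_sub _ _) ?_
    rw [abs_mul, abs_mul, abs_mul, abs_of_pos hr, abs_of_nonneg hqh, ← ha]
    have := mul_le_mul_of_nonneg_right hnd hr.le
    linarith
  have hz : (q : ℤ) * h * ρ.num = a * ρ.den := by
    have h3 : |(q : ℤ) * h * ρ.num - a * ρ.den| < 1 := by exact_mod_cast hk
    have := Int.abs_lt_one_iff.1 h3
    linarith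
  have hdvd : ρ.den ∣ q * h := by
    have h4 : (ρ.den : ℤ) ∣ ((q * h : ℕ) : ℤ) * ρ.num := ⟨a, by push_cast; linarith⟩
    have h5 : IsCoprime (ρ.den : ℤ) ρ.num := by
      rw [Int.isCoprime_iff_nat_coprime]
      simpa using ρ.reduced.symm
    exact_mod_cast h5.dvd_of_dvd_mul_right h4
  have hgpos : 0 < Nat.gcd ρ.den h := Nat.gcd_pos_of_pos_right _ (by omega)
  have hw : ρ.den / Nat.gcd ρ.den h ∣ q := by
    have hc := Nat.coprime_div_gcd_div_gcd hgpos
    refine hc.dvd_of_dvd_mul_right ?_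
    obtain ⟨x, hx⟩ := Nat.gcd_dvd_right ρ.den h
    obtain ⟨y, hy⟩ := Nat.gcd_dvd_left ρ.den h
    have ex : h / Nat.gcd ρ.den h = x := Nat.div_eq_of_eq_mul_right hgpos hx
    have ey : ρ.den / Nat.gcd ρ.den h = y := Nat.div_eq_of_eq_mul_right hgpos hy
    rw [ex, ey]
    refine Nat.dvd_of_mul_dvd_mul_left hgpos ?_
    rw [← hy]
    calc ρ.den ∣ q * h := hdvd
      _ = Nat.gcd ρ.den h * (q * x) := by nth_rewrite 1 [hx]; ring
  have hwq : ρ.den / Nat.gcd ρ.den h ≤ q := Nat.le_of_dvd (by omega) hw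
  refine ⟨hwq, ?_⟩
  have hwq' : ((ρ.den / Nat.gcd ρ.den h : ℕ) : ℝ) ≤ q := by exact_mod_cast hwq
  have hrr : (q : ℝ) * h * ρ = a := by
    have : (q : ℝ) * h * ρ.num = a * ρ.den := by exact_mod_cast hz
    rw [← hρ] at this
    have := mul_right_cancel₀ hr.ne' (by linarith : (q : ℝ) * h * ρ * ρ.den = a * ρ.den)
    exact this
  calc ((ρ.den / Nat.gcd ρ.den h : ℕ) : ℝ) * h * |β - ρ| ≤ (q : ℝ) * h * |β - ρ| := by gcongr
    _ = |h * β * q - a| := by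
        rw [← abs_of_nonneg hqh, ← abs_mul, ← hrr]
        congr 1; ring
    _ ≤ δ := by rw [← ha]; exact hnd

lemma weyl_step (J : ℕ) (κ : ℝ) (hκ : 0 < κ) (hκJ : 30 * κ * (J + 1) = 1) :
    ∃ N0 : ℕ, 2 ≤ N0 ∧ ∀ N : ℕ, N0 ≤ N → ((N : ℝ) ^ (1 - κ) ≤ ((N / 2 : ℕ) : ℝ)) ∧
      ∀ (β : ℝ) (ρ : ℚ), |β - ρ| ≤ 1 / (((N ^ 4 : ℕ) + 1) * ρ.den) → ρ.den ≤ N ^ 4 →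
      ∀ h : ℕ, 1 ≤ h → (h : ℝ) ≤ (N : ℝ) ^ 2 → ∀ j : ℕ, j < J →
      (N : ℝ) ^ (-(κ * (j + 1))) ≤ ‖TT (N / 2) (h * β)‖ / ((N / 2 : ℕ) : ℝ) ^ 2 →
      ((ρ.den / Nat.gcd ρ.den h : ℕ) : ℝ) ≤ (N : ℝ) ^ (30 * κ * (j + 1) + κ) ∧
      ((ρ.den / Nat.gcd ρ.den h : ℕ) : ℝ) * h * |β - ρ|
        ≤ (N : ℝ) ^ (30 * κ * (j + 1) + κ) / ((N / 2 : ℕ) : ℝ) ^ 6 := by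
  obtain ⟨L0, hL0, hweyl⟩ := weyl κ hκ
  obtain ⟨N1, hN1, hev⟩ := ev_const κ hκ 3
  refine ⟨N1 + 2 * L0 + 3000, by omega, ?_⟩
  intro N hN
  have hNr : (3000 : ℝ) ≤ N := by exact_mod_cast (by omega : 3000 ≤ N)
  have hNpos : (0 : ℝ) < N := by linarith
  have hN1' : (1 : ℝ) ≤ N := by linarith
  obtain ⟨L, hL⟩ : ∃ L, L = N / 2 := ⟨_, rfl⟩
  rw [← hL]
  have hLN : (N : ℝ) / 3 ≤ L := by
    have : N ≤ 3 * L := by omega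
    have : (N : ℝ) ≤ 3 * L := by exact_mod_cast this
    linarith
  have hLN' : (L : ℝ) ≤ N := by exact_mod_cast (by omega : L ≤ N)
  have hLpos : (0 : ℝ) < L := by linarith
  have h3 := hev N (by omega)
  have hfirst : (N : ℝ) ^ (1 - κ) ≤ (L : ℝ) := by
    refine le_trans ?_ hLN
    rw [Real.rpow_sub hNpos, Real.rpow_one]
    exact div_le_div_of_nonneg_left hNpos.le (by norm_num) h3.le
  refine ⟨hfirst, ?_⟩
  intro β ρ hρ hden h hh hh2 j hj hτ
  have hjJ : (j : ℝ) + 1 ≤ J := by exact_mod_cast hj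
  have hκjJ : 30 * κ * ((j : ℝ) + 1) ≤ 1 - 30 * κ := by nlinarith
  have hP1 : (1 : ℝ) ≤ (N : ℝ) ^ (κ * (j + 1)) := Real.one_le_rpow hN1' (by positivity)
  have hP30 : ((N : ℝ) ^ (κ * (j + 1))) ^ 30 = (N : ℝ) ^ (30 * κ * (j + 1)) := by
    rw [← Real.rpow_natCast, ← Real.rpow_mul hNpos.le]; congr 1; push_cast; ring
  have hQ : ((N : ℝ) ^ (κ * (j + 1))) ^ 30 * (L : ℝ) ^ κ ≤ (N : ℝ) ^ (30 * κ * (j + 1) + κ) := by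
    rw [hP30, Real.rpow_add hNpos]
    exact mul_le_mul_of_nonneg_left (Real.rpow_le_rpow hLpos.le hLN' hκ.le) (by positivity)
  have hQL : (N : ℝ) ^ (30 * κ * (j + 1) + κ) ≤ L := by
    refine le_trans ?_ hfirst
    exact Real.rpow_le_rpow_of_exponent_le hN1' (by linarith)
  have hTT : (L : ℝ) ^ 2 ≤ (N : ℝ) ^ (κ * (j + 1)) * ‖TT L (h * β)‖ := by
    rw [Real.rpow_neg hNpos.le, le_div_iff₀ (by positivity), inv_mul_le_iff₀ (by positivity)] at hτ
    exact hτ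
  obtain ⟨q, hq1, hq2, hq3⟩ := hweyl L (by omega) (h * β) _ hP1 (hQ.trans hQL) hTT
  have hδ : nd (h * β * q) ≤ (N : ℝ) ^ (30 * κ * (j + 1) + κ) / (L : ℝ) ^ 6 := by
    rw [le_div_iff₀ (by positivity)]
    exact hq3.trans hQ
  have hqQ := hq2.trans hQ
  obtain ⟨Q, hQdef⟩ : ∃ Q, Q = (N : ℝ) ^ (30 * κ * ((j : ℝ) + 1) + κ) := ⟨_, rfl⟩
  rw [← hQdef] at hδ hqQ hQL ⊢
  have hQN : Q ≤ N := hQL.trans hLN'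
  have hden' : (ρ.den : ℝ) ≤ (N : ℝ) ^ 4 := by exact_mod_cast hden
  have hdpos : (0 : ℝ) < ρ.den := by exact_mod_cast ρ.den_pos
  obtain ⟨ha, hb⟩ := arc_step β _ ρ h q hh hq1 hδ (by
      rw [div_mul_eq_mul_div, div_lt_iff₀ (by positivity)]
      calc Q * ρ.den ≤ (N : ℝ) * (N : ℝ) ^ 4 := mul_le_mul hQN hden' hdpos.le hNpos.le
        _ < 1 / 2 * ((N : ℝ) / 3) ^ 6 := by
            have : 0 < (N : ℝ) ^ 5 := by positivity
            have e : 1 / 2 * ((N : ℝ) / 3) ^ 6 = (N : ℝ) ^ 5 * (N / 1458) := by ring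
            rw [e]
            have : (1 : ℝ) < N / 1458 := by rw [lt_div_iff₀ (by norm_num)]; linarith
            nlinarith
        _ ≤ 1 / 2 * (L : ℝ) ^ 6 := by
            have := pow_le_pow_left₀ (by positivity) hLN 6
            linarith) (by
      rw [le_div_iff₀ (by positivity)] at hρ
      push_cast at hρ
      have h5 : (q : ℝ) * h ≤ (N : ℝ) ^ 3 := by
        calc (q : ℝ) * h ≤ (N : ℝ) * (N : ℝ) ^ 2 := mul_le_mul (hqQ.trans hQN) hh2 (by positivity) hNpos.le
          _ = _ := by ring
      have hx0 : 0 ≤ |β - ρ| * ρ.den := by positivity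
      have h6 : |β - ρ| * ρ.den * ((N : ℝ) ^ 4) ≤ 1 := by nlinarith
      have h7 : |β - ρ| * ρ.den * ((N : ℝ) ^ 3) * N ≤ 1 := by
        calc _ = |β - ρ| * ρ.den * ((N : ℝ) ^ 4) := by ring
          _ ≤ 1 := h6
      have h8 : 0 ≤ |β - ρ| * ρ.den * ((N : ℝ) ^ 3) := by positivity
      have h9 : |β - ρ| * ρ.den * ((N : ℝ) ^ 3) < 1 / 2 := by nlinarith
      calc (q : ℝ) * h * |β - ρ| * ρ.den = (q : ℝ) * h * (|β - ρ| * ρ.den) := by ring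
        _ ≤ (N : ℝ) ^ 3 * (|β - ρ| * ρ.den) := mul_le_mul_of_nonneg_right h5 hx0
        _ < 1 / 2 := by linarith)
  refine ⟨?_, hb⟩
  refine le_trans ?_ hqQ
  exact_mod_cast ha

lemma finish {ι : Type} [Fintype ι] (β : ι → ℝ) (ρ : ι → ℚ) (g w m : ι → ℕ) (G : ℕ) (hG : 1 ≤ G)
    (hgw : ∀ i, (ρ i).den = g i * w i) (hgG : ∀ i, g i ∣ G)
    (hdvd : (G : ℤ) ∣ ∑ i, ((ρ i).num * (G / g i : ℕ) * (w i : ℤ) ^ 5) * (m i : ℤ) ^ 6) :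
    nd (∑ i, β i * ((w i * m i : ℕ) : ℝ) ^ 6) ≤ ∑ i, |β i - ρ i| * ((w i * m i : ℕ) : ℝ) ^ 6 := by
  obtain ⟨c, hc⟩ := hdvd
  have hGpos : (0 : ℝ) < G := by exact_mod_cast hG
  have hcong : ∑ i, (ρ i : ℝ) * ((w i * m i : ℕ) : ℝ) ^ 6 = c := by
    have hc' : ∑ i, (((ρ i).num : ℝ) * ((G / g i : ℕ) : ℝ) * (w i : ℝ) ^ 5) * (m i : ℝ) ^ 6 = G * c := by
      have := congrArg (fun z : ℤ => (z : ℝ)) hc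
      push_cast at this
      exact this
    refine mul_left_cancel₀ hGpos.ne' ?_
    rw [← hc', Finset.mul_sum]
    refine Finset.sum_congr rfl fun i _ => ?_
    obtain ⟨k, hk⟩ := hgG i
    have hgp : 0 < g i := Nat.pos_of_dvd_of_pos (hgG i) (by omega)
    have hwp : 0 < w i := by
      rcases Nat.eq_zero_or_pos (w i) with h | h
      · have := hgw i
        rw [h, mul_zero] at this
        exact absurd this (ρ i).den_pos.ne'
      · exact h
    have hgp' : (0 : ℝ) < g i := by exact_mod_cast hgp
    have hwp' : (0 : ℝ) < w i := by exact_mod_cast hwp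
    rw [Nat.div_eq_of_eq_mul_right hgp hk]
    have e1 : (G : ℝ) = g i * k := by exact_mod_cast hk
    have e2 : (ρ i : ℝ) * (g i * w i) = (ρ i).num := by
      have : (ρ i : ℝ) * (ρ i).den = (ρ i).num := by exact_mod_cast Rat.mul_den_eq_num (ρ i)
      rw [hgw i] at this
      push_cast at this
      exact this
    rw [← e2, e1]
    push_cast
    ring
  refine (nd_le _ c).trans ?_
  rw [← hcong, ← Finset.sum_sub_distrib]
  refine (Finset.abs_sum_le_sum_abs _ _).trans (Finset.sum_le_sum fun i _ => ?_)
  rw [← sub_mul, abs_mul, abs_of_nonneg (by positivity : (0 : ℝ) ≤ ((w i * m i : ℕ) : ℝ) ^ 6)]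

end SFP

namespace SFP
open Finset

lemma pig (s : ℕ) (hs : s ≤ 56) (J : ℕ) (κ : ℝ) (hκ : 0 < κ) : ∃ N0 : ℕ, 2 ≤ N0 ∧ ∀ N : ℕ, N0 ≤ N →
    ∀ (den : Fin s → ℕ), (∀ i, 1 ≤ den i ∧ den i ≤ N ^ 4) → ∀ (τ : Fin s → ℕ → ℝ),
    (∀ i h, 0 ≤ τ i h ∧ τ i h ≤ 1) → ∀ H : ℕ, 1 ≤ (N : ℝ) ^ κ * ∑ h ∈ Finset.Icc 1 H, ∏ i, τ i h →
    ∃ (j : Fin s → Fin (J + 1)) (g : Fin s → ℕ) (B : Finset ℕ), B ⊆ Finset.Icc 1 H ∧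
      (∀ h ∈ B, ∀ i, Nat.gcd (den i) h = g i ∧
        ((j i : ℕ) < J → (N : ℝ) ^ (-(κ * ((j i : ℕ) + 1))) ≤ τ i h)) ∧
      (N : ℝ) ^ (∑ i, κ * ((j i : ℕ) : ℝ) - 57 * κ) ≤ (B.card : ℝ) := by
  classical
  obtain ⟨Cd, hCd1, hCd⟩ := divisor_bound (κ / 8) (by positivity)
  obtain ⟨N1, hN1, hev⟩ := ev_const (κ / 2) (by positivity) ((J + 1) * Cd)
  refine ⟨N1 + 2, by omega, ?_⟩
  intro N hN den hden τ hτ H hsum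
  have hNpos : (0 : ℝ) < N := by exact_mod_cast (by omega : 0 < N)
  have hN1' : (1 : ℝ) ≤ N := by exact_mod_cast (by omega : 1 ≤ N)
  choose jj hjj1 hjj2 using fun (i : Fin s) (h : ℕ) => class_exists N κ (τ i h) (hτ i h).2 J
  let key : ℕ → (Fin s → Fin (J + 1) × ℕ) := fun h i => (jj i h, Nat.gcd (den i) h)
  let keys : Finset (Fin s → Fin (J + 1) × ℕ) :=
    Fintype.piFinset (fun i => (Finset.univ : Finset (Fin (J + 1))) ×ˢ (den i).divisors)
  have hmaps : ∀ h ∈ Finset.Icc 1 H, key h ∈ keys := by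
    intro h _
    rw [Fintype.mem_piFinset]
    intro i
    rw [Finset.mem_product]
    refine ⟨Finset.mem_univ _, ?_⟩
    rw [Nat.mem_divisors]
    exact ⟨Nat.gcd_dvd_left _ _, by have := (hden i).1; omega⟩
  have hkeys_ne : keys.Nonempty := by
    refine ⟨fun i => (0, 1), ?_⟩
    rw [Fintype.mem_piFinset]
    intro i
    rw [Finset.mem_product]
    exact ⟨Finset.mem_univ _, by have := (hden i).1; simp; omega⟩
  have hcard : (keys.card : ℝ) ≤ (N : ℝ) ^ (56 * κ) := by
    have h1 : keys.card = ∏ i, ((J + 1) * (den i).divisors.card) := by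
      rw [Fintype.card_piFinset]
      exact Finset.prod_congr rfl fun i _ => by rw [Finset.card_product]; simp
    rw [h1]
    push_cast
    calc ∏ i, (((J : ℝ) + 1) * ((den i).divisors.card : ℝ)) ≤ ∏ i : Fin s, (N : ℝ) ^ κ := by
          refine Finset.prod_le_prod (fun i _ => by positivity) fun i _ => ?_
          have h2 := hCd (den i) (hden i).1
          have h3 : ((den i : ℕ) : ℝ) ^ (κ / 8) ≤ (N : ℝ) ^ (κ / 2) := by
            calc ((den i : ℕ) : ℝ) ^ (κ / 8) ≤ ((N : ℝ) ^ (4 : ℕ)) ^ (κ / 8) :=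
                  Real.rpow_le_rpow (by positivity) (by exact_mod_cast (hden i).2) (by positivity)
              _ = _ := by
                  rw [← Real.rpow_natCast, ← Real.rpow_mul hNpos.le]; congr 1; push_cast; ring
          calc ((J : ℝ) + 1) * ((den i).divisors.card : ℝ) ≤ ((J : ℝ) + 1) * (Cd * (N : ℝ) ^ (κ / 2)) := by
                refine mul_le_mul_of_nonneg_left ?_ (by positivity)
                exact h2.trans (mul_le_mul_of_nonneg_left h3 (by linarith))
            _ = ((J : ℝ) + 1) * Cd * (N : ℝ) ^ (κ / 2) := by ring
            _ ≤ (N : ℝ) ^ (κ / 2) * (N : ℝ) ^ (κ / 2) :=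
                mul_le_mul_of_nonneg_right (hev N (by omega)).le (by positivity)
            _ = _ := by rw [← Real.rpow_add hNpos]; ring_nf
      _ = (N : ℝ) ^ (κ * s) := by
          rw [Finset.prod_const, Finset.card_univ, Fintype.card_fin, Real.rpow_mul hNpos.le, Real.rpow_natCast]
      _ ≤ _ := by
          apply Real.rpow_le_rpow_of_exponent_le hN1'
          have : (s : ℝ) ≤ 56 := by exact_mod_cast hs
          nlinarith
  have hkpos : (0 : ℝ) < keys.card := by exact_mod_cast hkeys_ne.card_pos
  obtain ⟨k, hk, hkb⟩ := Finset.exists_le_sum_fiber_of_maps_to_of_nsmul_le_sum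
    (s := Finset.Icc 1 H) (w := fun h => ∏ i, τ i h) (f := key) (b := (N : ℝ) ^ (-(57 * κ))) hmaps hkeys_ne (by
      rw [nsmul_eq_mul]
      calc (keys.card : ℝ) * (N : ℝ) ^ (-(57 * κ)) ≤ (N : ℝ) ^ (56 * κ) * (N : ℝ) ^ (-(57 * κ)) :=
            mul_le_mul_of_nonneg_right hcard (by positivity)
        _ = (N : ℝ) ^ (-κ) := by rw [← Real.rpow_add hNpos]; ring_nf
        _ ≤ _ := by
            rw [Real.rpow_neg hNpos.le, inv_le_iff_one_le_mul₀ (by positivity), mul_comm]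
            exact hsum)
  refine ⟨fun i => (k i).1, fun i => (k i).2, (Finset.Icc 1 H).filter (fun h => key h = k),
    Finset.filter_subset _ _, ?_, ?_⟩
  · intro h hh i
    have hkey := (Finset.mem_filter.1 hh).2
    have e1 : jj i h = (k i).1 := by rw [← hkey]
    have e2 : Nat.gcd (den i) h = (k i).2 := by rw [← hkey]
    refine ⟨e2, ?_⟩
    have := hjj2 i h
    rw [e1] at this
    exact this
  · have h1 : ∀ h ∈ (Finset.Icc 1 H).filter (fun h => key h = k),
        ∏ i, τ i h ≤ (N : ℝ) ^ (-(∑ i, κ * (((k i).1 : ℕ) : ℝ))) := by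
      intro h hh
      have hkey := (Finset.mem_filter.1 hh).2
      rw [← Finset.sum_neg_distrib, Real.rpow_sum_of_pos hNpos]
      refine Finset.prod_le_prod (fun i _ => (hτ i h).1) fun i _ => ?_
      have e1 : jj i h = (k i).1 := by rw [← hkey]
      rw [← e1]
      exact hjj1 i h
    have h2 := hkb.trans (Finset.sum_le_card_nsmul _ _ _ h1)
    rw [nsmul_eq_mul, Real.rpow_neg hNpos.le (∑ i, κ * (((k i).1 : ℕ) : ℝ)), ← div_eq_mul_inv,
      le_div_iff₀ (by positivity), ← Real.rpow_add hNpos] at h2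
    refine le_trans (le_of_eq ?_) h2
    congr 1
    ring

lemma mult_card (B : Finset ℕ) (G h0 : ℕ) (hG : 1 ≤ G) (hB : ∀ h ∈ B, 1 ≤ h ∧ h ≤ h0 ∧ G ∣ h) :
    (B.card : ℝ) * G ≤ h0 := by
  have h1 : B ⊆ (Finset.Ioc 0 h0).filter (fun h => G ∣ h) := by
    intro h hh
    obtain ⟨a, b, c⟩ := hB h hh
    rw [Finset.mem_filter, Finset.mem_Ioc]
    exact ⟨⟨by omega, b⟩, c⟩
  have h2 := Finset.card_le_card h1
  rw [Nat.Ioc_filter_dvd_card_eq_div] at h2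
  have h3 : B.card * G ≤ h0 := (Nat.mul_le_mul_right G h2).trans (Nat.div_mul_le_self h0 G)
  exact_mod_cast h3

end SFP

namespace SFP
open Finset

lemma size_bound (s : ℕ) (hs : s ≤ 56) (J : ℕ) (κ : ℝ) (hκ : 0 < κ) (hκJ : 30 * κ * (J + 1) = 1)
    (N L t : ℝ) (hN : 1 ≤ N) (hL : N ^ (1 - κ) ≤ L) (ht0 : 0 < t) (ht1 : t ≤ 1) (j : Fin s → Fin (J + 1)) :
    t * N ^ ((s : ℝ) / 30 - (∑ i, κ * ((j i : ℕ) : ℝ)) - 112 * κ) ≤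
      ∏ i : {i : Fin s // (j i : ℕ) < J},
        (L / N ^ (30 * κ * (((j i.1 : ℕ) : ℝ) + 1) + κ) * t ^ (1 / 6 : ℝ)) ^ (1 / 30 : ℝ) := by
  classical
  have hNpos : 0 < N := by linarith
  have hLpos : 0 < L := lt_of_lt_of_le (by positivity) hL
  have hsub : ∏ i : {i : Fin s // (j i : ℕ) < J},
        (L / N ^ (30 * κ * (((j i.1 : ℕ) : ℝ) + 1) + κ) * t ^ (1 / 6 : ℝ)) ^ (1 / 30 : ℝ)
      = ∏ i, (if (j i : ℕ) < J then
        (L / N ^ (30 * κ * (((j i : ℕ) : ℝ) + 1) + κ) * t ^ (1 / 6 : ℝ)) ^ (1 / 30 : ℝ) else 1) := by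
    rw [← Finset.prod_filter]
    rw [Finset.prod_subtype (p := fun i => (j i : ℕ) < J) _ (by intro x; simp)
      (fun i => (L / N ^ (30 * κ * (((j i : ℕ) : ℝ) + 1) + κ) * t ^ (1 / 6 : ℝ)) ^ (1 / 30 : ℝ))]
  rw [hsub]
  have hterm : ∀ i, N ^ ((1 / 30 : ℝ) - κ * ((j i : ℕ) : ℝ) - 2 * κ) * t ^ (1 / 180 : ℝ) ≤ (if (j i : ℕ) < J then
        (L / N ^ (30 * κ * (((j i : ℕ) : ℝ) + 1) + κ) * t ^ (1 / 6 : ℝ)) ^ (1 / 30 : ℝ) else 1) := by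
    intro i
    split_ifs with hj
    · rw [Real.mul_rpow (by positivity) (by positivity), ← Real.rpow_mul ht0.le]
      refine mul_le_mul ?_ (le_of_eq (by norm_num)) (by positivity) (by positivity)
      have h1 : N ^ (1 - κ - (30 * κ * (((j i : ℕ) : ℝ) + 1) + κ)) ≤ L / N ^ (30 * κ * (((j i : ℕ) : ℝ) + 1) + κ) := by
        rw [Real.rpow_sub hNpos]
        exact div_le_div_of_nonneg_right hL (by positivity)
      refine le_trans ?_ (Real.rpow_le_rpow (by positivity) h1 (by norm_num))
      rw [← Real.rpow_mul hNpos.le]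
      apply Real.rpow_le_rpow_of_exponent_le hN
      nlinarith
    · have hjJ : ((j i : ℕ) : ℝ) = J := by
        have := (j i).2
        exact_mod_cast (by omega : (j i : ℕ) = J)
      refine mul_le_one₀ ?_ (by positivity) (Real.rpow_le_one ht0.le ht1 (by norm_num))
      apply Real.rpow_le_one_of_one_le_of_nonpos hN
      rw [hjJ]
      nlinarith
  have hs' : (s : ℝ) ≤ 56 := by exact_mod_cast hs
  calc t * N ^ ((s : ℝ) / 30 - (∑ i, κ * ((j i : ℕ) : ℝ)) - 112 * κ)
      ≤ t ^ ((1 / 180 : ℝ) * s) * N ^ ((s : ℝ) / 30 - (∑ i, κ * ((j i : ℕ) : ℝ)) - 2 * κ * s) := by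
        refine mul_le_mul ?_ ?_ (by positivity) (by positivity)
        · calc t = t ^ (1 : ℝ) := (Real.rpow_one t).symm
            _ ≤ _ := Real.rpow_le_rpow_of_exponent_ge ht0 ht1 (by linarith)
        · apply Real.rpow_le_rpow_of_exponent_le hN
          nlinarith
    _ = ∏ i, (N ^ ((1 / 30 : ℝ) - κ * ((j i : ℕ) : ℝ) - 2 * κ) * t ^ (1 / 180 : ℝ)) := by
        rw [Finset.prod_mul_distrib, Finset.prod_const, Finset.card_univ, Fintype.card_fin,
          Real.rpow_mul ht0.le, Real.rpow_natCast, mul_comm]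
        congr 1
        rw [← Real.rpow_sum_of_pos hNpos]
        congr 1
        rw [Finset.sum_sub_distrib, Finset.sum_sub_distrib]
        simp only [Finset.sum_const, Finset.card_univ, Fintype.card_fin, nsmul_eq_mul]
        ring
    _ ≤ _ := Finset.prod_le_prod (fun i _ => by positivity) fun i _ => hterm i

lemma err_bound (e w m Q L h H : ℝ) (he : 0 ≤ e) (hw : 0 ≤ w) (hm : 0 ≤ m) (hQ : 0 < Q) (hL : 0 < L) (hh : 0 < h)
    (hH : 0 < H) (hwQ : w ≤ Q) (hew : w * h * e ≤ Q / L ^ 6) (hmX : m ≤ L / Q * (h / H) ^ (1 / 6 : ℝ)) :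
    e * (w * m) ^ 6 ≤ 1 / H := by
  have h1 : m ^ 6 ≤ (L / Q) ^ 6 * (h / H) := by
    calc m ^ 6 ≤ (L / Q * (h / H) ^ (1 / 6 : ℝ)) ^ 6 := pow_le_pow_left₀ hm hmX 6
      _ = _ := by
          rw [mul_pow, ← Real.rpow_natCast ((h / H) ^ (1 / 6 : ℝ)), ← Real.rpow_mul (by positivity)]
          norm_num
  have h2 : w ^ 5 ≤ Q ^ 5 := pow_le_pow_left₀ hw hwQ 5
  calc e * (w * m) ^ 6 = (w * e) * (w ^ 5 * m ^ 6) := by ring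
    _ ≤ (w * e) * (Q ^ 5 * ((L / Q) ^ 6 * (h / H))) := by
        refine mul_le_mul_of_nonneg_left ?_ (by positivity)
        exact mul_le_mul h2 h1 (by positivity) (by positivity)
    _ = (w * h * e) * (Q ^ 5 * (L / Q) ^ 6 / H) := by ring
    _ ≤ (Q / L ^ 6) * (Q ^ 5 * (L / Q) ^ 6 / H) := mul_le_mul_of_nonneg_right hew (by positivity)
    _ = 1 / H := by field_simp

lemma modular (s : ℕ) (hs : s ≤ 56) (ε : ℝ) (hε : 0 < ε) : ∃ κ : ℝ, 0 < κ ∧ ∃ N0 : ℕ, 2 ≤ N0 ∧ ∀ N : ℕ, N0 ≤ N →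
    ∀ (β : Fin s → ℝ) (H : ℕ), 1 ≤ H → (H : ℝ) ≤ (N : ℝ) ^ ((s : ℝ) / 30 - ε / 2) →
    1 ≤ (N : ℝ) ^ κ * ∑ h ∈ Finset.Icc 1 H, ∏ i, (‖TT (N / 2) (h * β i)‖ / ((N / 2 : ℕ) : ℝ) ^ 2) →
    ∃ n : Fin s → ℕ, (∃ i, n i ≠ 0) ∧ (∀ i, n i ≤ N) ∧ nd (∑ i, β i * (n i : ℝ) ^ 6) ≤ 56 / H := by
  classical
  obtain ⟨J, hJ⟩ := exists_nat_ge (30 / ε)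
  obtain ⟨κ, hκdef⟩ : ∃ κ : ℝ, κ = 1 / (30 * (J + 1)) := ⟨_, rfl⟩
  have hκ : 0 < κ := by rw [hκdef]; positivity
  have hκJ : 30 * κ * (J + 1) = 1 := by rw [hκdef]; field_simp
  have hκε : 169 * κ ≤ ε / 4 := by
    rw [div_le_iff₀ hε] at hJ
    nlinarith
  refine ⟨κ, hκ, ?_⟩
  obtain ⟨N1, hN1, hweyl⟩ := weyl_step J κ hκ hκJ
  obtain ⟨N2, hN2, hpig⟩ := pig s hs J κ hκ
  obtain ⟨N3, hN3, hml⟩ := ml (ε / 4) (by positivity)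
  refine ⟨N1 + N2 + N3, by omega, ?_⟩
  intro N hN β H hH hHN hsum
  have hNpos : (0 : ℝ) < N := by exact_mod_cast (by omega : 0 < N)
  have hN1' : (1 : ℝ) ≤ N := by exact_mod_cast (by omega : 1 ≤ N)
  have hNnat : 0 < N ^ 4 := by have : 0 < N := by omega
                               positivity
  have hs' : (s : ℝ) ≤ 56 := by exact_mod_cast hs
  have hHpos : (0 : ℝ) < H := by exact_mod_cast hH
  choose ρ hρ1 hρ2 using fun i => Real.exists_rat_abs_sub_le_and_den_le (β i) hNnat
  obtain ⟨hLN, hweyl'⟩ := hweyl N (by omega)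
  obtain ⟨j, g, B, hBs, hBp, hBc⟩ := hpig N (by omega) (fun i => (ρ i).den) (fun i => ⟨(ρ i).den_pos, hρ2 i⟩)
    (fun i h => ‖TT (N / 2) (h * β i)‖ / ((N / 2 : ℕ) : ℝ) ^ 2)
    (fun i h => ⟨by positivity, div_le_one_of_le₀ (TT_triv _ _) (by positivity)⟩) H hsum
  obtain ⟨L, hLdef⟩ : ∃ L : ℕ, L = N / 2 := ⟨_, rfl⟩
  rw [← hLdef] at hLN hweyl' hBp
  have hLpos : (0 : ℝ) < L := lt_of_lt_of_le (by positivity) hLN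
  have hLN2 : (L : ℝ) ≤ N := by exact_mod_cast (by omega : L ≤ N)
  have hBne : B.Nonempty := by
    rw [← Finset.card_pos]
    have : (0 : ℝ) < B.card := lt_of_lt_of_le (by positivity) hBc
    exact_mod_cast this
  obtain ⟨h0, h0B, hmax⟩ := Finset.exists_max_image B id hBne
  have h0H := Finset.mem_Icc.1 (hBs h0B)
  have h0pos : (0 : ℝ) < h0 := by exact_mod_cast h0H.1
  have h0H' : (h0 : ℝ) ≤ H := by exact_mod_cast h0H.2
  have hHN2 : (H : ℝ) ≤ (N : ℝ) ^ 2 := by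
    refine hHN.trans ?_
    rw [← Real.rpow_natCast]
    apply Real.rpow_le_rpow_of_exponent_le hN1'
    push_cast
    linarith
  let I := {i : Fin s // (j i : ℕ) < J}
  obtain ⟨G, hGdef⟩ : ∃ G : ℕ, G = (Finset.univ : Finset I).lcm (fun i => g i.1) := ⟨_, rfl⟩
  have hGdvd : ∀ h ∈ B, G ∣ h := by
    intro h hh
    rw [hGdef]
    refine Finset.lcm_dvd fun i _ => ?_
    rw [← (hBp h hh i.1).1]
    exact Nat.gcd_dvd_right _ _
  have hgG : ∀ i : I, g i.1 ∣ G := fun i => by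
    rw [hGdef]; exact Finset.dvd_lcm (Finset.mem_univ i)
  have hG1 : 1 ≤ G := Nat.pos_of_dvd_of_pos (hGdvd h0 h0B) (by omega)
  have hcardG := mult_card B G h0 hG1 (fun h hh => ⟨(Finset.mem_Icc.1 (hBs hh)).1, hmax h hh, hGdvd h hh⟩)
  obtain ⟨w, hwdef⟩ : ∃ w : I → ℕ, w = fun i => (ρ i.1).den / g i.1 := ⟨_, rfl⟩
  have hgden : ∀ i, g i ∣ (ρ i).den := fun i => by
    rw [← (hBp h0 h0B i).1]; exact Nat.gcd_dvd_left _ _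
  obtain ⟨Q, hQdef⟩ : ∃ Q : I → ℝ, Q = fun i => (N : ℝ) ^ (30 * κ * (((j i.1 : ℕ) : ℝ) + 1) + κ) := ⟨_, rfl⟩
  have hQpos : ∀ i, 0 < Q i := fun i => by rw [hQdef]; positivity
  have hQ1 : ∀ i, 1 ≤ Q i := fun i => by rw [hQdef]; exact Real.one_le_rpow hN1' (by positivity)
  have hfac : ∀ i : I, (w i : ℝ) ≤ Q i ∧ (w i : ℝ) * h0 * |β i.1 - ρ i.1| ≤ Q i / (L : ℝ) ^ 6 := by
    intro i
    have := hweyl' (β i.1) (ρ i.1) (hρ1 i.1) (hρ2 i.1) h0 h0H.1 (h0H'.trans hHN2) (j i.1) i.2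
      ((hBp h0 h0B i.1).2 i.2)
    rw [(hBp h0 h0B i.1).1] at this
    rw [hwdef, hQdef]
    exact this
  have ht0 : 0 < (h0 : ℝ) / H := by positivity
  have ht1 : (h0 : ℝ) / H ≤ 1 := div_le_one_of_le₀ h0H' hHpos.le
  have hsize := size_bound s hs J κ hκ hκJ N L (h0 / H) hN1' hLN ht0 ht1 j
  have hX1 : ∀ i : I, L / Q i * ((h0 : ℝ) / H) ^ (1 / 6 : ℝ) ≤ L / Q i := fun i =>
    mul_le_of_le_one_right (by have := hQpos i; positivity) (Real.rpow_le_one ht0.le ht1 (by norm_num))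
  obtain ⟨m, ⟨i0, hi0⟩, hm1, hm2⟩ := hml N (by omega) I
    ((Fintype.card_subtype_le _).trans (by simpa using hs))
    (fun i => L / Q i * ((h0 : ℝ) / H) ^ (1 / 6 : ℝ))
    (fun i => (ρ i.1).num * (G / g i.1 : ℕ) * (w i : ℤ) ^ 5) G hG1
    (fun i => ⟨by have := hQpos i; positivity,
      (hX1 i).trans ((div_le_self hLpos.le (hQ1 i)).trans hLN2)⟩) (by
      rw [hQdef]
      refine le_trans ?_ (mul_le_mul_of_nonneg_right hsize (by positivity))
      obtain ⟨σ, hσ⟩ : ∃ σ, σ = ∑ i, κ * ((j i : ℕ) : ℝ) := ⟨_, rfl⟩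
      rw [← hσ] at hBc ⊢
      have h1 : (G : ℝ) * (N : ℝ) ^ (σ - 57 * κ) ≤ h0 := by
        refine le_trans ?_ hcardG
        rw [mul_comm (B.card : ℝ)]
        exact mul_le_mul_of_nonneg_left hBc (by positivity)
      have h2 : (H : ℝ) ≤ (N : ℝ) ^ ((s : ℝ) / 30 - σ - 112 * κ - ε / 4 + (σ - 57 * κ)) :=
        hHN.trans (Real.rpow_le_rpow_of_exponent_le hN1' (by linarith))
      have h3 : (G : ℝ) * H ≤ h0 * (N : ℝ) ^ ((s : ℝ) / 30 - σ - 112 * κ - ε / 4) := by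
        calc (G : ℝ) * H ≤ (G : ℝ) * (N : ℝ) ^ ((s : ℝ) / 30 - σ - 112 * κ - ε / 4 + (σ - 57 * κ)) :=
              mul_le_mul_of_nonneg_left h2 (by positivity)
          _ = ((G : ℝ) * (N : ℝ) ^ (σ - 57 * κ)) * (N : ℝ) ^ ((s : ℝ) / 30 - σ - 112 * κ - ε / 4) := by
              rw [Real.rpow_add hNpos]; ring
          _ ≤ _ := mul_le_mul_of_nonneg_right h1 (by positivity)
      rw [mul_assoc, ← Real.rpow_add hNpos, div_mul_eq_mul_div, le_div_iff₀ hHpos]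
      exact h3)
  have hnb : ∀ i : I, ((w i : ℝ) * m i) ≤ N := by
    intro i
    calc (w i : ℝ) * m i ≤ Q i * (L / Q i) :=
          mul_le_mul (hfac i).1 ((hm1 i).trans (hX1 i)) (by positivity) (hQpos i).le
      _ = L := by have := (hQpos i).ne'; field_simp
      _ ≤ N := hLN2
  have hfin := finish (fun i : I => β i.1) (fun i => ρ i.1) (fun i => g i.1) w m G hG1
    (fun i => by rw [hwdef]; exact (Nat.mul_div_cancel' (hgden i.1)).symm) hgG hm2
  refine ⟨fun i => if h : (j i : ℕ) < J then w ⟨i, h⟩ * m ⟨i, h⟩ else 0, ?_, ?_, ?_⟩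
  · refine ⟨i0.1, ?_⟩
    beta_reduce
    rw [dif_pos i0.2]
    have h1 : 0 < w i0 := by
      rw [hwdef]
      have hd := hgden i0.1
      exact Nat.div_pos (Nat.le_of_dvd (ρ i0.1).den_pos hd) (Nat.pos_of_dvd_of_pos hd (ρ i0.1).den_pos)
    have h2 : 0 < m i0 := Nat.pos_of_ne_zero hi0
    exact (Nat.mul_pos h1 h2).ne'
  · intro i
    beta_reduce
    split_ifs with h
    · exact_mod_cast hnb ⟨i, h⟩
    · omega
  · have hsumeq : ∑ i, β i * (((if h : (j i : ℕ) < J then w ⟨i, h⟩ * m ⟨i, h⟩ else 0 : ℕ)) : ℝ) ^ 6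
        = ∑ i : I, β i.1 * ((w i * m i : ℕ) : ℝ) ^ 6 := by
      symm
      have h0' : ∀ i ∈ (Finset.univ : Finset (Fin s)), i ∉ Finset.univ.filter (fun i => (j i : ℕ) < J) →
          β i * (((if h : (j i : ℕ) < J then w ⟨i, h⟩ * m ⟨i, h⟩ else 0 : ℕ)) : ℝ) ^ 6 = 0 := by
        intro i _ hi
        have : ¬ (j i : ℕ) < J := by simpa using hi
        rw [dif_neg this]; simp
      rw [← Finset.sum_subset (Finset.subset_univ _) h0']
      rw [Finset.sum_subtype (p := fun i => (j i : ℕ) < J) _ (by intro x; simp)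
        (fun i => β i * (((if h : (j i : ℕ) < J then w ⟨i, h⟩ * m ⟨i, h⟩ else 0 : ℕ)) : ℝ) ^ 6)]
      refine Finset.sum_congr rfl ?_
      rintro ⟨i, hi⟩ _
      simp only [dif_pos hi]
    rw [hsumeq]
    refine hfin.trans ?_
    calc ∑ i : I, |β i.1 - ρ i.1| * ((w i * m i : ℕ) : ℝ) ^ 6 ≤ ∑ i : I, 1 / (H : ℝ) := by
          refine Finset.sum_le_sum fun i _ => ?_
          push_cast
          exact err_bound _ _ _ (Q i) L h0 H (abs_nonneg _) (by positivity) (by positivity) (hQpos i) hLpos h0pos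
            hHpos (hfac i).1 (hfac i).2 (hm1 i)
      _ = (Fintype.card I : ℝ) * (1 / H) := by rw [Finset.sum_const, Finset.card_univ, nsmul_eq_mul]
      _ ≤ 56 * (1 / H) := by
          refine mul_le_mul_of_nonneg_right ?_ (by positivity)
          have : Fintype.card I ≤ 56 := (Fintype.card_subtype_le _).trans (by simpa using hs)
          exact_mod_cast this
      _ = _ := by ring

end SFP

namespace SFP
open Finset

lemma main_case (s : ℕ) (hs1 : 1 ≤ s) (hs : s ≤ 56) (ε : ℝ) (hε : 0 < ε) (hεs : ε < (s : ℝ) / 30) :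
    ∃ N0 : ℕ, ∀ (β : Fin s → ℝ) (N : ℕ), N0 ≤ N → ∃ n : Fin s → ℕ, (∀ i, n i ≤ N) ∧ n ≠ 0 ∧
      nd (∑ i, β i * (n i : ℝ) ^ 6) ≤ (N : ℝ) ^ (-((s : ℝ) / 30) + ε) := by
  classical
  obtain ⟨κ, hκ, N1, hN1, hmod⟩ := modular s hs ε hε
  obtain ⟨r, hr⟩ := exists_nat_ge (8 / ε)
  have hrε : 8 ≤ r * ε := by rwa [div_le_iff₀ hε] at hr
  have hrpos : (0 : ℝ) < r := lt_of_lt_of_le (by positivity) hr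
  have hr1 : 1 ≤ r := by exact_mod_cast hrpos
  obtain ⟨N2, hN2, hev2⟩ := ev_const (ε / 4) (by positivity) (2 * r)
  obtain ⟨N3, hN3, hev3⟩ := ev_const (ε / 4) (by positivity) 56
  obtain ⟨N4, hN4, hev4⟩ := ev_const κ hκ (4 * r)
  refine ⟨N1 + N2 + N3 + N4 + 2 * r, ?_⟩
  intro β N hN
  have hNpos : (0 : ℝ) < N := by exact_mod_cast (by omega : 0 < N)
  have hN1' : (1 : ℝ) ≤ N := by exact_mod_cast (by omega : 1 ≤ N)
  have hs' : (s : ℝ) ≤ 56 := by exact_mod_cast hs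
  obtain ⟨Δ, hΔ⟩ : ∃ Δ : ℝ, Δ = (N : ℝ) ^ (-((s : ℝ) / 30) + ε) := ⟨_, rfl⟩
  rw [← hΔ]
  have hΔpos : 0 < Δ := by rw [hΔ]; positivity
  by_contra hcon
  push Not at hcon
  obtain ⟨x, hx⟩ : ∃ x : ℝ, x = (N : ℝ) ^ ((s : ℝ) / 30 - 3 * ε / 4) := ⟨_, rfl⟩
  have hx1 : 1 ≤ x := by rw [hx]; exact Real.one_le_rpow hN1' (by linarith)
  have hxΔ : x * Δ = (N : ℝ) ^ (ε / 4) := by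
    rw [hx, hΔ, ← Real.rpow_add hNpos]; ring_nf
  obtain ⟨H, hHdef⟩ : ∃ H : ℕ, H = ⌈x⌉₊ := ⟨_, rfl⟩
  have hxH : x ≤ H := by rw [hHdef]; exact Nat.le_ceil x
  have hHx : (H : ℝ) ≤ 2 * x := by
    have := Nat.ceil_lt_add_one (by linarith : 0 ≤ x)
    rw [← hHdef] at this
    linarith
  have hHpos : (0 : ℝ) < H := by linarith
  have hH1 : 1 ≤ H := by exact_mod_cast hHpos
  have hrH : ((r * H : ℕ) : ℝ) ≤ (N : ℝ) ^ ((s : ℝ) / 30 - ε / 2) := by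
    push_cast
    calc (r : ℝ) * H ≤ r * (2 * x) := mul_le_mul_of_nonneg_left hHx hrpos.le
      _ = (2 * r) * x := by ring
      _ ≤ (N : ℝ) ^ (ε / 4) * x := mul_le_mul_of_nonneg_right (hev2 N (by omega)).le (by linarith)
      _ = _ := by rw [hx, ← Real.rpow_add hNpos]; ring_nf
  have hHN2 : (H : ℝ) ≤ (N : ℝ) ^ 2 := by
    calc (H : ℝ) ≤ ((r * H : ℕ) : ℝ) := by exact_mod_cast Nat.le_mul_of_pos_left H hr1
      _ ≤ _ := hrH
      _ ≤ (N : ℝ) ^ (2 : ℝ) := Real.rpow_le_rpow_of_exponent_le hN1' (by linarith)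
      _ = _ := by norm_num
  obtain ⟨L, hL⟩ : ∃ L : ℕ, L = N / 2 := ⟨_, rfl⟩
  have hLpos : (0 : ℝ) < L := by exact_mod_cast (by omega : 0 < L)
  let T := ∀ _ : Fin s, Fin L × Fin L
  let nn : T → Fin s → ℕ := fun t i => ((t i).2 : ℕ) + ((t i).1 : ℕ) + 1
  have hθ : ∀ t : T, Δ ≤ nd (∑ i, β i * ((nn t i : ℕ) : ℝ) ^ 6) := by
    intro t
    refine (hcon (nn t) ?_ ?_).le
    · intro i
      have h1 := (t i).1.2
      have h2 := (t i).2.2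
      show ((t i).2 : ℕ) + ((t i).1 : ℕ) + 1 ≤ N
      omega
    · intro h0
      have := congrFun h0 ⟨0, by omega⟩
      simp [nn] at this
  have hdet := detect (fun t : T => ∑ i, β i * ((nn t i : ℕ) : ℝ) ^ 6) Δ hΔpos hθ H r hH1 hr1
  have hsmall : (H : ℝ) * (1 / (2 * Δ * H)) ^ (2 * r) ≤ 1 / (2 * r) := by
    have h1 : 1 / (2 * Δ * H) ≤ (N : ℝ) ^ (-(ε / 4)) := by
      rw [Real.rpow_neg hNpos.le, ← hxΔ, one_div]
      apply inv_anti₀ (by positivity)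
      nlinarith
    have h2 : (1 / (2 * Δ * H)) ^ (2 * r) ≤ (N : ℝ) ^ (-(4 : ℝ)) := by
      calc (1 / (2 * Δ * H)) ^ (2 * r) ≤ ((N : ℝ) ^ (-(ε / 4))) ^ (2 * r) :=
            pow_le_pow_left₀ (by positivity) h1 _
        _ = (N : ℝ) ^ (-(r * ε / 2)) := by
            rw [← Real.rpow_natCast, ← Real.rpow_mul hNpos.le]; congr 1; push_cast; ring
        _ ≤ _ := Real.rpow_le_rpow_of_exponent_le hN1' (by linarith)
    have h3 : (N : ℝ) ^ (-(4 : ℝ)) = ((N : ℝ) ^ 4)⁻¹ := by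
      rw [Real.rpow_neg hNpos.le]; norm_num
    have h4 : (2 * r : ℝ) ≤ N := by exact_mod_cast (by omega : 2 * r ≤ N)
    calc (H : ℝ) * (1 / (2 * Δ * H)) ^ (2 * r) ≤ (N : ℝ) ^ 2 * ((N : ℝ) ^ 4)⁻¹ := by
          rw [← h3]; exact mul_le_mul hHN2 h2 (by positivity) (by positivity)
      _ = ((N : ℝ) ^ 2)⁻¹ := by field_simp
      _ ≤ 1 / (2 * r) := by
          rw [one_div]
          apply inv_anti₀ (by positivity)
          nlinarith
  have hcard : (Fintype.card T : ℝ) = ((L : ℝ) ^ 2) ^ s := by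
    simp [T, Fintype.card_prod, sq]
  have hsumT : ∀ h : ℕ, ‖∑ t : T, ee ((h : ℝ) * ∑ i, β i * ((nn t i : ℕ) : ℝ) ^ 6)‖
      = ((L : ℝ) ^ 2) ^ s * ∏ i, (‖TT L (h * β i)‖ / (L : ℝ) ^ 2) := by
    intro h
    have h1 := TT_prod (fun _ : Fin s => L) (fun i => (h : ℝ) * β i)
    have h2 : ∑ t : T, ee ((h : ℝ) * ∑ i, β i * ((nn t i : ℕ) : ℝ) ^ 6) = ∏ i, TT L (h * β i) := by
      rw [← h1]
      refine Finset.sum_congr rfl fun t _ => ?_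
      congr 1
      rw [Finset.mul_sum]
      exact Finset.sum_congr rfl fun i _ => by rw [← mul_assoc]
    rw [h2, norm_prod, Finset.prod_div_distrib, Finset.prod_const, Finset.card_univ, Fintype.card_fin]
    field_simp
  rw [hcard, Finset.sum_congr rfl fun h _ => hsumT h, ← Finset.mul_sum] at hdet
  obtain ⟨Sg, hSg⟩ : ∃ S : ℝ, S = ∑ h ∈ Finset.Icc 1 (r * H), ∏ i, (‖TT L (h * β i)‖ / (L : ℝ) ^ 2) := ⟨_, rfl⟩
  rw [← hSg] at hdet
  have hSg0 : 0 ≤ Sg := by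
    rw [hSg]
    exact Finset.sum_nonneg fun h _ => Finset.prod_nonneg fun i _ => by positivity
  have hLs : 0 < ((L : ℝ) ^ 2) ^ s := by positivity
  have h5 : 1 / (r : ℝ) - H * (1 / (2 * Δ * H)) ^ (2 * r) ≤ 2 * Sg := by
    refine le_of_mul_le_mul_left ?_ hLs
    calc _ ≤ _ := hdet
      _ = _ := by ring
  have h6 : 1 / (2 * r : ℝ) ≤ 2 * Sg := by
    have : 1 / (r : ℝ) = 1 / (2 * r) + 1 / (2 * r) := by field_simp; norm_num
    linarith
  have h7 : 1 ≤ 4 * r * Sg := by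
    rw [div_le_iff₀ (by positivity)] at h6
    linarith
  have h8 : 1 ≤ (N : ℝ) ^ κ * Sg :=
    h7.trans (mul_le_mul_of_nonneg_right (hev4 N (by omega)).le hSg0)
  rw [hSg, hL] at h8
  obtain ⟨n, ⟨i, hi⟩, hn1, hn2⟩ := hmod N (by omega) β (r * H) (Nat.mul_pos hr1 hH1) hrH h8
  have h9 := hcon n hn1 (fun h0 => hi (by rw [h0]; rfl))
  have h10 : 56 / ((r * H : ℕ) : ℝ) ≤ Δ := by
    rw [div_le_iff₀ (by exact_mod_cast Nat.mul_pos hr1 hH1)]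
    calc (56 : ℝ) ≤ (N : ℝ) ^ (ε / 4) := (hev3 N (by omega)).le
      _ = x * Δ := hxΔ.symm
      _ ≤ H * Δ := mul_le_mul_of_nonneg_right hxH hΔpos.le
      _ ≤ Δ * ((r * H : ℕ) : ℝ) := by
          rw [mul_comm]
          refine mul_le_mul_of_nonneg_left ?_ hΔpos.le
          exact_mod_cast Nat.le_mul_of_pos_left H hr1
  linarith

end SFP

/-- **Theorem 3, special case (Baker).** Let `1 ≤ s ≤ 56` and `ε > 0`. There is a
constant `C > 0` (depending only on `s` and `ε`) such that for all sufficiently large `N`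
and all real `β₁, …, β_s` there exist integers `0 ≤ nᵢ ≤ N`, not all zero, with
`‖β₁ n₁⁶ + ⋯ + β_s n_s⁶‖ ≤ C · N^(−s/30 + ε)`. -/
theorem small_fractional_parts_sixth_powers (s : ℕ) (hs1 : 1 ≤ s) (hs2 : s ≤ 56)
    (ε : ℝ) (hε : 0 < ε) :
    ∃ C : ℝ, 0 < C ∧ ∃ N₀ : ℕ, ∀ (β : Fin s → ℝ) (N : ℕ), N₀ ≤ N →
      ∃ n : Fin s → ℕ, (∀ i, n i ≤ N) ∧ n ≠ 0 ∧
        nearestIntDist (∑ i, β i * (n i : ℝ) ^ 6) ≤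
          C * (N : ℝ) ^ (-((s : ℝ) / 30) + ε) := by
  by_cases h : ε < (s : ℝ) / 30
  · obtain ⟨N0, h0⟩ := SFP.main_case s hs1 hs2 ε hε h
    refine ⟨1, one_pos, N0, fun β N hN => ?_⟩
    obtain ⟨n, hn1, hn2, hn3⟩ := h0 β N hN
    refine ⟨n, hn1, hn2, ?_⟩
    rw [one_mul]
    exact hn3
  · refine ⟨1, one_pos, 1, fun β N hN => ⟨fun _ => 1, fun _ => hN, ?_, ?_⟩⟩
    · intro h1
      have := congrFun h1 ⟨0, hs1⟩
      simp at this
    · rw [one_mul]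
      have h2 : (1 : ℝ) ≤ (N : ℝ) ^ (-((s : ℝ) / 30) + ε) :=
        Real.one_le_rpow (by exact_mod_cast hN) (by linarith)
      refine le_trans ?_ h2
      have h3 := abs_sub_round (∑ i, β i * ((((fun _ => 1) : Fin s → ℕ) i : ℕ) : ℝ) ^ 6)
      exact le_trans h3 (by norm_num)
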